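/- Let n ≥ 1 and let φ be an automorphism of the free group F_n that grows polynomially of degree d. Then d ≤ n − 1. -/

import Mathlib

open scoped Classical

/-- The minimal word length of a cyclically reduced word representing a conjugate of `g`,
i.e. the minimum of the reduced word lengths over the conjugacy class of `g`. -/
noncomputable def conjLength {n : ℕ} (g : FreeGroup (Fin n)) : ℕ :=
  sInf {m : ℕ | ∃ h : FreeGroup (Fin n), ((h * g * h⁻¹).toWord).length = m}

/-- The conjugacy class of `g` grows polynomially of degree `d` under iteration of `φ`:
`C₁·k^d ≤ |φ^k(g)‾| ≤ C₂·k^d` for all `k ≥ 1`. -/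
def ConjClassGrowsPolyDeg {n : ℕ} (φ : MulAut (FreeGroup (Fin n))) (g : FreeGroup (Fin n))
    (d : ℕ) : Prop :=
  ∃ C₁ C₂ : ℝ, 0 < C₁ ∧ 0 < C₂ ∧ ∀ k : ℕ, 1 ≤ k →
    C₁ * (k : ℝ) ^ d ≤ (conjLength ((φ ^ k) g) : ℝ) ∧
    (conjLength ((φ ^ k) g) : ℝ) ≤ C₂ * (k : ℝ) ^ d

/-- The conjugacy class of `g` grows polynomially of degree at most `d` under `φ`:
`|φ^k(g)‾| ≤ C·k^d` for all `k ≥ 1`. -/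
def ConjClassGrowsAtMost {n : ℕ} (φ : MulAut (FreeGroup (Fin n))) (g : FreeGroup (Fin n))
    (d : ℕ) : Prop :=
  ∃ C : ℝ, 0 < C ∧ ∀ k : ℕ, 1 ≤ k → (conjLength ((φ ^ k) g) : ℝ) ≤ C * (k : ℝ) ^ d

/-- The automorphism `φ` grows polynomially of degree `d`: every conjugacy class grows
polynomially of degree at most `d`, and some conjugacy class grows of degree exactly `d`. -/
def AutGrowsPolyDeg {n : ℕ} (φ : MulAut (FreeGroup (Fin n))) (d : ℕ) : Prop :=
  (∀ g, ConjClassGrowsAtMost φ g d) ∧ ∃ g, ConjClassGrowsPolyDeg φ g d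

/-- `φ` is polynomially growing. -/
def PolyGrowing {n : ℕ} (φ : MulAut (FreeGroup (Fin n))) : Prop :=
  ∃ d : ℕ, AutGrowsPolyDeg φ d

/-- The mapping torus `F_n ⋊_φ ℤ`, where the generator `1` of `ℤ` acts by `φ`. -/
abbrev MappingTorus (n : ℕ) (φ : MulAut (FreeGroup (Fin n))) :=
  SemidirectProduct (FreeGroup (Fin n)) (Multiplicative ℤ)
    (zpowersHom (MulAut (FreeGroup (Fin n))) φ)



structure Tr (F : Type) [Group F] where
  V : Type
  E : Type
  actV : MulAction F V
  actE : MulAction F E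
  src : E → V
  rev : E → E
  U : E → Set V
  rev_rev : ∀ e, rev (rev e) = e
  src_smul : ∀ (g : F) e, src (g • e) = g • src e
  rev_smul : ∀ (g : F) e, rev (g • e) = g • rev e
  U_smul : ∀ (g : F) e x, g • x ∈ U (g • e) ↔ x ∈ U e
  U_rev : ∀ e x, x ∈ U (rev e) ↔ x ∉ U e
  src_notin : ∀ e, src e ∉ U e
  cross : ∀ d e, d ≠ e → d ≠ rev e → (src e ∈ U d ↔ src (rev e) ∈ U d)
  conn : ∀ A : Set V, A.Nonempty → (∀ e, src e ∈ A → src (rev e) ∈ A) → ∀ x, x ∈ A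
  free : ∀ (g : F) (e : E), g • e = e → g = 1
  noinv : ∀ (g : F) (e : E), g • e ≠ rev e
  fin : ∃ S : Set E, S.Finite ∧ ∀ e, ∃ g : F, ∃ s ∈ S, g • s = e
  ne : Nonempty V

attribute [instance] Tr.actV Tr.actE

namespace Tr
variable {F : Type} [Group F] (T : Tr F)

def tgt (e : T.E) : T.V := T.src (T.rev e)

theorem tgt_mem (e : T.E) : T.tgt e ∈ T.U e := by
  by_contra h
  exact T.src_notin (T.rev e) ((T.U_rev _ _).2 h)

theorem tgt_rev (e : T.E) : T.tgt (T.rev e) = T.src e := by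
  unfold tgt; rw [T.rev_rev]

theorem tgt_smul (g : F) (e : T.E) : T.tgt (g • e) = g • T.tgt e := by
  unfold tgt; rw [T.rev_smul, T.src_smul]

theorem rev_inj {a b : T.E} (h : T.rev a = T.rev b) : a = b := by
  rw [← T.rev_rev a, h, T.rev_rev]

theorem U_smul' (g : F) (e : T.E) (x : T.V) : x ∈ T.U (g • e) ↔ g⁻¹ • x ∈ T.U e := by
  rw [← T.U_smul g e, smul_inv_smul]

theorem rev_ne (e : T.E) : T.rev e ≠ e := by
  intro h; exact T.noinv 1 e (by rw [h, one_smul])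

theorem free' {g h : F} {e : T.E} (H : g • e = h • e) : g = h := by
  have := T.free (h⁻¹ * g) e (by rw [mul_smul, H, inv_smul_smul])
  rw [inv_mul_eq_one] at this; exact this.symm

/-- an edge crossing a wall positively is the wall -/
theorem crossing {d e : T.E} (h1 : T.src d ∉ T.U e) (h2 : T.tgt d ∈ T.U e) : d = e := by
  by_contra hne
  by_cases h : e = T.rev d
  · subst h
    rw [T.U_rev] at h1 h2
    exact h2 (T.tgt_mem d)
  · exact h1 ((T.cross e d (Ne.symm hne) h).2 h2)

theorem src_ne_tgt (e : T.E) : T.src e ≠ T.tgt e := by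
  intro h; exact T.src_notin e (h ▸ T.tgt_mem e)

theorem exists_dir {x y : T.V} (h : x ≠ y) : ∃ e, T.src e = x ∧ y ∈ T.U e := by
  have := T.conn {y | y = x ∨ ∃ e, T.src e = x ∧ y ∈ T.U e} ⟨x, Or.inl rfl⟩ ?_ y
  · rcases this with h' | h'
    · exact absurd h'.symm h
    · exact h'
  · intro d hd
    by_cases hx : T.src d = x
    · exact Or.inr ⟨d, hx, T.tgt_mem d⟩
    · rcases hd with hd | ⟨e, he, hde⟩
      · exact absurd hd hx
      · by_cases h1 : e = d
        · subst h1; exact absurd he hx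
        · by_cases h2 : e = T.rev d
          · left; rw [← h2]; exact he
          · exact Or.inr ⟨e, he, (T.cross e d h1 h2).1 hde⟩

theorem disj {a b : T.E} (h : T.src a = T.src b) (hne : a ≠ b) (x : T.V) (h1 : x ∈ T.U a)
    (h2 : x ∈ T.U b) : False := by
  have := T.conn {x | ¬ (x ∈ T.U a ∧ x ∈ T.U b)} ⟨T.src a, fun h => T.src_notin _ h.1⟩ ?_ x
  · exact this ⟨h1, h2⟩
  · rintro d hd ⟨k1, k2⟩
    by_cases h3 : T.src d ∈ T.U a
    · have h4 : T.src d ∉ T.U b := fun h4 => hd ⟨h3, h4⟩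
      have := T.crossing h4 k2
      subst this
      rw [← h] at h3
      exact T.src_notin _ h3
    · have := T.crossing h3 k1
      subst this
      by_cases h4 : T.src d ∈ T.U b
      · rw [h] at h4; exact T.src_notin _ h4
      · exact hne (T.crossing h4 k2)

theorem dir_unique {a b : T.E} {x : T.V} (h : T.src a = T.src b) (h1 : x ∈ T.U a)
    (h2 : x ∈ T.U b) : a = b := by
  by_contra hne; exact T.disj h hne x h1 h2

def seg (x y : T.V) : Set T.E := {e | x ∉ T.U e ∧ y ∈ T.U e}

theorem seg_finite (x y : T.V) : (T.seg x y).Finite := by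
  refine T.conn {y | (T.seg x y).Finite} ⟨x, ?_⟩ ?_ y
  · have : T.seg x x = ∅ := by ext e; simp [seg]
    simp [this]
  · intro d hd
    refine (hd.union (Set.finite_singleton d)).subset ?_
    rintro e ⟨h1, h2⟩
    by_cases h3 : T.src d ∈ T.U e
    · exact Or.inl ⟨h1, h3⟩
    · exact Or.inr (T.crossing h3 h2).symm

theorem seg_nonempty {x y : T.V} (h : x ≠ y) : (T.seg x y).Nonempty := by
  obtain ⟨e, rfl, h2⟩ := T.exists_dir h
  exact ⟨e, T.src_notin _, h2⟩

theorem mem_seg_rev (x y : T.V) (e : T.E) : T.rev e ∈ T.seg x y ↔ e ∈ T.seg y x := by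
  simp only [seg, Set.mem_ofPred_eq, T.U_rev]; tauto

theorem mem_seg_smul (g : F) (x y : T.V) (e : T.E) :
    g • e ∈ T.seg (g • x) (g • y) ↔ e ∈ T.seg x y := by
  simp only [seg, Set.mem_ofPred_eq, T.U_smul]

theorem N1 {k p : T.E} (h1 : T.src k ∉ T.U p) (h2 : T.tgt k ∉ T.U p) {y : T.V} (hy : y ∈ T.U p) :
    y ∈ T.U k ↔ T.tgt p ∈ T.U k := by
  refine T.conn {y | y ∈ T.U p → (y ∈ T.U k ↔ T.tgt p ∈ T.U k)} ⟨T.tgt p, fun _ => Iff.rfl⟩ ?_ y hy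
  intro d hd h3
  by_cases h4 : T.src d ∈ T.U p
  · rw [← hd h4]
    by_cases h5 : k = d
    · subst h5; exact absurd h3 h2
    · by_cases h6 : k = T.rev d
      · subst h6; exact absurd h3 h1
      · exact (T.cross k d h5 h6).symm
  · have := T.crossing h4 h3
    subst this; exact Iff.rfl

theorem dir_sub {p k : T.E} (h1 : T.src p ∉ T.U k) {x : T.V} (h2 : x ∈ T.U k) (h3 : x ∈ T.U p) :
    T.U k ⊆ T.U p := by
  by_cases h4 : T.tgt p ∈ T.U k
  · rw [T.crossing h1 h4]
  · intro y hy
    rw [T.N1 h1 h4 hy, ← T.N1 h1 h4 h2]; exact h3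

/-- peeling the first edge -/
theorem seg_first {x y : T.V} {e : T.E} (h1 : T.src e = x) (h2 : y ∈ T.U e) :
    T.seg x y = insert e (T.seg (T.tgt e) y) ∧ e ∉ T.seg (T.tgt e) y := by
  subst h1
  constructor
  · ext d
    constructor
    · rintro ⟨k1, k2⟩
      by_cases h : T.tgt e ∈ T.U d
      · left; exact (T.crossing k1 h).symm
      · right; exact ⟨h, k2⟩
    · rintro (h | ⟨k1, k2⟩)
      · subst h; exact ⟨T.src_notin _, h2⟩
      · refine ⟨fun h => ?_, k2⟩
        have : T.rev e = d := T.crossing (d := T.rev e) k1 (by rw [tgt_rev]; exact h)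
        subst this
        rw [T.U_rev] at k2; exact k2 h2
  · rintro ⟨k1, _⟩; exact k1 (T.tgt_mem e)

theorem seg_ncard {x y : T.V} {e : T.E} (h1 : T.src e = x) (h2 : y ∈ T.U e) :
    (T.seg x y).ncard = (T.seg (T.tgt e) y).ncard + 1 := by
  rw [(T.seg_first h1 h2).1, Set.ncard_insert_of_notMem (T.seg_first h1 h2).2 (T.seg_finite _ _)]

theorem seg_self (x : T.V) : T.seg x x = ∅ := by ext e; simp [seg]

/-- segment induction, peeling first edges -/
theorem seg_induction {P : T.V → T.V → Prop} (h0 : ∀ x, P x x)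
    (h1 : ∀ (e : T.E) (y : T.V), y ∈ T.U e → P (T.tgt e) y → P (T.src e) y) (x y : T.V) : P x y := by
  generalize hn : (T.seg x y).ncard = n
  induction n generalizing x with
  | zero =>
    by_cases h : x = y
    · subst h; exact h0 x
    · exact absurd hn (Set.ncard_ne_zero_of_mem (T.seg_nonempty h).some_mem (T.seg_finite _ _))
  | succ n ih =>
    by_cases h : x = y
    · subst h; exact h0 x
    · obtain ⟨e, rfl, he⟩ := T.exists_dir h
      exact h1 e y he (ih _ (by have := T.seg_ncard rfl he; omega))

theorem seg_ncard_le (x y z : T.V) :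
    (T.seg x z).ncard ≤ (T.seg x y).ncard + (T.seg y z).ncard := by
  refine (Set.ncard_le_ncard ?_ ((T.seg_finite x y).union (T.seg_finite y z))).trans
    (Set.ncard_union_le _ _)
  rintro e ⟨h1, h2⟩
  by_cases h : y ∈ T.U e
  · exact Or.inl ⟨h1, h⟩
  · exact Or.inr ⟨h, h2⟩

theorem seg_ncard_smul (g : F) (x y : T.V) :
    (T.seg (g • x) (g • y)).ncard = (T.seg x y).ncard := by
  have : T.seg (g • x) (g • y) = (fun e => g • e) '' T.seg x y := by
    ext e
    constructor
    · intro h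
      exact ⟨g⁻¹ • e, by rw [← T.mem_seg_smul g, smul_inv_smul]; exact h, smul_inv_smul _ _⟩
    · rintro ⟨d, hd, rfl⟩; exact (T.mem_seg_smul _ _ _ _).2 hd
  rw [this, Set.ncard_image_of_injective _ (MulAction.injective g)]

theorem seg_single {x y : T.V} {e : T.E} (h : T.seg x y = {e}) : x = T.src e ∧ y = T.tgt e := by
  have hxy : x ≠ y := by
    rintro rfl; rw [seg_self] at h; exact Set.singleton_ne_empty _ h.symm
  obtain ⟨d, rfl, hd⟩ := T.exists_dir hxy
  have : d ∈ T.seg (T.src d) y := ⟨T.src_notin _, hd⟩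
  rw [h] at this
  have := Set.mem_singleton_iff.1 this
  subst this
  refine ⟨rfl, ?_⟩
  by_contra hne
  have := T.seg_nonempty (Ne.symm hne)
  obtain ⟨k, hk⟩ := this
  have h2 := T.seg_first rfl hd
  have : k ∈ T.seg (T.src d) y := by rw [h2.1]; exact Or.inr hk
  rw [h] at this
  have := Set.mem_singleton_iff.1 this
  subst this
  exact h2.2 hk

/-! ### orbits -/
def orb (e : T.E) : Set T.E := {d | ∃ g : F, d = g • e ∨ d = g • T.rev e}

def qs : Setoid T.E where
  r a b := ∃ g : F, b = g • a ∨ b = g • T.rev a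
  iseqv := by
    refine ⟨fun a => ⟨1, Or.inl (one_smul _ _).symm⟩, ?_, ?_⟩
    · rintro a b ⟨g, rfl | rfl⟩
      · exact ⟨g⁻¹, Or.inl (inv_smul_smul _ _).symm⟩
      · exact ⟨g⁻¹, Or.inr (by rw [T.rev_smul, T.rev_rev, inv_smul_smul])⟩
    · rintro a b c ⟨g, rfl | rfl⟩ ⟨h, rfl | rfl⟩
      · exact ⟨h * g, Or.inl (mul_smul _ _ _).symm⟩
      · exact ⟨h * g, Or.inr (by rw [T.rev_smul, mul_smul])⟩
      · exact ⟨h * g, Or.inr (by rw [mul_smul])⟩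
      · exact ⟨h * g, Or.inl (by rw [T.rev_smul, T.rev_rev, mul_smul])⟩

def Q : Type := Quotient T.qs

def cl (e : T.E) : T.Q := Quotient.mk T.qs e

theorem cl_smul (g : F) (e : T.E) : T.cl (g • e) = T.cl e :=
  Quotient.sound (T.qs.symm ⟨g, Or.inl rfl⟩)

theorem cl_rev (e : T.E) : T.cl (T.rev e) = T.cl e :=
  Quotient.sound (T.qs.symm ⟨1, Or.inr (one_smul _ _).symm⟩)

theorem cl_eq {a b : T.E} : T.cl a = T.cl b ↔ ∃ g : F, b = g • a ∨ b = g • T.rev a :=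
  ⟨fun h => Quotient.exact h, fun h => Quotient.sound h⟩

theorem cl_surj : Function.Surjective T.cl := Quotient.exists_rep

instance : Finite T.Q := by
  obtain ⟨S, hS, h⟩ := T.fin
  have : Finite S := hS
  refine Finite.of_surjective (fun s : S => T.cl s) ?_
  intro q
  obtain ⟨e, rfl⟩ := T.cl_surj q
  obtain ⟨g, s, hs, rfl⟩ := h e
  exact ⟨⟨s, hs⟩, (T.cl_smul g s).symm⟩

noncomputable instance : Fintype T.Q := Fintype.ofFinite _

/-- oriented orbits -/
def O : Type := MulAction.orbitRel.Quotient F T.E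
def mkO (e : T.E) : T.O := Quotient.mk (MulAction.orbitRel F T.E) e
theorem mkO_eq {a b : T.E} : T.mkO a = T.mkO b ↔ ∃ g : F, g • b = a := by
  have h : T.mkO a = T.mkO b ↔ MulAction.orbitRel F T.E a b :=
    ⟨fun h => Quotient.exact h, fun h => Quotient.sound h⟩
  rw [h, MulAction.orbitRel_apply, MulAction.mem_orbit_iff]

instance : Finite T.O := by
  obtain ⟨S, hS, h⟩ := T.fin
  have : Finite S := hS
  refine Finite.of_surjective (fun s : S => T.mkO s) ?_
  intro q
  obtain ⟨e, rfl⟩ : ∃ e, T.mkO e = q := Quotient.exists_rep q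
  obtain ⟨g, s, hs, rfl⟩ := h e
  exact ⟨⟨s, hs⟩, T.mkO_eq.2 ⟨g⁻¹, inv_smul_smul _ _⟩⟩

structure Inv (K : Set T.E) : Prop where
  smul : ∀ (g : F) e, e ∈ K → g • e ∈ K
  rev : ∀ e, e ∈ K → T.rev e ∈ K

def NF : Prop := ∀ x : T.V, ∃ g : F, g • x ≠ x
def ECond : Prop := Nonempty T.E ∧ ∀ (d : T.E) (x : T.V), ∃ g : F, g • x ∈ T.U d

theorem NF.nonempty (h : T.NF) : Nonempty T.E := by
  obtain ⟨x⟩ := T.ne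
  obtain ⟨g, hg⟩ := h x
  obtain ⟨e, _⟩ := T.exists_dir hg
  exact ⟨e⟩

end Tr


namespace LA
def Fe {ι : Type} [Fintype ι] (A : ι → ι → ℕ) (l : ℝ) (w : ι → ℝ) : Prop :=
  (∀ i, 0 < w i) ∧ ∀ i, ∑ j, (A i j : ℝ) * w j ≤ l * w i

def Irr {ι : Type} (A : ι → ι → ℕ) : Prop :=
  ∀ B : Set ι, B.Nonempty → (∀ i ∈ B, ∀ j, A i j ≠ 0 → j ∈ B) → ∀ i, i ∈ B

theorem entry {ι : Type} [Fintype ι] {A : ι → ι → ℕ} {l : ℝ} {w : ι → ℝ} (h : Fe A l w) (i j : ι) :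
    (A i j : ℝ) * w j ≤ l * w i :=
  le_trans (Finset.single_le_sum (f := fun j => (A i j : ℝ) * w j)
    (fun k _ => mul_nonneg (Nat.cast_nonneg _) (h.1 k).le) (Finset.mem_univ j)) (h.2 i)

theorem ratio {ι : Type} [Fintype ι] {A : ι → ι → ℕ} {l R : ℝ} {w : ι → ℝ} (h : Fe A l w)
    (hI : Irr A) (hR : 1 ≤ R) (hl : l ≤ R) (i j : ι) :
    w j ≤ R ^ (Fintype.card ι) * w i := by
  have mono : ∀ k x, w x ≤ R ^ k * w i → w x ≤ R ^ (k+1) * w i := by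
    intro k x hx
    refine hx.trans ?_
    have := (h.1 i).le
    gcongr
    omega
  have key : ∀ k : ℕ, (∀ x, w x ≤ R ^ k * w i) ∨
      k + 1 ≤ (Finset.univ.filter (fun x => w x ≤ R ^ k * w i)).card := by
    intro k
    induction k with
    | zero =>
      right
      apply Finset.card_pos.2
      exact ⟨i, by simp⟩
    | succ k ih =>
      rcases ih with ih | ih
      · left; exact fun x => mono k x (ih x)
      · by_cases hc : ∀ x, w x ≤ R ^ (k+1) * w i → w x ≤ R ^ k * w i
        · left
          intro x
          apply mono
          refine hI {x | w x ≤ R ^ k * w i} ⟨i, ?_⟩ ?_ x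
          · show w i ≤ _
            have := h.1 i
            have : 1 ≤ R ^ k := one_le_pow₀ hR
            nlinarith [h.1 i]
          · intro x hx y hy
            apply hc
            have h1 := entry h x y
            have h2 : (1:ℝ) ≤ A x y := by exact_mod_cast Nat.one_le_iff_ne_zero.2 hy
            have h3 : w x ≤ R ^ k * w i := hx
            have h4 := h.1 x
            have h5 := h.1 y
            calc w y ≤ A x y * w y := by nlinarith
              _ ≤ l * w x := h1
              _ ≤ R * w x := by gcongr
              _ ≤ R * (R ^ k * w i) := by gcongr
              _ = _ := by ring
        · right
          push Not at hc
          obtain ⟨y, hy1, hy2⟩ := hc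
          have : (Finset.univ.filter (fun x => w x ≤ R ^ k * w i)) ⊂
              (Finset.univ.filter (fun x => w x ≤ R ^ (k+1) * w i)) := by
            refine (Finset.ssubset_iff_of_subset ?_).2 ⟨y, by simp [hy1], by simp [hy2]⟩
            intro x; simp only [Finset.mem_filter, Finset.mem_univ, true_and]
            exact mono k x
          have := Finset.card_lt_card this
          omega
  rcases key (Fintype.card ι) with h1 | h1
  · exact h1 j
  · have := Finset.card_le_univ (Finset.univ.filter (fun x => w x ≤ R ^ (Fintype.card ι) * w i))
    omega

theorem Fe.smul {ι : Type} [Fintype ι] {A : ι → ι → ℕ} {l : ℝ} {w : ι → ℝ} (h : Fe A l w) {c : ℝ}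
    (hc : 0 < c) : Fe A l (fun i => c * w i) := by
  refine ⟨fun i => mul_pos hc (h.1 i), fun i => ?_⟩
  have := mul_le_mul_of_nonneg_left (h.2 i) hc.le
  rw [Finset.mul_sum] at this
  calc _ = ∑ j, c * ((A i j : ℝ) * w j) := by congr 1; ext j; ring
    _ ≤ _ := this
    _ = _ := by ring

theorem nonneg {ι : Type} [Fintype ι] {A : ι → ι → ℕ} {l : ℝ} {w : ι → ℝ} (h : Fe A l w) (i : ι) :
    0 ≤ l := by
  have h1 := entry h i i
  have : 0 ≤ (A i i : ℝ) * w i := mul_nonneg (Nat.cast_nonneg _) (h.1 i).le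
  have := h.1 i
  by_contra hl
  push Not at hl
  nlinarith

theorem min_one {ι : Type} [Fintype ι] [Nonempty ι] {A : ι → ι → ℕ} (hI : Irr A)
    (h : ∃ l w, Fe A l w) : ∃ l w, Fe A l w ∧ ∀ l' w', Fe A l' w' → l ≤ l' := by
  obtain ⟨l0, w0, h0⟩ := h
  obtain ⟨i0⟩ := ‹Nonempty ι›
  set R : ℝ := max 1 l0
  have hR : 1 ≤ R := le_max_left _ _
  set c : ℝ := R ^ (Fintype.card ι)
  have hc : 0 < c := by positivity
  let K : Set (ℝ × (ι → ℝ)) := (Set.Icc 0 R ×ˢ Set.Icc (fun _ => c⁻¹) (fun _ => c)) ∩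
    {p | ∀ i, ∑ j, (A i j : ℝ) * p.2 j ≤ p.1 * p.2 i}
  have hK : IsCompact K := by
    apply IsCompact.inter_right
    · exact isCompact_Icc.prod isCompact_Icc
    · have : {p : ℝ × (ι → ℝ) | ∀ i, ∑ j, (A i j : ℝ) * p.2 j ≤ p.1 * p.2 i} =
        ⋂ i, {p : ℝ × (ι → ℝ) | ∑ j, (A i j : ℝ) * p.2 j ≤ p.1 * p.2 i} := by
        ext; simp
      rw [this]
      refine isClosed_iInter fun i => isClosed_le ?_ ?_ <;> fun_prop
  have mem : ∀ l w, Fe A l w → l ≤ R → ∃ w', (l, w') ∈ K := by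
    intro l w hw hl
    refine ⟨fun i => (w i0)⁻¹ * w i, ⟨⟨nonneg hw i0, hl⟩, ?_, ?_⟩, ?_⟩
    · intro i
      have := ratio hw hI hR hl i i0
      have h1 := hw.1 i0
      show c⁻¹ ≤ (w i0)⁻¹ * w i
      rw [inv_mul_eq_div, le_div_iff₀ h1, inv_mul_le_iff₀ hc]
      exact this
    · intro i
      have := ratio hw hI hR hl i0 i
      have h1 := hw.1 i0
      show (w i0)⁻¹ * w i ≤ c
      rw [inv_mul_le_iff₀ h1, mul_comm]
      exact this
    · exact (hw.smul (inv_pos.2 (hw.1 i0))).2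
  obtain ⟨w1, hw1⟩ := mem l0 w0 h0 (le_max_right _ _)
  obtain ⟨⟨l, w⟩, hp, hmin⟩ := hK.exists_isMinOn ⟨_, hw1⟩ (f := Prod.fst) continuous_fst.continuousOn
  refine ⟨l, w, ⟨fun i => ?_, hp.2⟩, ?_⟩
  · exact lt_of_lt_of_le (inv_pos.2 hc) (hp.1.2.1 i)
  · intro l' w' hw'
    by_cases hl : l' ≤ R
    · obtain ⟨w2, hw2⟩ := mem l' w' hw' hl
      exact hmin hw2
    · have : l ≤ R := hp.1.1.2
      linarith

theorem min_exists (N : ℕ) (P : (m : ℕ) → (Fin m → Fin m → ℕ) → Prop)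
    (hP : ∀ m A, P m A → m ≤ N ∧ 0 < m ∧ Irr A)
    (h : ∃ m A l w, P m A ∧ Fe A l w) :
    ∃ m A l w, P m A ∧ Fe A l w ∧ ∀ m' A' l' w', P m' A' → Fe A' l' w' → l ≤ l' := by
  obtain ⟨m0, A0, l0, w0, hP0, h0⟩ := h
  set R : ℝ := max 1 l0
  have hR : 1 ≤ R := le_max_left _ _
  let X : Set (Σ m : ℕ, (Fin m → Fin m → ℕ)) := {x | P x.1 x.2 ∧ ∃ l w, Fe x.2 l w ∧ l ≤ R}
  obtain ⟨b, hb⟩ := exists_nat_ge (R * R ^ N)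
  have hX : X.Finite := by
    refine Set.Finite.subset (s := ⋃ m ∈ Set.Iic N, Sigma.mk m '' Set.Iic (fun _ _ => b)) ?_ ?_
    · exact (Set.finite_Iic N).biUnion fun m _ => (Set.finite_Iic _).image _
    · rintro ⟨m, A⟩ ⟨hx, l, w, hF, hl⟩
      obtain ⟨hm, hm0, hI⟩ := hP m A hx
      simp only [Set.mem_iUnion]
      refine ⟨m, hm, A, ?_, rfl⟩
      intro i j
      have h1 := entry hF i j
      have h2 := ratio hF hI hR hl j i
      have h3 := hF.1 j
      have h4 := hF.1 i
      have h5 : R ^ m ≤ R ^ N := pow_le_pow_right₀ hR hm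
      rw [Fintype.card_fin] at h2
      have : (A i j : ℝ) * w j ≤ (R * R ^ N) * w j := by
        calc _ ≤ l * w i := h1
          _ ≤ R * w i := by gcongr
          _ ≤ R * (R ^ m * w j) := by gcongr
          _ ≤ R * (R ^ N * w j) := by gcongr
          _ = _ := by ring
      have := le_of_mul_le_mul_right this h3
      exact_mod_cast this.trans hb
  have key : ∀ x : (Σ m : ℕ, (Fin m → Fin m → ℕ)), x ∈ X → ∃ l w, Fe x.2 l w ∧ ∀ l' w', Fe x.2 l' w' → l ≤ l' := by
    rintro ⟨m, A⟩ ⟨hx, l, w, hF, hl⟩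
    obtain ⟨hm, hm0, hI⟩ := hP m A hx
    have : Nonempty (Fin m) := ⟨⟨0, hm0⟩⟩
    exact min_one hI ⟨l, w, hF⟩
  choose! v hv using key
  obtain ⟨⟨m, A⟩, hx, hmin⟩ := Set.exists_min_image X v hX ⟨⟨m0, A0⟩, hP0, l0, w0, h0, le_max_right _ _⟩
  obtain ⟨w, hF, hm⟩ := hv _ hx
  refine ⟨m, A, _, w, hx.1, hF, ?_⟩
  have hvR : v ⟨m, A⟩ ≤ R := by
    obtain ⟨_, l, w', h1, h2⟩ := hx
    exact (hm _ _ h1).trans h2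
  intro m' A' l' w' hP' hF'
  by_cases hl : l' ≤ R
  · have hx' : (⟨m', A'⟩ : Σ m : ℕ, (Fin m → Fin m → ℕ)) ∈ X := ⟨hP', l', w', hF', hl⟩
    obtain ⟨w'', _, hm'⟩ := hv _ hx'
    exact (hmin _ hx').trans (hm' _ _ hF')
  · linarith

theorem decrease {ι : Type} [Fintype ι] {A : ι → ι → ℕ} {l : ℝ} (w : ι → ℝ) (h : Fe A l w)
    (hs : ∀ B : Set ι, B.Nonempty → (∀ i ∈ B, ∀ j, A i j ≠ 0 → j ∈ B) →
      ∃ i ∈ B, ∑ j, (A i j : ℝ) * w j < l * w i) :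
    ∃ l' w', l' < l ∧ Fe A l' w' := by
  generalize hn : (Finset.univ.filter (fun i => ¬ ∑ j, (A i j : ℝ) * w j < l * w i)).card = n
  induction n using Nat.strong_induction_on generalizing w with
  | _ n ih =>
  by_cases hN : ∀ i, ∑ j, (A i j : ℝ) * w j < l * w i
  · have : ∀ s : Finset ι, ∃ l' < l, ∀ i ∈ s, ∑ j, (A i j : ℝ) * w j ≤ l' * w i := by
      intro s
      induction s using Finset.induction_on with
      | empty => exact ⟨l - 1, by linarith, by simp⟩
      | insert a s _ ih =>
        obtain ⟨l', h1, h2⟩ := ih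
        refine ⟨max l' ((∑ j, (A a j : ℝ) * w j) / w a), ?_, ?_⟩
        · rw [max_lt_iff]
          exact ⟨h1, by rw [div_lt_iff₀ (h.1 a)]; exact hN a⟩
        · intro i hi
          rcases Finset.mem_insert.1 hi with rfl | hi
          · rw [← div_le_iff₀ (h.1 i)]; exact le_max_right _ _
          · exact (h2 i hi).trans (mul_le_mul_of_nonneg_right (le_max_left _ _) (h.1 i).le)
    obtain ⟨l', h1, h2⟩ := this Finset.univ
    exact ⟨l', w, h1, h.1, fun i => h2 i (Finset.mem_univ _)⟩
  · push Not at hN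
    obtain ⟨i0, hi0⟩ := hN
    have : ∃ i j, ¬ (∑ j, (A i j : ℝ) * w j < l * w i) ∧ A i j ≠ 0 ∧ ∑ k, (A j k : ℝ) * w k < l * w j := by
      by_contra hcon
      push Not at hcon
      obtain ⟨i, hi1, hi2⟩ := hs {i | ¬ (∑ j, (A i j : ℝ) * w j < l * w i)} ⟨i0, not_lt.2 hi0⟩
        (fun i hi j hj => not_lt.2 (hcon i j (not_lt.1 hi) hj))
      exact hi1 hi2
    obtain ⟨i, j, hi, hij, hj⟩ := this
    set gap := l * w j - ∑ k, (A j k : ℝ) * w k with hgap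
    have hgap0 : 0 < gap := by linarith
    set ε := min (w j / 2) (gap / (2 * (|l| + 1))) with hε
    have hε0 : 0 < ε := lt_min (by linarith [h.1 j]) (by positivity)
    have hε1 : ε ≤ w j / 2 := min_le_left _ _
    have hε2 : l * ε < gap := by
      have h1 : ε ≤ gap / (2 * (|l| + 1)) := min_le_right _ _
      rw [le_div_iff₀ (by positivity)] at h1
      have h2 := le_abs_self l
      have h3 := abs_nonneg l
      nlinarith
    set w' : ι → ℝ := Function.update w j (w j - ε) with hw'
    have hle : ∀ k, w' k ≤ w k := by
      intro k
      by_cases hk : k = j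
      · subst hk; simp [hw', hε0.le]
      · simp [hw', hk]
    have hsum : ∀ a, ∑ k, (A a k : ℝ) * w' k ≤ ∑ k, (A a k : ℝ) * w k := fun a =>
      Finset.sum_le_sum fun k _ => mul_le_mul_of_nonneg_left (hle k) (Nat.cast_nonneg _)
    have hrow : ∀ a, ∑ k, (A a k : ℝ) * w k < l * w a → ∑ k, (A a k : ℝ) * w' k < l * w' a := by
      intro a ha
      by_cases hk : a = j
      · subst hk
        have : w' a = w a - ε := by simp [hw']
        rw [this]
        have := hsum a
        nlinarith
      · have : w' a = w a := by simp [hw', hk]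
        rw [this]
        exact (hsum a).trans_lt ha
    have hF' : Fe A l w' := by
      constructor
      · intro k
        by_cases hk : k = j
        · subst hk; simp only [hw', Function.update_self]; linarith [h.1 k]
        · simp only [hw', Function.update_of_ne hk]; exact h.1 k
      · intro a
        by_cases ha : ∑ k, (A a k : ℝ) * w k < l * w a
        · exact (hrow a ha).le
        · have hk : a ≠ j := by rintro rfl; exact ha hj
          have : w' a = w a := by simp [hw', hk]
          rw [this]
          exact (hsum a).trans (h.2 a)
    have hi' : ∑ k, (A i k : ℝ) * w' k < l * w' i := by
      have hk : i ≠ j := by rintro rfl; exact hi hj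
      have : w' i = w i := by simp [hw', hk]
      rw [this]
      refine lt_of_lt_of_le ?_ (h.2 i)
      refine Finset.sum_lt_sum (fun k _ => mul_le_mul_of_nonneg_left (hle k) (Nat.cast_nonneg _))
        ⟨j, Finset.mem_univ _, ?_⟩
      have h1 : (0:ℝ) < A i j := by exact_mod_cast Nat.pos_of_ne_zero hij
      apply mul_lt_mul_of_pos_left _ h1
      simp [hw', hε0]
    refine ih _ ?_ w' hF' ?_ rfl
    · rw [← hn]
      apply Finset.card_lt_card
      refine (Finset.ssubset_iff_of_subset ?_).2 ⟨i, by simpa using hi, by simpa using hi'⟩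
      intro a
      simp only [Finset.mem_filter, Finset.mem_univ, true_and]
      exact mt (hrow a)
    · intro B hB hB'
      obtain ⟨a, ha, ha'⟩ := hs B hB hB'
      exact ⟨a, ha, hrow a ha'⟩
end LA


structure Sys {F : Type} [Group F] (φ : MulAut F) extends Tr F where
  f : V → V
  f_smul : ∀ (g : F) x, f (g • x) = φ g • f x

namespace Sys
variable {F : Type} [Group F] {φ : MulAut F} (S : Sys φ)

def C (d : S.E) : Set S.E := S.f ⁻¹' (S.U d) |> fun A => {e | S.src e ∉ A ∧ S.tgt e ∈ A}

theorem mem_C {d e : S.E} : e ∈ S.C d ↔ S.f (S.src e) ∉ S.U d ∧ S.f (S.tgt e) ∈ S.U d := Iff.rfl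

theorem mem_C_seg {d e : S.E} : e ∈ S.C d ↔ d ∈ S.seg (S.f (S.src e)) (S.f (S.tgt e)) := Iff.rfl

theorem mem_C_smul (g : F) (d e : S.E) : g • e ∈ S.C (φ g • d) ↔ e ∈ S.C d := by
  rw [mem_C, mem_C, S.src_smul, S.tgt_smul, S.f_smul, S.f_smul, S.U_smul, S.U_smul]

theorem mem_C_smul' (g : F) (d e : S.E) : g • e ∈ S.C d ↔ e ∈ S.C ((φ g)⁻¹ • d) := by
  conv_lhs => rw [← smul_inv_smul (φ g) d, mem_C_smul]

theorem mem_C_rev (d e : S.E) : S.rev e ∈ S.C (S.rev d) ↔ e ∈ S.C d := by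
  rw [mem_C, mem_C, S.U_rev, S.U_rev, S.tgt_rev]
  show ¬ (S.f (S.tgt e) ∉ _) ∧ _ ↔ _
  tauto

theorem C_finite (d : S.E) : (S.C d).Finite := by
  obtain ⟨R, hR, h⟩ := S.fin
  refine Set.Finite.subset (s := ⋃ s ∈ R, (fun g : F => g • s) ''
    {g | (φ g)⁻¹ • d ∈ S.seg (S.f (S.src s)) (S.f (S.tgt s))}) ?_ ?_
  · refine hR.biUnion fun s _ => Set.Finite.image _ ?_
    refine Set.Finite.preimage (f := fun g => (φ g)⁻¹ • d) ?_ (S.seg_finite _ _)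
    intro a _ b _ hab
    exact φ.injective (inv_injective (S.free' hab))
  · intro e he
    obtain ⟨g, s, hs, rfl⟩ := h e
    simp only [Set.mem_iUnion]
    refine ⟨s, hs, g, ?_, rfl⟩
    rwa [mem_C_smul'] at he

noncomputable def Cf (d : S.E) : Finset S.E := (S.C_finite d).toFinset

@[simp] theorem mem_Cf {d e : S.E} : e ∈ S.Cf d ↔ e ∈ S.C d := by simp [Cf]

theorem Cf_smul (g : F) (d : S.E) : S.Cf (φ g • d) = (S.Cf d).image (fun e => g • e) := by
  ext e
  simp only [mem_Cf, Finset.mem_image]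
  constructor
  · intro h
    exact ⟨g⁻¹ • e, by rw [← S.mem_C_smul g, smul_inv_smul]; exact h, smul_inv_smul _ _⟩
  · rintro ⟨e, h, rfl⟩; exact (S.mem_C_smul _ _ _).2 h

theorem Cf_rev (d : S.E) : S.Cf (S.rev d) = (S.Cf d).image S.rev := by
  ext e
  simp only [mem_Cf, Finset.mem_image]
  constructor
  · intro h
    exact ⟨S.rev e, by rw [← mem_C_rev, S.rev_rev]; exact h, S.rev_rev _⟩
  · rintro ⟨e, h, rfl⟩; exact (S.mem_C_rev _ _).2 h

noncomputable def cost (w : S.E → ℝ) (d : S.E) : ℝ := ∑ e ∈ S.Cf d, w e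

structure WInv (w : S.E → ℝ) : Prop where
  smul : ∀ (g : F) e, w (g • e) = w e
  rev : ∀ e, w (S.rev e) = w e

theorem cost_smul {w : S.E → ℝ} (hw : S.WInv w) (g : F) (d : S.E) :
    S.cost w (g • d) = S.cost w d := by
  obtain ⟨h, rfl⟩ := φ.surjective g
  unfold cost
  rw [Cf_smul, Finset.sum_image (fun a _ b _ hab => MulAction.injective h hab)]
  exact Finset.sum_congr rfl fun e _ => hw.smul _ _

theorem cost_rev {w : S.E → ℝ} (hw : S.WInv w) (d : S.E) :
    S.cost w (S.rev d) = S.cost w d := by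
  unfold cost
  rw [Cf_rev, Finset.sum_image (fun a _ b _ hab => S.rev_inj hab)]
  exact Finset.sum_congr rfl fun e _ => hw.rev _

theorem WInv.eq {S : Sys φ} {w : S.E → ℝ} (hw : S.WInv w) {a b : S.E} (h : S.cl a = S.cl b) : w a = w b := by
  obtain ⟨g, rfl | rfl⟩ := S.cl_eq.1 h
  · rw [hw.smul]
  · rw [hw.smul, hw.rev]

theorem cost_eq {w : S.E → ℝ} (hw : S.WInv w) {a b : S.E} (h : S.cl a = S.cl b) :
    S.cost w a = S.cost w b := by
  obtain ⟨g, rfl | rfl⟩ := S.cl_eq.1 h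
  · rw [S.cost_smul hw]
  · rw [S.cost_smul hw, S.cost_rev hw]

theorem winv_cl (w : S.Q → ℝ) : S.WInv (fun e => w (S.cl e)) :=
  ⟨fun g e => by rw [S.cl_smul], fun e => by rw [S.cl_rev]⟩

noncomputable def rep (q : S.Q) : S.E := (S.cl_surj q).choose
theorem cl_rep (q : S.Q) : S.cl (S.rep q) = q := (S.cl_surj q).choose_spec

noncomputable def M (q r : S.Q) : ℕ := ((S.Cf (S.rep q)).filter (fun e => S.cl e = r)).card

theorem cost_M (w : S.Q → ℝ) (q : S.Q) :
    S.cost (fun e => w (S.cl e)) (S.rep q) = ∑ r, (S.M q r : ℝ) * w r := by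
  unfold cost
  rw [← Finset.sum_fiberwise (S.Cf (S.rep q)) S.cl]
  refine Finset.sum_congr rfl fun r _ => ?_
  rw [Finset.sum_congr rfl (g := fun _ => w r) (fun e he => by rw [(Finset.mem_filter.1 he).2])]
  rw [Finset.sum_const, nsmul_eq_mul]
  rfl

structure FeE (l : ℝ) (w : S.E → ℝ) : Prop where
  inv : S.WInv w
  pos : ∀ e, 0 < w e
  le : ∀ d, S.cost w d ≤ l * w d

theorem FeE.cl {S : Sys φ} {l : ℝ} {w : S.E → ℝ} (h : S.FeE l w) :
    (fun e => w (S.rep (S.cl e))) = w := by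
  ext e; exact h.inv.eq (S.cl_rep _)

theorem FeE.toQ {S : Sys φ} {l : ℝ} {w : S.E → ℝ} (h : S.FeE l w) : LA.Fe S.M l (fun q => w (S.rep q)) := by
  refine ⟨fun q => h.pos _, fun q => ?_⟩
  rw [← S.cost_M (fun q => w (S.rep q)) q, h.cl]
  exact h.le _

theorem FeE.ofQ {l : ℝ} {w : S.Q → ℝ} (h : LA.Fe S.M l w) : S.FeE l (fun e => w (S.cl e)) := by
  refine ⟨S.winv_cl w, fun e => h.1 _, fun d => ?_⟩
  rw [S.cost_eq (S.winv_cl w) (S.cl_rep (S.cl d)).symm, S.cost_M]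
  exact h.2 _

structure Closed (B : Set S.E) : Prop extends S.Inv B where
  cl : ∀ d ∈ B, ∀ e ∈ S.C d, e ∈ B

def Irr : Prop := ∀ B, S.Closed B → B.Nonempty → ∀ e, e ∈ B

theorem closed_of_Q {B : Set S.Q} (h : ∀ i ∈ B, ∀ j, S.M i j ≠ 0 → j ∈ B) :
    S.Closed (S.cl ⁻¹' B) := by
  have h1 : S.Inv (S.cl ⁻¹' B) := ⟨fun g e he => by
    show S.cl _ ∈ B
    rw [S.cl_smul]; exact he, fun e he => by
    show S.cl _ ∈ B
    rw [S.cl_rev]; exact he⟩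
  refine ⟨h1, ?_⟩
  intro d hd e he
  have : ∃ e' ∈ S.C (S.rep (S.cl d)), S.cl e' = S.cl e := by
    obtain ⟨g, hg⟩ := S.cl_eq.1 (S.cl_rep (S.cl d)).symm
    obtain ⟨g, rfl⟩ := φ.surjective g
    rcases hg with hg | hg
    · exact ⟨g • e, by rw [hg, mem_C_smul]; exact he, S.cl_smul _ _⟩
    · exact ⟨g • S.rev e, by rw [hg, mem_C_smul, mem_C_rev]; exact he, by rw [S.cl_smul, S.cl_rev]⟩
  obtain ⟨e', h2, h3⟩ := this
  refine h _ hd _ ?_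
  unfold M
  rw [← Nat.pos_iff_ne_zero, Finset.card_pos]
  exact ⟨e', Finset.mem_filter.2 ⟨by simpa using h2, h3⟩⟩

theorem Irr.toQ {S : Sys φ} (h : S.Irr) : LA.Irr S.M := by
  intro B ⟨q, hq⟩ hB i
  have := h _ (S.closed_of_Q hB) ⟨S.rep q, by show S.cl _ ∈ B; rw [cl_rep]; exact hq⟩ (S.rep i)
  have h2 : S.cl (S.rep i) ∈ B := this
  rwa [cl_rep] at h2

theorem decrease {l : ℝ} {w : S.E → ℝ} (h : S.FeE l w)
    (hs : ∀ B, S.Closed B → B.Nonempty → ∃ d ∈ B, S.cost w d < l * w d) :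
    ∃ l' w', l' < l ∧ S.FeE l' w' := by
  obtain ⟨l', w', h1, h2⟩ := LA.decrease _ h.toQ (by
    intro B ⟨q, hq⟩ hB
    obtain ⟨d, hd, hd'⟩ := hs _ (S.closed_of_Q hB) ⟨S.rep q, by show S.cl _ ∈ B; rw [cl_rep]; exact hq⟩
    refine ⟨S.cl d, hd, ?_⟩
    rw [← S.cost_M (fun q => w (S.rep q)), h.cl, h.inv.eq (S.cl_rep _), S.cost_eq h.inv (S.cl_rep _)]
    exact hd')
  exact ⟨l', _, h1, FeE.ofQ S h2⟩

end Sys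


namespace Tr
variable {F : Type} [Group F] (T : Tr F)

def ks (K : Set T.E) : Setoid T.V where
  r x y := ∀ d ∈ K, (x ∈ T.U d ↔ y ∈ T.U d)
  iseqv := ⟨fun _ _ _ => Iff.rfl, fun h d hd => (h d hd).symm,
    fun h h' d hd => (h d hd).trans (h' d hd)⟩

theorem ks_iff {K : Set T.E} {x y : T.V} : T.ks K x y ↔ ∀ d ∈ K, (x ∈ T.U d ↔ y ∈ T.U d) := Iff.rfl

theorem ks_smul {K : Set T.E} (hK : T.Inv K) (g : F) {x y : T.V} (h : T.ks K x y) :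
    T.ks K (g • x) (g • y) := by
  intro d hd
  have := h (g⁻¹ • d) (hK.smul _ _ hd)
  rwa [T.U_smul', T.U_smul', inv_inv] at this

theorem ks_edge {K : Set T.E} (hK : T.Inv K) {e : T.E} (he : e ∉ K) :
    T.ks K (T.src e) (T.tgt e) := by
  intro d hd
  refine T.cross d e ?_ ?_
  · rintro rfl; exact he hd
  · rintro rfl; exact he (by rw [← T.rev_rev e]; exact hK.rev _ hd)

theorem ks_const {K : Set T.E} (hK : T.Inv K) {X : Type} (h : T.V → X)
    (hh : ∀ e, e ∉ K → h (T.src e) = h (T.tgt e)) (x y : T.V) : T.ks K x y → h x = h y := by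
  refine T.seg_induction (P := fun x y => T.ks K x y → h x = h y) (fun _ _ => rfl) ?_ x y
  intro e y hy ih hk
  have he : e ∉ K := fun he => T.src_notin e ((hk e he).2 hy)
  rw [hh e he]
  exact ih ((T.ks K).trans ((T.ks K).symm (T.ks_edge hK he)) hk)

def quot (K : Set T.E) (hK : T.Inv K) : Tr F where
  V := Quotient (T.ks K)
  E := K
  actV :=
    { smul := fun g => Quotient.map (fun x => g • x) (fun _ _ h => T.ks_smul hK g h)
      one_smul := by
        rintro ⟨x⟩; exact congrArg (Quotient.mk (T.ks K)) (one_smul F x)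
      mul_smul := by
        rintro g h ⟨x⟩; exact congrArg (Quotient.mk (T.ks K)) (mul_smul g h x) }
  actE :=
    { smul := fun g e => ⟨g • e.1, hK.smul _ _ e.2⟩
      one_smul := fun e => Subtype.ext (one_smul F e.1)
      mul_smul := fun g h e => Subtype.ext (mul_smul g h e.1) }
  src e := Quotient.mk _ (T.src e.1)
  rev e := ⟨T.rev e.1, hK.rev _ e.2⟩
  U e := {q | Quotient.lift (fun x => x ∈ T.U e.1) (fun _ _ h => propext (T.ks_iff.1 h e.1 e.2)) q}
  rev_rev e := Subtype.ext (T.rev_rev e.1)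
  src_smul g e := congrArg (Quotient.mk (T.ks K)) (T.src_smul g e.1)
  rev_smul g e := Subtype.ext (T.rev_smul g e.1)
  U_smul := by rintro g e ⟨x⟩; exact T.U_smul g e.1 x
  U_rev := by rintro e ⟨x⟩; exact T.U_rev e.1 x
  src_notin e := T.src_notin e.1
  cross d e h1 h2 := T.cross d.1 e.1 (fun h => h1 (Subtype.ext h)) (fun h => h2 (Subtype.ext h))
  conn := by
    rintro A ⟨⟨x0⟩, hx0⟩ hA ⟨x⟩
    refine T.conn {x | (Quotient.mk (T.ks K) x) ∈ A} ⟨x0, hx0⟩ ?_ x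
    intro e he
    by_cases h : e ∈ K
    · exact hA ⟨e, h⟩ he
    · show Quotient.mk (T.ks K) (T.tgt e) ∈ A
      rw [← Quotient.sound (s := T.ks K) (T.ks_edge hK h)]; exact he
  free g e h := T.free g e.1 (congrArg Subtype.val h)
  noinv g e h := T.noinv g e.1 (congrArg Subtype.val h)
  fin := by
    obtain ⟨R, hR, h⟩ := T.fin
    refine ⟨Subtype.val ⁻¹' R, hR.preimage Subtype.val_injective.injOn, ?_⟩
    intro e
    obtain ⟨g, s, hs, hge⟩ := h e.1
    refine ⟨g, ⟨s, ?_⟩, hs, Subtype.ext hge⟩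
    have := hK.smul g⁻¹ _ e.2
    rwa [← hge, inv_smul_smul] at this
  ne := ⟨Quotient.mk _ T.ne.some⟩

variable {K : Set T.E} (hK : T.Inv K)

def pr (x : T.V) : (T.quot K hK).V := Quotient.mk (T.ks K) x
theorem pr_surj : Function.Surjective (T.pr hK) := Quotient.exists_rep
theorem pr_eq {x y : T.V} : T.pr hK x = T.pr hK y ↔ T.ks K x y :=
  ⟨fun h => Quotient.exact h, fun h => Quotient.sound h⟩
theorem smul_pr (g : F) (x : T.V) : g • T.pr hK x = T.pr hK (g • x) := rfl
theorem mem_quot_U (e : (T.quot K hK).E) (x : T.V) :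
    T.pr hK x ∈ (T.quot K hK).U e ↔ x ∈ T.U e.1 := Iff.rfl
theorem quot_tgt (e : (T.quot K hK).E) : (T.quot K hK).tgt e = T.pr hK (T.tgt e.1) := rfl
theorem quot_src (e : (T.quot K hK).E) : (T.quot K hK).src e = T.pr hK (T.src e.1) := rfl

theorem ECond.quot {T : Tr F} (h : T.ECond) {K : Set T.E} (hK : T.Inv K) (hne : K.Nonempty) :
    (T.quot K hK).ECond := by
  refine ⟨⟨⟨_, hne.some_mem⟩⟩, fun d x => ?_⟩
  obtain ⟨x, rfl⟩ := T.pr_surj hK x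
  exact h.2 d.1 x

theorem card_quot {e0 : T.E} (he : e0 ∉ K) :
    Nat.card (T.quot K hK).Q < Nat.card T.Q := by
  rw [Nat.card_eq_fintype_card, Nat.card_eq_fintype_card]
  have hmem : ∀ (q : (T.quot K hK).Q), ∃ e, (T.quot K hK).cl e = q := (T.quot K hK).cl_surj
  choose r hr using hmem
  refine Fintype.card_lt_of_injective_of_notMem (fun q => T.cl (r q).1) ?_ (b := T.cl e0) ?_
  · intro a b hab
    rw [← hr a, ← hr b]
    obtain ⟨g, h | h⟩ := T.cl_eq.1 hab
    · exact (T.quot K hK).cl_eq.2 ⟨g, Or.inl (Subtype.ext h)⟩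
    · exact (T.quot K hK).cl_eq.2 ⟨g, Or.inr (Subtype.ext h)⟩
  · rintro ⟨q, hq⟩
    obtain ⟨g, h | h⟩ := T.cl_eq.1 hq
    · exact he (h ▸ hK.smul _ _ (r q).2)
    · exact he (h ▸ hK.smul _ _ (hK.rev _ (r q).2))

theorem econd_of_leafless (hE : Nonempty T.E)
    (h : ∀ c, ∃ c', T.src c' = T.src c ∧ c' ≠ c) : T.ECond := by
  refine ⟨hE, ?_⟩
  intro d x
  choose nx h1 h2 using fun c => h (T.rev c)
  have hsub : ∀ c, T.U (nx c) ⊆ T.U c := by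
    intro c y hy
    by_contra hc
    rw [← T.U_rev] at hc
    exact T.disj (h1 c) (h2 c) y hy hc
  have hss : ∀ c, T.tgt c ∉ T.U (nx c) := by
    intro c hc
    have : T.tgt c = T.src (nx c) := (h1 c).symm
    rw [this] at hc; exact T.src_notin _ hc
  have hmono : ∀ k j, T.U (nx^[k + j] d) ⊆ T.U (nx^[j] d) := by
    intro k j
    induction k with
    | zero => simp
    | succ k ih =>
      rw [show k + 1 + j = (k + j) + 1 by omega, Function.iterate_succ_apply']
      exact (hsub _).trans ih
  obtain ⟨a, b, hab, heq⟩ := Finite.exists_ne_map_eq_of_infinite (fun i : ℕ => T.mkO (nx^[i] d))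
  wlog hlt : a < b generalizing a b
  · exact this b a hab.symm heq.symm (by omega)
  obtain ⟨g, hg⟩ := T.mkO_eq.1 heq
  -- g • d_b = d_a
  set e := nx^[a] d with he
  have hbsub : T.U (nx^[b] d) ⊆ T.U (nx e) := by
    have := hmono (b - (a + 1)) (a + 1)
    rw [show b - (a+1) + (a+1) = b by omega, Function.iterate_succ_apply'] at this
    exact this
  have hb : nx^[b] d = g⁻¹ • e := by rw [← hg, inv_smul_smul]
  rw [hb] at hbsub
  have step : ∀ k : ℕ, T.U e ⊆ T.U (g ^ k • e) := by
    intro k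
    induction k with
    | zero => simp
    | succ k ih =>
      intro y hy
      have hy' := ih hy
      rw [T.U_smul'] at hy' ⊢
      have h3 : g⁻¹ • ((g ^ k)⁻¹ • y) ∈ T.U (g⁻¹ • e) := (T.U_smul _ _ _).2 hy'
      have h4 := hsub _ (hbsub h3)
      rwa [← mul_smul, ← mul_inv_rev, ← pow_succ] at h4
  by_contra hcon
  push Not at hcon
  have hinj : Function.Injective (fun k : ℕ => g ^ k • e) := by
    have key : ∀ k j : ℕ, k < j → g ^ k • e ≠ g ^ j • e := by
      intro k j hkj h
      have h5 : e = g ^ (j - k) • e := by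
        have : g ^ j = g ^ k * g ^ (j - k) := by rw [← pow_add]; congr 1; omega
        rw [this, mul_smul] at h
        exact MulAction.injective _ h
      have h6 : T.U (g • e) ⊆ T.U e := by
        intro y hy
        have := (T.U_smul (g ^ (j-k-1)) (g • e) y).2 hy
        rw [← mul_smul, ← pow_succ, show j - k - 1 + 1 = j - k by omega, ← h5] at this
        -- g^(j-k-1) y ∈ U e
        have h7 := step (j - k - 1) |> fun _ => this
        have h8 : T.U (g • e) ⊆ T.U e := by
          have h10 : ∀ i : ℕ, T.U (g • e) ⊆ T.U (g ^ (i + 1) • e) := by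
            intro i z hz
            rw [T.U_smul'] at hz
            have := step i hz
            rw [pow_succ', mul_smul, T.U_smul']
            exact this
          have := h10 (j - k - 1)
          rwa [show j - k - 1 + 1 = j - k by omega, ← h5] at this
        exact h8 hy
      have h9 : T.tgt e ∈ T.U (nx e) := by
        apply hbsub
        have := T.tgt_mem e
        have h11 := h6 ((T.U_smul g e _).2 this)
        rwa [T.U_smul', inv_inv]
      exact hss e h9
    intro k j h
    by_contra hne
    rcases lt_or_gt_of_ne hne with hl | hl
    · exact key k j hl h
    · exact key j k hl h.symm
  have hfin := T.seg_finite x (T.tgt e)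
  refine Set.infinite_range_of_injective hinj (hfin.subset ?_)
  rintro _ ⟨k, rfl⟩
  refine ⟨fun hx => ?_, step k (T.tgt_mem e)⟩
  rw [T.U_smul'] at hx
  have := hmono a 0 hx
  exact hcon _ this

end Tr

namespace Sys
variable {F : Type} [Group F] {φ : MulAut F} (S : Sys φ)

def quot (K : Set S.E) (hK : S.Inv K) (s : S.V → S.V) (hs : ∀ (g : F) x, s (g • x) = g • s x)
    (hsK : ∀ x y, S.ks K x y → S.ks K (S.f (s x)) (S.f (s y))) : Sys φ where
  toTr := S.toTr.quot K hK
  f := Quotient.map (fun x => S.f (s x)) (fun x y h => hsK x y h)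
  f_smul := by
    rintro g ⟨x⟩
    refine congrArg (Quotient.mk (S.ks K)) ?_
    show S.f (s (g • x)) = φ g • S.f (s x)
    rw [hs, S.f_smul]

theorem quot_fe {K : Set S.E} (hK : S.Inv K) (s : S.V → S.V) (hs : ∀ (g : F) x, s (g • x) = g • s x)
    (hsK : ∀ x y, S.ks K x y → S.ks K (S.f (s x)) (S.f (s y))) {l : ℝ} {w : S.E → ℝ}
    (h : S.FeE l w) (hi : ∀ d ∈ K, ∃ ι : S.E → S.E,
      Set.InjOn ι {e | e ∈ K ∧ S.f (s (S.src e)) ∉ S.U d ∧ S.f (s (S.tgt e)) ∈ S.U d} ∧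
      ∀ e, e ∈ K → S.f (s (S.src e)) ∉ S.U d → S.f (s (S.tgt e)) ∈ S.U d →
        ι e ∈ S.C d ∧ w e ≤ w (ι e)) :
    ∃ w', (S.quot K hK s hs hsK).FeE l w' := by
  refine ⟨fun e => w e.1, ⟨⟨fun g e => h.inv.smul g e.1, fun e => h.inv.rev e.1⟩,
    fun e => h.pos _, ?_⟩⟩
  intro d
  refine le_trans ?_ (h.le d.1)
  obtain ⟨ι, h1, h2⟩ := hi d.1 d.2
  unfold cost
  have hm : ∀ e ∈ (S.quot K hK s hs hsK).Cf d, e.1 ∈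
      {e | e ∈ K ∧ S.f (s (S.src e)) ∉ S.U d.1 ∧ S.f (s (S.tgt e)) ∈ S.U d.1} := by
    intro e he
    rw [mem_Cf] at he
    exact ⟨e.2, he.1, he.2⟩
  calc ∑ e ∈ (S.quot K hK s hs hsK).Cf d, w e.1
      ≤ ∑ e ∈ (S.quot K hK s hs hsK).Cf d, w (ι e.1) :=
        Finset.sum_le_sum fun e he => (h2 e.1 (hm e he).1 (hm e he).2.1 (hm e he).2.2).2
    _ = ∑ e ∈ ((S.quot K hK s hs hsK).Cf d).image (fun e => ι e.1), w e := by
        rw [Finset.sum_image]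
        intro a ha b hb hab
        exact Subtype.ext (h1 (hm a ha) (hm b hb) hab)
    _ ≤ _ := by
        refine Finset.sum_le_sum_of_subset_of_nonneg ?_ (fun e _ _ => (h.pos e).le)
        intro e he
        obtain ⟨a, ha, rfl⟩ := Finset.mem_image.1 he
        rw [mem_Cf]
        exact (h2 a.1 (hm a ha).1 (hm a ha).2.1 (hm a ha).2.2).1

end Sys


namespace Sys
variable {F : Type} [Group F] {φ : MulAut F}

theorem removal (S : Sys φ) {l : ℝ} {w : S.E → ℝ} (hw : S.FeE l w) (c d : S.E)
    (hdc : S.src d = S.src c) (hst : ∀ g : F, g • S.src c = S.src c → g = 1)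
    (hedge : ∀ e, S.src e = S.src c → e = c ∨ e = d)
    (hcase : d = c ∨ (S.cl d ≠ S.cl c ∧ w d ≤ w c)) :
    ∃ S' : Sys φ, (∃ w', S'.FeE l w') ∧ Nat.card S'.Q < Nat.card S.Q ∧ (S.NF → S'.NF) ∧
      (d ≠ c → S.ECond → S'.ECond) := by
  set u := S.src c with hu
  let K : Set S.E := {e | S.cl e ≠ S.cl c}
  have hK : S.Inv K := ⟨fun g e he => by show S.cl _ ≠ _; rw [S.cl_smul]; exact he,
    fun e he => by show S.cl _ ≠ _; rw [S.cl_rev]; exact he⟩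
  have hnK : ∀ e, e ∉ K → ∃ g : F, e = g • c ∨ e = g • S.rev c := by
    intro e he
    exact S.cl_eq.1 (not_not.1 he).symm
  have hcu : ∀ h : F, S.tgt c ≠ h • u := by
    intro h hh
    have h1 : S.src (h⁻¹ • S.rev c) = u := by
      rw [S.src_smul]; show h⁻¹ • S.tgt c = u; rw [hh, inv_smul_smul]
    have h3 : h⁻¹ • S.rev c ≠ c := by
      intro h2; exact S.noinv h c (by rw [eq_comm, ← inv_smul_eq_iff, h2])
    rcases hedge _ h1 with h2 | h2
    · exact h3 h2
    · rcases hcase with hc | hc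
      · rw [hc] at h2; exact h3 h2
      · exact hc.1 (by rw [← h2, S.cl_smul, S.cl_rev])
  let s : S.V → S.V := fun x => if h : ∃ g : F, x = g • u then h.choose • S.tgt c else x
  have s1 : ∀ g : F, s (g • u) = g • S.tgt c := by
    intro g
    have h : ∃ g' : F, g • u = g' • u := ⟨g, rfl⟩
    have h1 : s (g • u) = h.choose • S.tgt c := dif_pos h
    have h2 : g • u = h.choose • u := h.choose_spec
    have h3 := hst (g⁻¹ * h.choose) (by rw [mul_smul, ← h2, inv_smul_smul])
    rw [h1, ← inv_mul_eq_one.1 h3]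
  have s2 : ∀ x, (∀ g : F, x ≠ g • u) → s x = x := by
    intro x hx
    exact dif_neg (by push Not; exact hx)
  have hs : ∀ (g : F) x, s (g • x) = g • s x := by
    intro g x
    by_cases hx : ∃ h : F, x = h • u
    · obtain ⟨h, rfl⟩ := hx
      rw [← mul_smul, s1, s1, mul_smul]
    · push Not at hx
      rw [s2 x hx, s2]
      intro h hh
      exact hx (g⁻¹ * h) (by rw [mul_smul, ← hh, inv_smul_smul])
  have htc : ∀ g : F, s (g • S.tgt c) = g • S.tgt c := by
    intro g; rw [hs, s2 _ hcu]
  have hsc : ∀ e, e ∉ K → s (S.src e) = s (S.tgt e) := by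
    intro e he
    obtain ⟨g, rfl | rfl⟩ := hnK e he
    · rw [S.src_smul, S.tgt_smul, htc, ← hu, s1]
    · rw [S.src_smul, S.tgt_smul, S.tgt_rev, ← hu, s1]
      exact htc g
  have hseq : ∀ x y, S.ks K x y → s x = s y := S.ks_const hK s hsc
  have hsK : ∀ x y, S.ks K x y → S.ks K (S.f (s x)) (S.f (s y)) := by
    intro x y h
    rw [hseq x y h]
  refine ⟨S.quot K hK s hs hsK, ?_, S.toTr.card_quot hK (e0 := c) (fun h => h rfl), ?_, ?_⟩
  · apply S.quot_fe hK s hs hsK hw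
    intro k hk
    let ι : S.E → S.E := fun e => if e ∈ S.C k then e else
      if h : ∃ g : F, e = g • d then h.choose • S.rev c else
      if h : ∃ g : F, e = g • S.rev d then h.choose • c else e
    have i1 : ∀ e, e ∈ S.C k → ι e = e := fun e he => if_pos he
    have i2 : ∀ g : F, g • d ∉ S.C k → ι (g • d) = g • S.rev c := by
      intro g hg
      have h : ∃ g' : F, g • d = g' • d := ⟨g, rfl⟩
      have : ι (g • d) = h.choose • S.rev c := by
        show (if _ then _ else _) = _
        rw [if_neg hg, dif_pos h]
      rw [this, S.free' h.choose_spec.symm]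
    have i3 : ∀ g : F, g • S.rev d ∉ S.C k → ι (g • S.rev d) = g • c := by
      intro g hg
      have h : ∃ g' : F, g • S.rev d = g' • S.rev d := ⟨g, rfl⟩
      have h' : ¬ ∃ g' : F, g • S.rev d = g' • d := by
        rintro ⟨g', hg'⟩
        exact S.noinv (g⁻¹ * g') d (by rw [mul_smul, ← hg', inv_smul_smul])
      have : ι (g • S.rev d) = h.choose • c := by
        show (if _ then _ else _) = _
        rw [if_neg hg, dif_neg h', dif_pos h]
      rw [this, S.free' h.choose_spec.symm]
    have hdu : S.cl d ≠ S.cl c → ∀ h : F, S.tgt d ≠ h • u := by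
      intro hcl h hh
      have h1 : S.src (h⁻¹ • S.rev d) = u := by
        rw [S.src_smul]; show h⁻¹ • S.tgt d = u; rw [hh, inv_smul_smul]
      rcases hedge _ h1 with h2 | h2
      · exact hcl (by rw [← h2, S.cl_smul, S.cl_rev])
      · exact S.noinv h d (by rw [eq_comm, ← inv_smul_eq_iff, h2])
    have bad : ∀ e, e ∈ K → S.f (s (S.src e)) ∉ S.U k → S.f (s (S.tgt e)) ∈ S.U k → e ∉ S.C k →
        S.cl d ≠ S.cl c ∧ ∃ g : F, (e = g • d ∧ ι e = g • S.rev c ∧ g • S.rev c ∈ S.C k) ∨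
          (e = g • S.rev d ∧ ι e = g • c ∧ g • c ∈ S.C k) := by
      intro e he h1 h2 h3
      have aux : ∀ (e' : S.E) (g : F), e' ∈ K → S.src e' = g • u → e' = g • d := by
        intro e' g he' h4
        have h5 : S.src (g⁻¹ • e') = u := by rw [S.src_smul, h4, inv_smul_smul]
        rcases hedge _ h5 with h6 | h6
        · exact absurd (by rw [← h6, S.cl_smul]) he'
        · rw [← h6, smul_inv_smul]
      by_cases h4 : ∃ g : F, S.src e = g • u
      · obtain ⟨g, hg⟩ := h4
        have h5 := aux e g he hg
        subst h5
        have hcl : S.cl d ≠ S.cl c := by rw [← S.cl_smul g]; exact he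
        refine ⟨hcl, g, Or.inl ⟨rfl, i2 g h3, ?_⟩⟩
        rw [S.tgt_smul, hs, s2 _ (hdu hcl)] at h2
        rw [hg, s1] at h1
        rw [mem_C, hg, S.tgt_smul] at h3
        rw [mem_C, S.src_smul, S.tgt_smul, S.tgt_rev]
        refine ⟨h1, ?_⟩
        by_contra h6
        exact h3 ⟨h6, h2⟩
      · by_cases h5 : ∃ g : F, S.tgt e = g • u
        · obtain ⟨g, hg⟩ := h5
          have h5 := aux (S.rev e) g (hK.rev _ he) hg
          have h6 : e = g • S.rev d := by rw [← S.rev_smul, ← h5, S.rev_rev]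
          subst h6
          have hcl : S.cl d ≠ S.cl c := by rw [← S.cl_rev, ← S.cl_smul g]; exact he
          refine ⟨hcl, g, Or.inr ⟨rfl, i3 g h3, ?_⟩⟩
          rw [hg, s1] at h2
          rw [mem_C, hg, S.src_smul] at h3
          rw [S.src_smul, hs, show S.src (S.rev d) = S.tgt d from rfl, s2 _ (hdu hcl)] at h1
          rw [mem_C, S.src_smul, S.tgt_smul]
          refine ⟨?_, h2⟩
          intro h6
          exact h3 ⟨h1, h6⟩
        · push Not at h4 h5
          rw [s2 _ h4] at h1
          rw [s2 _ h5] at h2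
          exact absurd ⟨h1, h2⟩ h3
    have hrc : ∀ g : F, g • S.rev c ∉ K := fun g h => h (by rw [S.cl_smul, S.cl_rev])
    have hcc : ∀ g : F, g • c ∉ K := fun g h => h (by rw [S.cl_smul])
    have hnr : ∀ g h : F, g • S.rev c ≠ h • c := by
      intro g h hh
      exact S.noinv (g⁻¹ * h) c (by rw [mul_smul, ← hh, inv_smul_smul])
    refine ⟨ι, ?_, ?_⟩
    · rintro a ⟨ha1, ha2, ha3⟩ b ⟨hb1, hb2, hb3⟩ hab
      by_cases hac : a ∈ S.C k <;> by_cases hbc : b ∈ S.C k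
      · rwa [i1 a hac, i1 b hbc] at hab
      · obtain ⟨_, g, ⟨_, h, _⟩ | ⟨_, h, _⟩⟩ := bad b hb1 hb2 hb3 hbc
        · rw [i1 a hac, h] at hab; exact absurd (hab ▸ ha1) (hrc g)
        · rw [i1 a hac, h] at hab; exact absurd (hab ▸ ha1) (hcc g)
      · obtain ⟨_, g, ⟨_, h, _⟩ | ⟨_, h, _⟩⟩ := bad a ha1 ha2 ha3 hac
        · rw [i1 b hbc, h] at hab; exact absurd (hab ▸ hb1) (hrc g)
        · rw [i1 b hbc, h] at hab; exact absurd (hab ▸ hb1) (hcc g)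
      · obtain ⟨_, g, ⟨hx, h, _⟩ | ⟨hx, h, _⟩⟩ := bad a ha1 ha2 ha3 hac <;>
        obtain ⟨_, g', ⟨hx', h', _⟩ | ⟨hx', h', _⟩⟩ := bad b hb1 hb2 hb3 hbc <;>
        rw [h, h'] at hab
        · rw [hx, hx', S.free' hab]
        · exact absurd hab (hnr _ _)
        · exact absurd hab.symm (hnr _ _)
        · rw [hx, hx', S.free' hab]
    · intro e h1 h2 h3
      by_cases h4 : e ∈ S.C k
      · rw [i1 e h4]; exact ⟨h4, le_rfl⟩
      · obtain ⟨hcl, g, hh⟩ := bad e h1 h2 h3 h4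
        have hle : w d ≤ w c := by
          rcases hcase with hc | hc
          · exact absurd (by rw [hc]) hcl
          · exact hc.2
        rcases hh with ⟨hx, h, h'⟩ | ⟨hx, h, h'⟩
        · rw [h]
          refine ⟨h', ?_⟩
          rw [hx, hw.inv.smul, hw.inv.smul, hw.inv.rev]; exact hle
        · rw [h]
          refine ⟨h', ?_⟩
          rw [hx, hw.inv.smul, hw.inv.smul, hw.inv.rev]; exact hle
  · intro hNF x
    obtain ⟨x, rfl⟩ := S.toTr.pr_surj hK x
    by_contra hcon
    push Not at hcon
    obtain ⟨g, hg⟩ := hNF (s x)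
    have h1 : S.toTr.pr hK (g • x) = S.toTr.pr hK x := hcon g
    rw [S.toTr.pr_eq] at h1
    exact hg (by rw [← hs]; exact hseq _ _ h1)
  · intro hne hE
    refine hE.quot hK ⟨d, ?_⟩
    rcases hcase with h | h
    · exact absurd h hne
    · exact h.1

theorem line_case (S : Sys φ) (c : S.E) (g : F) (hst : ∀ g : F, g • S.src c = S.src c → g = 1)
    (hg : S.src (g • S.rev c) = S.src c)
    (hedge : ∀ e, S.src e = S.src c → e = c ∨ e = g • S.rev c) : ∀ h : F, ∃ k : ℤ, h = g ^ k := by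
  set u := S.src c with hu
  have hgc : S.tgt c = g⁻¹ • u := by
    rw [S.src_smul] at hg
    rw [← hg, inv_smul_smul]; rfl
  have : ∀ x : S.V, x ∈ {x : S.V | ∃ k : ℤ, x = g ^ k • u} := by
    refine S.conn _ ⟨u, 0, by simp⟩ ?_
    rintro e ⟨k, hk⟩
    have h1 : S.src ((g ^ k)⁻¹ • e) = u := by rw [S.src_smul, hk, inv_smul_smul]
    show ∃ k : ℤ, S.tgt e = _
    rcases hedge _ h1 with h2 | h2
    · refine ⟨k - 1, ?_⟩
      rw [inv_smul_eq_iff] at h2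
      rw [h2, S.tgt_smul, hgc, ← mul_smul, zpow_sub_one]
    · refine ⟨k + 1, ?_⟩
      rw [inv_smul_eq_iff] at h2
      rw [h2, S.tgt_smul, S.tgt_smul, S.tgt_rev, ← mul_smul, zpow_add_one]
  intro h
  obtain ⟨k, hk⟩ := this (h • u)
  refine ⟨k, ?_⟩
  have := hst ((g ^ k)⁻¹ * h) (by rw [mul_smul, hk, inv_smul_smul])
  rw [inv_mul_eq_one] at this
  exact this.symm

def NoV2 (S : Sys φ) : Prop := ∀ c d : S.E, S.src d = S.src c →
  (∀ g : F, g • S.src c = S.src c → g = 1) → ∃ e, S.src e = S.src c ∧ e ≠ c ∧ e ≠ d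

def Red (S : Sys φ) : Prop := S.ECond ∧ S.Irr ∧ S.NoV2

theorem reduce1 (l : ℝ) : ∀ (N : ℕ) (S : Sys φ), Nat.card S.Q = N → (∃ w, S.FeE l w) → S.NF →
    ∃ S' : Sys φ, (∃ w, S'.FeE l w) ∧ S'.ECond := by
  intro N
  induction N using Nat.strong_induction_on with
  | _ N ih =>
  rintro S hN ⟨w, hw⟩ hNF
  by_cases hl : ∀ c, ∃ c', S.src c' = S.src c ∧ c' ≠ c
  · exact ⟨S, ⟨w, hw⟩, S.econd_of_leafless (Tr.NF.nonempty _ hNF) hl⟩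
  · push Not at hl
    obtain ⟨c, hc⟩ := hl
    obtain ⟨S', h1, h2, h3, _⟩ := S.removal hw c c rfl (fun g hg => S.free g c (hc _ (by rw [S.src_smul, hg])))
      (fun e he => Or.inl (hc e he)) (Or.inl rfl)
    exact ih _ (hN ▸ h2) S' rfl h1 (h3 hNF)

theorem reduce2 (hF : ∃ a b : F, a * b ≠ b * a) (l : ℝ) : ∀ (N : ℕ) (S : Sys φ), Nat.card S.Q = N →
    (∃ w, S.FeE l w) → S.ECond → ∃ S' : Sys φ, (∃ w, S'.FeE l w) ∧ S'.Red := by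
  intro N
  induction N using Nat.strong_induction_on with
  | _ N ih =>
  rintro S hN ⟨w, hw⟩ hE
  by_cases hI : S.Irr
  swap
  · unfold Irr at hI
    push Not at hI
    obtain ⟨K, hK, hne, e, he⟩ := hI
    have hsK : ∀ x y, S.ks K x y → S.ks K (S.f (id x)) (S.f (id y)) := by
      intro x y h d hd
      have := S.ks_const hK.toInv (fun x => decide (S.f x ∈ S.U d)) ?_ x y h
      · exact decide_eq_decide.1 this
      · intro e he
        rw [decide_eq_decide]
        by_contra hcon
        by_cases h1 : S.f (S.src e) ∈ S.U d
        · have h2 : S.f (S.tgt e) ∉ S.U d := fun h2 => hcon ⟨fun _ => h2, fun _ => h1⟩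
          refine he ?_
          have := hK.cl d hd (S.rev e) ⟨h2, by rw [S.tgt_rev]; exact h1⟩
          rw [← S.rev_rev e]; exact hK.rev _ this
        · have h2 : S.f (S.tgt e) ∈ S.U d := by
            by_contra h2; exact hcon ⟨fun h => absurd h h1, fun h => absurd h h2⟩
          exact he (hK.cl d hd e ⟨h1, h2⟩)
    refine ih _ ?_ (S.quot K hK.toInv id (fun _ _ => rfl) hsK) rfl ?_ (hE.quot hK.toInv hne)
    · rw [← hN]; exact S.toTr.card_quot hK.toInv he
    · exact S.quot_fe hK.toInv id _ hsK hw fun d hd =>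
        ⟨id, Set.injOn_id _, fun e he h1 h2 => ⟨⟨h1, h2⟩, le_rfl⟩⟩
  by_cases hV : S.NoV2
  · exact ⟨S, ⟨w, hw⟩, hE, hI, hV⟩
  · unfold NoV2 at hV
    push Not at hV
    obtain ⟨c, d, hdc, hst, hedge⟩ := hV
    have hedge' : ∀ e, S.src e = S.src c → e = c ∨ e = d := fun e he => by
      by_cases h : e = c
      · exact Or.inl h
      · exact Or.inr (hedge e he h)
    have hne : d ≠ c := by
      rintro rfl
      -- leaf contradicts ECond
      obtain ⟨g, hg⟩ := hE.2 (S.rev d) (S.tgt d)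
      have h1 : g • S.tgt d = S.src d := by
        by_contra h1
        obtain ⟨e, he1, he2⟩ := S.exists_dir (Ne.symm h1)
        have : e = d := by rcases hedge' e he1 with h | h <;> exact h
        subst this
        rw [S.U_rev] at hg; exact hg he2
      have h2 : S.src (g • S.rev d) = S.src d := by rw [S.src_smul]; exact h1
      have h3 : g • S.rev d = d := by rcases hedge' _ h2 with h | h <;> exact h
      exact S.noinv g⁻¹ d (by rw [inv_smul_eq_iff, h3])
    have hcl : S.cl d ≠ S.cl c := by
      intro h
      obtain ⟨g, h | h⟩ := S.cl_eq.1 h.symm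
      · apply hne
        have : g = 1 := hst g (by rw [← S.src_smul, ← h, hdc])
        rw [h, this, one_smul]
      · obtain ⟨a, b, hab⟩ := hF
        have := S.line_case c g hst (by rw [← h, hdc]) (fun e he => h ▸ hedge' e he)
        obtain ⟨i, rfl⟩ := this a
        obtain ⟨j, rfl⟩ := this b
        exact hab (by rw [← zpow_add, ← zpow_add, add_comm])
    rcases le_total (w d) (w c) with hle | hle
    · obtain ⟨S', h1, h2, _, h4⟩ := S.removal hw c d hdc hst hedge' (Or.inr ⟨hcl, hle⟩)
      exact ih _ (hN ▸ h2) S' rfl h1 (h4 hne hE)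
    · obtain ⟨S', h1, h2, _, h4⟩ := S.removal hw d c hdc.symm (by rw [hdc]; exact hst)
        (fun e he => (hedge' e (he.trans hdc)).symm) (Or.inr ⟨hcl.symm, hle⟩)
      exact ih _ (hN ▸ h2) S' rfl h1 (h4 hne.symm hE)

theorem reduce (hF : ∃ a b : F, a * b ≠ b * a) {l : ℝ} (S : Sys φ) (h : ∃ w, S.FeE l w) (hNF : S.NF) :
    ∃ S' : Sys φ, (∃ w, S'.FeE l w) ∧ S'.Red := by
  obtain ⟨S1, h1, h2⟩ := reduce1 l _ S rfl h hNF
  exact reduce2 hF l _ S1 rfl h1 h2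

end Sys


namespace Tr
variable {F : Type} [Group F] (T : Tr F)

noncomputable def pot {G : Type} [Group G] (δ : T.E → G) (v0 : T.V) (x : T.V) : G :=
  if h : x = v0 then 1 else pot δ v0 (T.tgt (T.exists_dir h).choose) * (δ (T.exists_dir h).choose)⁻¹
termination_by (T.seg x v0).ncard
decreasing_by
  have := T.seg_ncard (T.exists_dir h).choose_spec.1 (T.exists_dir h).choose_spec.2
  omega

theorem pot_eq {G : Type} [Group G] (δ : T.E → G) {v0 : T.V} {e : T.E} (h : v0 ∈ T.U e) :
    T.pot δ v0 (T.src e) = T.pot δ v0 (T.tgt e) * (δ e)⁻¹ := by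
  have hne : T.src e ≠ v0 := fun h' => T.src_notin e (h' ▸ h)
  rw [pot, dif_neg hne]
  have := T.dir_unique (T.exists_dir hne).choose_spec.1 (T.exists_dir hne).choose_spec.2 h
  rw [this]

theorem potential {G : Type} [Group G] (δ : T.E → G) (hδ : ∀ e, δ (T.rev e) = (δ e)⁻¹) (v0 : T.V) :
    ∃ u : T.V → G, u v0 = 1 ∧ ∀ e, u (T.tgt e) = u (T.src e) * δ e := by
  refine ⟨T.pot δ v0, by rw [pot, dif_pos rfl], fun e => ?_⟩
  by_cases h : v0 ∈ T.U e
  · rw [T.pot_eq δ h]; group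
  · rw [← T.U_rev] at h
    have := T.pot_eq δ h
    rw [T.tgt_rev, hδ, inv_inv] at this
    exact this

theorem pot_unique {G : Type} [Group G] (δ : T.E → G) (u u' : T.V → G)
    (h : ∀ e, u (T.tgt e) = u (T.src e) * δ e) (h' : ∀ e, u' (T.tgt e) = u' (T.src e) * δ e)
    (x y : T.V) : u' x * (u x)⁻¹ = u' y * (u y)⁻¹ := by
  refine T.conn {x | u' x * (u x)⁻¹ = u' y * (u y)⁻¹} ⟨y, rfl⟩ ?_ x
  intro e he
  show u' (T.tgt e) * (u (T.tgt e))⁻¹ = _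
  rw [h, h', ← show _ = _ from he]; group

theorem edge_hom {G : Type} [Group G] (δ : T.E → G) (hδ : ∀ e, δ (T.rev e) = (δ e)⁻¹)
    (hi : ∀ (g : F) e, δ (g • e) = δ e) :
    ∃ (u : T.V → G) (χ : F →* G), (∀ e, u (T.tgt e) = u (T.src e) * δ e) ∧
      ∀ (g : F) v, u (g • v) = χ g * u v := by
  obtain ⟨v0⟩ := T.ne
  obtain ⟨u, hu0, hu⟩ := T.potential δ hδ v0
  have key : ∀ (g : F) v, u (g • v) = u (g • v0) * u v := by
    intro g v
    have := T.pot_unique δ u (fun v => u (g • v)) hu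
      (fun e => by rw [← T.tgt_smul, ← T.src_smul, hu, hi]) v v0
    rw [hu0, inv_one, mul_one, mul_inv_eq_iff_eq_mul] at this
    exact this
  refine ⟨u, ⟨⟨fun g => u (g • v0), by rw [one_smul, hu0]⟩, fun g h => ?_⟩, hu, key⟩
  show u ((g * h) • v0) = _
  rw [mul_smul, key]

theorem retraction (w : T.V) : ∃ r : F →* F, (∀ g, r g • w = w) ∧ (∀ g : F, g • w = w → r g = g) ∧
    ∀ (g : F) v, (∀ h : F, v ≠ h • w) → g • v = v → r g = 1 := by
  have hrep : ∀ o : T.O, ∃ e0, T.mkO e0 = o ∧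
      ((∃ e, T.mkO e = o ∧ ∃ h : F, T.src e = h • w) → T.src e0 = w) := by
    intro o
    by_cases ho : ∃ e, T.mkO e = o ∧ ∃ h : F, T.src e = h • w
    · obtain ⟨e, rfl, h, hh⟩ := ho
      refine ⟨h⁻¹ • e, T.mkO_eq.2 ⟨h⁻¹, rfl⟩, fun _ => ?_⟩
      rw [T.src_smul, hh, inv_smul_smul]
    · obtain ⟨e, he⟩ : ∃ e, T.mkO e = o := Quotient.exists_rep o
      exact ⟨e, he, fun h => absurd h ho⟩
  choose e0 he0 he0' using hrep
  have hrho : ∀ e, ∃ g : F, g • e0 (T.mkO e) = e := fun e => T.mkO_eq.1 (he0 (T.mkO e)).symm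
  choose ρ hρ using hrho
  have hρg : ∀ (g : F) e, ρ (g • e) = g * ρ e := by
    intro g e
    have h1 := hρ (g • e)
    have h2 : T.mkO (g • e) = T.mkO e := T.mkO_eq.2 ⟨g, rfl⟩
    rw [h2] at h1
    apply T.free' (e := e0 (T.mkO e))
    rw [h1, mul_smul, hρ]
  have hρw : ∀ e, (∃ h : F, T.src e = h • w) → ρ e • w = T.src e := by
    intro e h
    have := he0' (T.mkO e) ⟨e, rfl, h⟩
    conv_rhs => rw [← hρ e, T.src_smul, this]
  let inO : T.V → Prop := fun v => ∃ h : F, v = h • w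
  have inO_smul : ∀ (g : F) v, inO (g • v) ↔ inO v := by
    intro g v
    constructor
    · rintro ⟨h, hh⟩; exact ⟨g⁻¹ * h, by rw [mul_smul, ← hh, inv_smul_smul]⟩
    · rintro ⟨h, rfl⟩; exact ⟨g * h, by rw [mul_smul]⟩
  let β : T.E → F := fun e => if inO (T.src e) then ρ e else 1
  let tw : F → T.V → F := fun g v => if inO v then g else 1
  have hβ : ∀ (g : F) e, β (g • e) = tw g (T.src e) * β e := by
    intro g e
    simp only [β, tw, T.src_smul, inO_smul]
    split_ifs
    · exact hρg g e
    · simp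
  obtain ⟨m, hm0, hm⟩ := T.potential (fun e => β e * (β (T.rev e))⁻¹)
    (fun e => by rw [T.rev_rev]; group) w
  have key : ∀ (g : F) v, m (g • v) * tw g v * (m v)⁻¹ = m (g • w) * g := by
    intro g v
    have := T.pot_unique _ m (fun v => m (g • v) * tw g v) hm ?_ v w
    · rw [this, hm0]
      have : tw g w = g := if_pos ⟨1, (one_smul _ _).symm⟩
      rw [this]; group
    · intro e
      show m (g • T.tgt e) * _ = m (g • T.src e) * _ * _
      rw [← T.tgt_smul, ← T.src_smul, hm, T.rev_smul, hβ, hβ]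
      show _ * (_ * (tw g (T.tgt e) * _)⁻¹) * _ = _
      group
  have hmv : ∀ v, v ∈ {v | (inO v → m v • v = w) ∧ (¬ inO v → m v • w = w)} := by
    refine T.conn _ ⟨w, fun _ => by rw [hm0, one_smul], fun h => absurd ⟨1, (one_smul _ _).symm⟩ h⟩ ?_
    rintro e ⟨h1, h2⟩
    have hA : (m (T.src e) * β e) • w = w := by
      by_cases h : inO (T.src e)
      · have : β e = ρ e := if_pos h
        rw [this, mul_smul, hρw e h, h1 h]
      · have : β e = 1 := if_neg h
        rw [this, mul_one, h2 h]
    show (inO (T.tgt e) → m (T.tgt e) • T.tgt e = w) ∧ (¬ inO (T.tgt e) → m (T.tgt e) • w = w)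
    rw [hm, ← mul_assoc]
    constructor
    · intro h
      have : β (T.rev e) = ρ (T.rev e) := if_pos h
      have h3 : T.tgt e = ρ (T.rev e) • w := (hρw _ h).symm
      rw [this, h3, mul_smul, inv_smul_smul, hA]
    · intro h
      have : β (T.rev e) = 1 := if_neg h
      rw [this, inv_one, mul_one, hA]
  have hww : ∀ g : F, inO (g • w) := fun g => ⟨g, rfl⟩
  refine ⟨⟨⟨fun g => m (g • w) * g, by rw [one_smul, hm0, one_mul]⟩, fun g h => ?_⟩, ?_, ?_, ?_⟩
  · show m ((g * h) • w) * (g * h) = (m (g • w) * g) * (m (h • w) * h)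
    rw [← key g (h • w)]
    have : tw g (h • w) = g := if_pos (hww h)
    rw [this, mul_smul]; group
  · intro g
    show (m (g • w) * g) • w = w
    rw [mul_smul]; exact (hmv (g • w)).1 (hww g)
  · intro g hg
    show m (g • w) * g = g
    rw [hg, hm0, one_mul]
  · intro g v hv hg
    show m (g • w) * g = 1
    rw [← key g v, hg]
    have : tw g v = 1 := if_neg (by rintro ⟨h, hh⟩; exact hv h hh)
    rw [this]; group

def P : Type := MulAction.orbitRel.Quotient F T.V
def mkP (v : T.V) : T.P := Quotient.mk (MulAction.orbitRel F T.V) v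
theorem mkP_eq {a b : T.V} : T.mkP a = T.mkP b ↔ ∃ g : F, g • b = a := by
  have h : T.mkP a = T.mkP b ↔ MulAction.orbitRel F T.V a b :=
    ⟨fun h => Quotient.exact h, fun h => Quotient.sound h⟩
  rw [h, MulAction.orbitRel_apply, MulAction.mem_orbit_iff]

theorem mkP_surj : Function.Surjective T.mkP := Quotient.exists_rep

theorem exists_edge (hE : Nonempty T.E) (x : T.V) : ∃ e, T.src e = x := by
  obtain ⟨e⟩ := hE
  by_cases h : x = T.src e
  · exact ⟨e, h.symm⟩
  · obtain ⟨d, hd, _⟩ := T.exists_dir h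
    exact ⟨d, hd⟩

theorem finite_P (hE : Nonempty T.E) : Finite T.P := by
  refine Finite.of_surjective (fun o : T.O => Quotient.liftOn o (fun e => T.mkP (T.src e)) ?_) ?_
  · intro a b hab
    obtain ⟨g, rfl⟩ := MulAction.mem_orbit_iff.1 (MulAction.orbitRel_apply.1 hab)
    exact T.mkP_eq.2 ⟨g, (T.src_smul _ _).symm⟩
  · intro p
    obtain ⟨x, rfl⟩ := T.mkP_surj p
    obtain ⟨e, rfl⟩ := T.exists_edge hE x
    exact ⟨T.mkO e, rfl⟩

abbrev Z2 : Type := Multiplicative (ZMod 2)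

theorem z2inv (x : Z2) : x⁻¹ = x := by revert x; decide

theorem bound (n : ℕ) [Finite (F →* Z2)] (hcard : Nat.card (F →* Z2) ≤ 2 ^ n)
    (hZ : ∀ H : Subgroup F, H ≠ ⊥ → ∃ χ : H →* Z2, ∃ g, χ g ≠ 1) (hE : Nonempty T.E)
    (hV : ∀ c d : T.E, T.src d = T.src c →
      (∀ g : F, g • T.src c = T.src c → g = 1) → ∃ e, T.src e = T.src c ∧ e ≠ c ∧ e ≠ d) :
    Nat.card T.Q ≤ 6 * n := by
  have := T.finite_P hE
  choose pt hpt using T.mkP_surj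
  -- step 1
  have s1 : Nat.card T.Q ≤ n + Nat.card T.P := by
    have hex : ∀ t : T.Q → Z2, ∃ (u : T.V → Z2) (χ : F →* Z2),
        (∀ e, u (T.tgt e) = u (T.src e) * t (T.cl e)) ∧ ∀ (g : F) v, u (g • v) = χ g * u v := fun t =>
      T.edge_hom (fun e => t (T.cl e)) (fun e => by rw [T.cl_rev, z2inv]) (fun g e => by rw [T.cl_smul])
    choose u χ h1 h2 using hex
    have hinj : Function.Injective (fun t : T.Q → Z2 => (χ t, fun p : T.P => u t (pt p))) := by
      intro t t' h
      obtain ⟨ha, hb⟩ := Prod.ext_iff.1 h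
      simp only at ha hb
      have huu : u t = u t' := by
        funext v
        obtain ⟨g, hg⟩ := T.mkP_eq.1 (hpt (T.mkP v)).symm
        rw [← hg, h2, h2, ha, show u t (pt (T.mkP v)) = u t' (pt (T.mkP v)) from congrFun hb _]
      funext q
      obtain ⟨e, rfl⟩ := T.cl_surj q
      have := h1 t e
      rw [huu, h1 t' e] at this
      exact (mul_left_cancel this).symm
    have := Nat.card_le_card_of_injective _ hinj
    rw [Nat.card_prod, Nat.card_fun, Nat.card_fun] at this
    have h2 : Nat.card Z2 = 2 := by rw [Nat.card_eq_fintype_card]; rfl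
    rw [h2] at this
    have h3 : 2 ^ Nat.card T.Q ≤ 2 ^ (n + Nat.card T.P) := by
      rw [pow_add]
      exact this.trans (Nat.mul_le_mul_right _ hcard)
    exact (Nat.pow_le_pow_iff_right (by norm_num)).1 h3
  -- step 2
  let P1 := {p : T.P // ∃ g : F, g ≠ 1 ∧ g • pt p = pt p}
  let P0 := {p : T.P // ¬ ∃ g : F, g ≠ 1 ∧ g • pt p = pt p}
  have s2 : Nat.card P1 ≤ n := by
    have hex : ∀ p : P1, ∃ (χ : F →* Z2) (g : F), g • pt p.1 = pt p.1 ∧ χ g ≠ 1 ∧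
        ∀ (h : F) v, (∀ k : F, v ≠ k • pt p.1) → h • v = v → χ h = 1 := by
      rintro ⟨p, g, hg1, hg2⟩
      obtain ⟨r, hr1, hr2, hr3⟩ := T.retraction (pt p)
      let H := MulAction.stabilizer F (pt p)
      have hH : H ≠ ⊥ := by
        intro h
        have : g ∈ H := hg2
        rw [h] at this; exact hg1 this
      obtain ⟨χ, k, hk⟩ := hZ H hH
      refine ⟨χ.comp (r.codRestrict H hr1), k.1, k.2, ?_, ?_⟩
      · have : r.codRestrict H hr1 k.1 = k := Subtype.ext (hr2 _ k.2)
        show χ (r.codRestrict H hr1 k.1) ≠ 1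
        rw [this]; exact hk
      · intro h v hv hh
        have : r.codRestrict H hr1 h = 1 := Subtype.ext (hr3 h v hv hh)
        show χ (r.codRestrict H hr1 h) = 1
        rw [this, map_one]
    choose χ g h1 h2 h3 using hex
    have : Fintype P1 := Fintype.ofFinite _
    have hval : ∀ (s : Finset P1) (p : P1), (∏ o ∈ s, χ o) (g p) = if p ∈ s then χ p (g p) else 1 := by
      intro s p
      rw [MonoidHom.finsetProd_apply]
      rw [← Finset.prod_ite_eq' s p (fun o => χ o (g p))]
      refine Finset.prod_congr rfl fun o _ => ?_
      split_ifs with h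
      · rfl
      · apply h3 o (g p) (pt p.1) _ (h1 p)
        intro k hk
        apply h
        have := T.mkP_eq.2 ⟨k, hk.symm⟩
        rw [hpt, hpt] at this
        exact Subtype.ext this.symm
    have hinj : Function.Injective (fun s : Finset P1 => ∏ o ∈ s, χ o) := by
      intro s s' h
      ext p
      have h4 := hval s p
      have h5 := hval s' p
      have h6 : (∏ o ∈ s, χ o) = ∏ o ∈ s', χ o := h
      rw [h6, h5] at h4
      have := h2 p
      by_cases a : p ∈ s <;> by_cases b : p ∈ s' <;> simp_all
    have := (Nat.card_le_card_of_injective _ hinj).trans hcard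
    rw [Nat.card_eq_fintype_card, Fintype.card_finset, ← Nat.card_eq_fintype_card] at this
    exact (Nat.pow_le_pow_iff_right (by norm_num)).1 this
  have s3 : Nat.card P0 * 3 ≤ 2 * Nat.card T.Q := by
    have hO : Nat.card T.O ≤ Nat.card (T.Q × Bool) := by
      choose rp hrp using T.cl_surj
      refine Nat.card_le_card_of_surjective (fun x : T.Q × Bool =>
        T.mkO (if x.2 then rp x.1 else T.rev (rp x.1))) ?_
      intro o
      obtain ⟨e, rfl⟩ : ∃ e, T.mkO e = o := Quotient.exists_rep o
      obtain ⟨g, h | h⟩ := T.cl_eq.1 (hrp (T.cl e))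
      · exact ⟨(T.cl e, true), T.mkO_eq.2 ⟨g⁻¹, inv_smul_eq_iff.2 h⟩⟩
      · exact ⟨(T.cl e, false), T.mkO_eq.2 ⟨g⁻¹, inv_smul_eq_iff.2 h⟩⟩
    have hex : ∀ p : P0, ∃ ed : Fin 3 → T.E, Function.Injective ed ∧ ∀ i, T.src (ed i) = pt p.1 := by
      rintro ⟨p, hp⟩
      push Not at hp
      obtain ⟨c, hc⟩ := T.exists_edge hE (pt p)
      have hst : ∀ g : F, g • T.src c = T.src c → g = 1 := by
        intro g hg
        by_contra h
        rw [hc] at hg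
        exact hp g h hg
      obtain ⟨d, hd1, hd2, _⟩ := hV c c rfl hst
      obtain ⟨e, he1, he2, he3⟩ := hV c d hd1 hst
      refine ⟨![c, d, e], ?_, ?_⟩
      · intro i j hij
        fin_cases i <;> fin_cases j <;> first
          | rfl
          | exact absurd hij hd2
          | exact absurd hij he2
          | exact absurd hij he3
          | exact absurd hij.symm hd2
          | exact absurd hij.symm he2
          | exact absurd hij.symm he3
      · intro i
        fin_cases i
        exacts [hc, hd1.trans hc, he1.trans hc]
    choose ed h1 h2 using hex
    have hinj : Function.Injective (fun x : P0 × Fin 3 => T.mkO (ed x.1 x.2)) := by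
      rintro ⟨p, i⟩ ⟨p', i'⟩ h
      obtain ⟨g, hg⟩ := T.mkO_eq.1 h
      simp only at hg
      have h3 : g • pt p'.1 = pt p.1 := by rw [← h2 p' i', ← h2 p i, ← hg, T.src_smul]
      have h4 : p = p' := by
        have := T.mkP_eq.2 ⟨g, h3⟩
        rw [hpt, hpt] at this
        exact Subtype.ext this
      subst h4
      have h5 : g = 1 := by
        by_contra h5
        exact p.2 ⟨g, h5, h3⟩
      rw [h5, one_smul] at hg
      rw [h1 p hg]
    have := (Nat.card_le_card_of_injective _ hinj).trans hO
    rw [Nat.card_prod, Nat.card_prod, Nat.card_eq_fintype_card (α := Fin 3), Fintype.card_fin,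
      Nat.card_eq_fintype_card (α := Bool), Fintype.card_bool] at this
    omega
  have s4 : Nat.card T.P = Nat.card P1 + Nat.card P0 := by
    rw [← Nat.card_sum]
    exact (Nat.card_congr (Equiv.sumCompl _)).symm
  omega

end Tr


namespace Tr
variable {F : Type} [Group F] (T : Tr F)

def Btw (x m y : T.V) : Prop := ∀ d, m ∈ T.U d → x ∈ T.U d ∨ y ∈ T.U d

noncomputable def L (x y : T.V) : ℕ := (T.seg x y).ncard

theorem Btw.symm {T : Tr F} {x m y : T.V} (h : T.Btw x m y) : T.Btw y m x := fun d hd => (h d hd).symm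

theorem Btw.L {T : Tr F} {x m y : T.V} (h : T.Btw x m y) : T.L x y = T.L x m + T.L m y := by
  have h1 : T.seg x y = T.seg x m ∪ T.seg m y := by
    ext d
    have a1 := h d
    have a2 := h (T.rev d)
    simp only [T.U_rev] at a2
    simp only [seg, Set.mem_ofPred_eq, Set.mem_union]
    tauto
  have h2 : Disjoint (T.seg x m) (T.seg m y) := by
    rw [Set.disjoint_left]
    intro d hd hd'
    exact hd'.1 hd.2
  unfold Tr.L
  rw [h1, Set.ncard_union_eq h2 (T.seg_finite _ _) (T.seg_finite _ _)]

theorem btw_of_dirs {p q : T.E} {m x y : T.V} (hp : T.src p = m) (hq : T.src q = m) (hpq : p ≠ q)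
    (hx : x ∈ T.U p) (hy : y ∈ T.U q) : T.Btw x m y := by
  intro d hm
  by_contra hc
  push Not at hc
  have e1 : T.U (T.rev d) ⊆ T.U p := T.dir_sub (by rw [hp, T.U_rev]; simpa using hm)
    ((T.U_rev _ _).2 hc.1) hx
  have e2 : T.U (T.rev d) ⊆ T.U q := T.dir_sub (by rw [hq, T.U_rev]; simpa using hm)
    ((T.U_rev _ _).2 hc.2) hy
  exact T.disj (hp.trans hq.symm) hpq x hx (e2 ((T.U_rev _ _).2 hc.1))

theorem btw_edge {e : T.E} {y : T.V} (h : y ∈ T.U e) : T.Btw (T.src e) (T.tgt e) y := by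
  intro d hd
  by_cases hs : T.src e ∈ T.U d
  · exact Or.inl hs
  · have := T.crossing hs hd
    subst this
    exact Or.inr h

theorem btw_seg {e : T.E} {x y : T.V} (h : e ∈ T.seg x y) :
    T.Btw x (T.src e) y ∧ T.Btw x (T.tgt e) y ∧ T.Btw x (T.src e) (T.tgt e) ∧
      T.Btw (T.src e) (T.tgt e) y := by
  have h4 := T.btw_edge h.2
  have h3 : T.Btw x (T.src e) (T.tgt e) := by
    have := T.btw_edge (e := T.rev e) (y := x) ((T.U_rev _ _).2 h.1)
    rw [T.tgt_rev] at this
    exact this.symm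
  have key : T.Btw x (T.src e) y := by
    intro d hd
    by_cases hx : x ∈ T.U d
    · exact Or.inl hx
    right
    have h5 := (h3 d hd).resolve_left hx
    by_contra hy
    have e1 : T.rev d ∈ T.seg (T.src e) y := by
      refine ⟨?_, ?_⟩ <;> rw [T.U_rev] <;> tauto
    -- d separates {x, y} from {src, tgt}
    have e2 : T.U (T.rev d) ⊆ T.U e := by
      refine T.dir_sub (p := e) (k := T.rev d) ?_ ((T.U_rev _ _).2 hy) h.2
      rw [T.U_rev]; simpa using hd
    exact h.1 (e2 ((T.U_rev _ _).2 hx))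
  refine ⟨key, ?_, h3, h4⟩
  intro d hd
  rcases h4 d hd with h6 | h6
  · exact key d h6
  · exact Or.inr h6

theorem seg_tri {e d : T.E} {x y : T.V} (hd : d ∈ T.seg x y) (hne : d ≠ e) :
    d ∈ T.seg x (T.src e) ∨ d ∈ T.seg (T.tgt e) y := by
  by_cases h : T.src e ∈ T.U d
  · exact Or.inl ⟨hd.1, h⟩
  · right
    refine ⟨fun h2 => hne (T.crossing h h2).symm, hd.2⟩

theorem L_pos_of_mem {e : T.E} {x y : T.V} (he : e ∈ T.seg x y) : 1 ≤ T.L x y := by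
  unfold L
  rw [Nat.one_le_iff_ne_zero, Ne, Set.ncard_eq_zero (T.seg_finite _ _)]
  intro h
  rw [h] at he
  exact he

theorem L_edge (e : T.E) : T.L (T.src e) (T.tgt e) = 1 := by
  unfold L
  rw [T.seg_ncard rfl (T.tgt_mem e), T.seg_self]
  simp

end Tr

namespace Sys
variable {F : Type} [Group F] {φ : MulAut F} {S : Sys φ}

structure Dir (S : Sys φ) where
  D : S.E → S.E
  src_D : ∀ e, S.src (D e) = S.f (S.src e)
  tgt_D : ∀ e, S.f (S.tgt e) ∈ S.U (D e)

namespace Dir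
variable (A : Dir S)

theorem ne (A : Dir S) (e : S.E) : S.f (S.src e) ≠ S.f (S.tgt e) := by
  intro h
  have := A.tgt_D e
  rw [← h, ← A.src_D] at this
  exact S.src_notin _ this

theorem eq {e x : S.E} (h : S.src x = S.f (S.src e)) (h' : S.f (S.tgt e) ∈ S.U x) : A.D e = x :=
  S.dir_unique ((A.src_D e).trans h.symm) (A.tgt_D e) h'

theorem smul (g : F) (e : S.E) : A.D (g • e) = φ g • A.D e := by
  apply A.eq
  · rw [S.src_smul, S.src_smul, S.f_smul, A.src_D]
  · rw [S.tgt_smul, S.f_smul, S.U_smul]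
    exact A.tgt_D e

theorem mem (e : S.E) : e ∈ S.C (A.D e) := by
  refine ⟨?_, A.tgt_D e⟩
  change S.f (S.src e) ∉ S.U (A.D e)
  rw [← A.src_D]
  exact S.src_notin _

theorem iter_smul (H : ℕ) (g : F) (e : S.E) : A.D^[H] (g • e) = (φ ^ H) g • A.D^[H] e := by
  induction H generalizing g e with
  | zero => simp
  | succ H ih =>
    rw [Function.iterate_succ_apply, A.smul, ih, Function.iterate_succ_apply, pow_succ,
      MulAut.mul_apply]

theorem iter_src (H : ℕ) (a b : S.E) (h : S.src a = S.src b) :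
    S.src (A.D^[H] a) = S.src (A.D^[H] b) := by
  induction H with
  | zero => exact h
  | succ H ih => rw [Function.iterate_succ_apply', Function.iterate_succ_apply', A.src_D, A.src_D, ih]

def Legal (x y : S.V) : Prop := ∀ a b, S.src a = S.src b → x ∈ S.U a → y ∈ S.U b → a ≠ b →
  ∀ H, A.D^[H] a ≠ A.D^[H] b

def Taken (_A : Dir S) (a b : S.E) : Prop := S.src a = S.src b ∧ a ≠ b ∧
  ∃ e, S.f (S.src e) ∈ S.U a ∧ S.f (S.tgt e) ∈ S.U b

variable {A}

theorem Legal.symm {x y : S.V} (h : A.Legal x y) : A.Legal y x :=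
  fun a b h1 h2 h3 h4 H h5 => h b a h1.symm h3 h2 h4.symm H h5.symm

theorem Legal.right {x m y : S.V} (h : A.Legal x y) (hb : S.Btw x m y) : A.Legal m y := by
  intro a b h1 h2 h3 h4
  refine h a b h1 ?_ h3 h4
  exact (hb a h2).resolve_right (fun h5 => S.disj h1 h4 y h5 h3)

theorem Legal.left {x m y : S.V} (h : A.Legal x y) (hb : S.Btw x m y) : A.Legal x m :=
  (h.symm.right hb.symm).symm

variable (A)
theorem legal_edge (e : S.E) : A.Legal (S.src e) (S.tgt e) := by
  intro a b h1 h2 h3 h4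
  exfalso
  have h5 : S.src e ∉ S.U b := fun h => S.disj h1 h4 _ h2 h
  have h6 := S.crossing h5 h3
  subst h6
  rw [← h1] at h2
  exact S.src_notin _ h2

theorem legal_smul (g : F) {x y : S.V} (h : A.Legal x y) : A.Legal (g • x) (g • y) := by
  intro a b h1 h2 h3 h4 H h5
  have e1 : ∀ (z : S.V) (c : S.E), g • z ∈ S.U c → z ∈ S.U (g⁻¹ • c) := by
    intro z c hz
    rw [S.U_smul', inv_inv]; exact hz
  refine h (g⁻¹ • a) (g⁻¹ • b) ?_ (e1 _ _ h2) (e1 _ _ h3) ?_ H ?_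
  · rw [S.src_smul, S.src_smul, h1]
  · simpa using h4
  · rw [A.iter_smul, A.iter_smul, h5]

variable {A}
theorem Legal.dir {x y : S.V} : A.Legal x y → ∀ b, S.src b = x → y ∈ S.U b → S.f y ∈ S.U (A.D b) := by
  refine S.seg_induction (P := fun x y => A.Legal x y → ∀ b, S.src b = x → y ∈ S.U b →
    S.f y ∈ S.U (A.D b)) ?_ ?_ x y
  · intro x _ b h1 h2
    rw [← h1] at h2
    exact absurd h2 (S.src_notin _)
  · intro e y hy ih hl b hb hyb
    have : b = e := S.dir_unique hb hyb hy
    subst this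
    by_cases ht : S.tgt b = y
    · rw [← ht]; exact A.tgt_D b
    obtain ⟨c, hc1, hc2⟩ := S.exists_dir ht
    have hl' := hl.right (S.btw_edge hy)
    have h1 := ih hl' c hc1 hc2
    have hne : S.rev b ≠ c := by
      rintro rfl
      exact (S.U_rev _ _).1 hc2 hy
    have hD := hl (S.rev b) c hc1.symm ((S.U_rev _ _).2 (S.src_notin _)) hc2 hne 1
    have hf1 : S.f (S.src b) ∈ S.U (A.D (S.rev b)) := by
      have := A.tgt_D (S.rev b)
      rwa [S.tgt_rev] at this
    have hbt := S.btw_of_dirs (A.src_D (S.rev b)) ((A.src_D c).trans (by rw [hc1]; rfl)) hD hf1 h1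
    refine (hbt (A.D b) (A.tgt_D b)).resolve_left ?_
    rw [← A.src_D]
    exact S.src_notin _

theorem Legal.btw {x m y : S.V} (h : A.Legal x y) (hb : S.Btw x m y) :
    S.Btw (S.f x) (S.f m) (S.f y) := by
  by_cases hx : m = x
  · rw [hx]; exact fun d hd => Or.inl hd
  by_cases hy : m = y
  · rw [hy]; exact fun d hd => Or.inr hd
  obtain ⟨a, ha1, ha2⟩ := S.exists_dir hx
  obtain ⟨b, hb1, hb2⟩ := S.exists_dir hy
  have hne : a ≠ b := by
    rintro rfl
    have := hb (S.rev a) ((S.U_rev _ _).2 (by rw [← ha1]; exact S.src_notin _))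
    rw [S.U_rev, S.U_rev] at this
    tauto
  exact S.btw_of_dirs ((A.src_D a).trans (by rw [ha1])) ((A.src_D b).trans (by rw [hb1]))
    (h a b (ha1.trans hb1.symm) ha2 hb2 hne 1) ((h.left hb).symm.dir a ha1 ha2)
    ((h.right hb).dir b hb1 hb2)

theorem Legal.f (hT : ∀ a b, A.Taken a b → ∀ H, A.D^[H] a ≠ A.D^[H] b) {x y : S.V} :
    A.Legal x y → A.Legal (S.f x) (S.f y) := by
  refine S.seg_induction (P := fun x y => A.Legal x y → A.Legal (S.f x) (S.f y)) ?_ ?_ x y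
  · intro x _ a b h1 h2 h3 h4
    exact absurd h3 (fun h => S.disj h1 h4 _ h2 h)
  · intro e y hy ih hl a b h1 h2 h3 h4
    have hbe := S.btw_edge hy
    have hbt := hl.btw hbe
    by_cases hmb : S.f (S.tgt e) ∈ S.U b
    · exact hT a b ⟨h1, h4, e, h2, hmb⟩
    by_cases hma : S.f (S.tgt e) ∈ S.U a
    · exact ih (hl.right hbe) a b h1 hma h3 h4
    have hv : S.src a = S.f (S.tgt e) := by
      by_contra hv
      obtain ⟨c, hc1, hc2⟩ := S.exists_dir hv
      have hca : c ≠ a := by rintro rfl; exact hma hc2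
      have hcb : c ≠ b := by rintro rfl; exact hmb hc2
      rcases hbt c hc2 with h | h
      · exact S.disj hc1 hca _ h h2
      · exact S.disj (hc1.trans h1) hcb _ h h3
    have ht : S.tgt e ≠ y := by
      rintro rfl
      exact hmb h3
    obtain ⟨c, hc1, hc2⟩ := S.exists_dir ht
    have hne : S.rev e ≠ c := by
      rintro rfl
      exact (S.U_rev _ _).1 hc2 hy
    have ea : A.D (S.rev e) = a := by
      apply A.eq
      · exact hv
      · rw [S.tgt_rev]; exact h2
    have eb : A.D c = b := by
      refine S.dir_unique ?_ ((hl.right hbe).dir c hc1 hc2) h3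
      rw [A.src_D, ← h1, hv, hc1]
    intro H
    have := hl (S.rev e) c hc1.symm ((S.U_rev _ _).2 (S.src_notin _)) hc2 hne (H + 1)
    rwa [Function.iterate_succ_apply, Function.iterate_succ_apply, ea, eb] at this

/-- gluing legal paths along an edge -/
theorem Legal.glue {x z : S.V} {d : S.E} (h1 : A.Legal x (S.tgt d)) (hx : x ∉ S.U d)
    (h2 : A.Legal (S.src d) z) (hz : z ∈ S.U d) : A.Legal x z := by
  intro p q hpq hp hq hne
  by_cases a1 : S.src d ∈ S.U p
  · exact h2 p q hpq a1 hq hne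
  by_cases a2 : S.tgt d ∈ S.U q
  · exact h1 p q hpq hp a2 hne
  exfalso
  by_cases hv : S.src p ∈ S.U d
  · have := S.dir_sub (p := p) (k := S.rev d) (by rw [S.U_rev]; simpa using hv)
      ((S.U_rev _ _).2 hx) hp
    exact a1 (this ((S.U_rev _ _).2 (S.src_notin _)))
  · have := S.dir_sub (p := q) (k := d) (by rw [← hpq]; exact hv) hz hq
    exact a2 (this (S.tgt_mem _))

end Dir

/-- number of edges in the image of an edge under an iterate -/
noncomputable def N (S : Sys φ) (j : ℕ) (e : S.E) : ℕ := S.L (S.f^[j] (S.src e)) (S.f^[j] (S.tgt e))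

theorem iter_f_smul (S : Sys φ) (j : ℕ) (g : F) (x : S.V) : S.f^[j] (g • x) = (φ ^ j) g • S.f^[j] x := by
  induction j generalizing g x with
  | zero => simp
  | succ j ih =>
    rw [Function.iterate_succ_apply, S.f_smul, ih, Function.iterate_succ_apply, pow_succ,
      MulAut.mul_apply]

theorem L_symm (T : Tr F) (x y : T.V) : T.L x y = T.L y x := by
  unfold Tr.L
  refine Set.ncard_congr (fun e _ => T.rev e) ?_ ?_ ?_
  · intro e he
    exact (T.mem_seg_rev _ _ _).2 he
  · intro a b _ _ h
    exact T.rev_inj h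
  · intro b hb
    refine ⟨T.rev b, (T.mem_seg_rev _ _ _).2 hb, T.rev_rev b⟩

theorem N_smul (S : Sys φ) (j : ℕ) (g : F) (e : S.E) : S.N j (g • e) = S.N j e := by
  unfold N
  rw [S.src_smul, S.tgt_smul, S.iter_f_smul, S.iter_f_smul]
  exact S.seg_ncard_smul _ _ _

theorem N_rev (S : Sys φ) (j : ℕ) (e : S.E) : S.N j (S.rev e) = S.N j e := by
  unfold N
  rw [S.tgt_rev, L_symm]
  rfl

theorem N_cl (S : Sys φ) (j : ℕ) {a b : S.E} (h : S.cl a = S.cl b) : S.N j a = S.N j b := by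
  obtain ⟨g, rfl | rfl⟩ := S.cl_eq.1 h
  · rw [N_smul]
  · rw [N_smul, N_rev]

namespace Dir
variable {A : Dir S}

theorem Legal.iter (hT : ∀ a b, A.Taken a b → ∀ H, A.D^[H] a ≠ A.D^[H] b) {x y : S.V} (h : A.Legal x y)
    (j : ℕ) : A.Legal (S.f^[j] x) (S.f^[j] y) := by
  induction j with
  | zero => exact h
  | succ j ih =>
    rw [Function.iterate_succ_apply', Function.iterate_succ_apply']
    exact ih.f hT

theorem Legal.iter_btw (hT : ∀ a b, A.Taken a b → ∀ H, A.D^[H] a ≠ A.D^[H] b) {x m y : S.V}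
    (h : A.Legal x y) (hb : S.Btw x m y) (j : ℕ) :
    S.Btw (S.f^[j] x) (S.f^[j] m) (S.f^[j] y) := by
  induction j with
  | zero => exact hb
  | succ j ih =>
    simp only [Function.iterate_succ_apply']
    exact (h.iter hT j).btw ih

theorem Legal.split (hT : ∀ a b, A.Taken a b → ∀ H, A.D^[H] a ≠ A.D^[H] b) {x y : S.V}
    (h : A.Legal x y) {e : S.E} (he : e ∈ S.seg x y) (j : ℕ) :
    S.L (S.f^[j] x) (S.f^[j] y) = S.L (S.f^[j] x) (S.f^[j] (S.src e)) + S.N j e +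
      S.L (S.f^[j] (S.tgt e)) (S.f^[j] y) := by
  obtain ⟨h1, h2, h3, h4⟩ := S.btw_seg he
  rw [(h.iter_btw hT h2 j).L, ((h.left h2).iter_btw hT h3 j).L]
  rfl

theorem Legal.one (hT : ∀ a b, A.Taken a b → ∀ H, A.D^[H] a ≠ A.D^[H] b) {x y : S.V}
    (h : A.Legal x y) {e : S.E} (he : e ∈ S.seg x y) (j : ℕ) :
    S.N j e ≤ S.L (S.f^[j] x) (S.f^[j] y) := by
  rw [h.split hT he j]; omega

theorem Legal.two (hT : ∀ a b, A.Taken a b → ∀ H, A.D^[H] a ≠ A.D^[H] b) {x y : S.V}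
    (h : A.Legal x y) {e d : S.E} (he : e ∈ S.seg x y) (hd : d ∈ S.seg x y) (hne : d ≠ e) (j : ℕ) :
    S.N j e + S.N j d ≤ S.L (S.f^[j] x) (S.f^[j] y) := by
  rw [h.split hT he j]
  obtain ⟨h1, h2, h3, h4⟩ := S.btw_seg he
  rcases S.seg_tri hd hne with h5 | h5
  · have := (h.left h1).one hT h5 j
    omega
  · have := (h.right h2).one hT h5 j
    omega

end Dir
end Sys


namespace Sys
variable {F : Type} [Group F] {φ : MulAut F} {S : Sys φ}

theorem WInv.exists_min {w : S.E → ℝ} (hw : S.WInv w) (hE : Nonempty S.E) : ∃ e, ∀ d, w e ≤ w d := by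
  have : Nonempty S.Q := hE.map S.cl
  obtain ⟨q, hq⟩ := Finite.exists_min (fun q => w (S.rep q))
  refine ⟨S.rep q, fun d => (hq (S.cl d)).trans (le_of_eq (hw.eq (S.cl_rep _)))⟩

namespace Dir
variable {A : Dir S}

theorem expand (A : Dir S) {l : ℝ} {w : S.E → ℝ} (hl : 1 < l) (hw : S.WInv w) (hp : ∀ e, 0 < w e)
    (hc : ∀ d, S.cost w d = l * w d) (hE : Nonempty S.E) : ∃ e, 2 ≤ S.N 1 e := by
  by_contra hcon
  push Not at hcon
  have hseg : ∀ d e, e ∈ S.C d → d = A.D e := by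
    intro d e h
    by_contra hne
    have h1 := hcon e
    have hd : d ∈ S.seg (S.f (S.src e)) (S.f (S.tgt e)) := h
    have hd' : A.D e ∈ S.seg (S.f (S.src e)) (S.f (S.tgt e)) := A.mem e
    have : 1 < (S.seg (S.f (S.src e)) (S.f (S.tgt e))).ncard :=
      (Set.one_lt_ncard (S.seg_finite _ _)).2 ⟨d, hd, _, hd', hne⟩
    unfold N Tr.L at h1
    simp only [Function.iterate_one] at h1
    omega
  let G : S.O → S.O := Quotient.lift (fun e => S.mkO (A.D e)) (by
    intro a b hab
    obtain ⟨g, rfl⟩ := S.mkO_eq.1 (Quotient.sound hab)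
    exact S.mkO_eq.2 ⟨φ g, (A.smul g b).symm⟩)
  have hG : ∀ e, G (S.mkO e) = S.mkO (A.D e) := fun e => rfl
  have hne : ∀ d, ∃ e, e ∈ S.C d := by
    intro d
    by_contra h
    push Not at h
    have h0 : S.Cf d = ∅ := by
      ext e; simp [h e]
    have := hc d
    rw [cost, h0, Finset.sum_empty] at this
    have := hp d
    nlinarith
  have hsurj : Function.Surjective G := by
    intro o
    obtain ⟨d, rfl⟩ : ∃ e, S.mkO e = o := Quotient.exists_rep o
    obtain ⟨e, he⟩ := hne d
    exact ⟨S.mkO e, by rw [hG, ← hseg d e he]⟩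
  have hinj : Function.Injective G := Finite.injective_iff_surjective.2 hsurj
  obtain ⟨e, he⟩ := hw.exists_min hE
  have h1 : S.Cf (A.D e) = {e} := by
    ext x
    rw [mem_Cf, Finset.mem_singleton]
    constructor
    · intro hx
      have h2 := hseg _ _ hx
      obtain ⟨g, hg⟩ := S.mkO_eq.1 (hinj (by rw [hG, hG, h2] : G (S.mkO x) = G (S.mkO e)))
      subst hg
      rw [A.smul] at h2
      have h3 : φ g = 1 := S.free _ _ h2.symm
      have h4 : g = 1 := by simpa using h3
      rw [h4, one_smul]
    · rintro rfl
      exact A.mem x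
  have h2 := hc (A.D e)
  rw [cost, h1, Finset.sum_singleton] at h2
  have h3 := he (A.D e)
  have h4 := hp (A.D e)
  nlinarith

theorem Legal.sub (hT : ∀ a b, A.Taken a b → ∀ H, A.D^[H] a ≠ A.D^[H] b) {x y : S.V}
    (h : A.Legal x y) {e : S.E} (he : e ∈ S.seg x y) (j : ℕ) :
    S.seg (S.f^[j] (S.src e)) (S.f^[j] (S.tgt e)) ⊆ S.seg (S.f^[j] x) (S.f^[j] y) := by
  obtain ⟨h1, h2, h3, h4⟩ := S.btw_seg he
  have k1 := ((h.left h2).iter_btw hT h3 j)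
  have k2 := ((h.right h1).iter_btw hT h4 j)
  rintro d ⟨hd1, hd2⟩
  have a1 := k1 (S.rev d)
  have a2 := k2 d
  simp only [S.U_rev] at a1
  exact ⟨by tauto, by tauto⟩

theorem reach (hT : ∀ a b, A.Taken a b → ∀ H, A.D^[H] a ≠ A.D^[H] b) (hI : S.Irr) (e d : S.E) :
    ∃ k, ∀ m, S.N m d ≤ S.N (k + m) e := by
  suffices h : ∃ k, ∃ d' ∈ S.seg (S.f^[k] (S.src e)) (S.f^[k] (S.tgt e)), S.cl d' = S.cl d by
    obtain ⟨k, d', h1, h2⟩ := h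
    refine ⟨k, fun m => ?_⟩
    have := ((A.legal_edge e).iter hT k).one hT h1 m
    rw [S.N_cl m h2, ← Function.iterate_add_apply, ← Function.iterate_add_apply] at this
    rw [add_comm]
    exact this
  refine hI {e | ∃ k, ∃ d' ∈ S.seg (S.f^[k] (S.src e)) (S.f^[k] (S.tgt e)), S.cl d' = S.cl d}
    ⟨⟨?_, ?_⟩, ?_⟩ ⟨d, 0, d, ⟨S.src_notin d, S.tgt_mem d⟩, rfl⟩ e
  · rintro g e ⟨k, d', h1, h2⟩
    refine ⟨k, (φ ^ k) g • d', ?_, by rw [S.cl_smul, h2]⟩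
    rw [S.src_smul, S.tgt_smul, S.iter_f_smul, S.iter_f_smul, S.mem_seg_smul]
    exact h1
  · rintro e ⟨k, d', h1, h2⟩
    refine ⟨k, S.rev d', ?_, by rw [S.cl_rev, h2]⟩
    rw [S.mem_seg_rev, S.tgt_rev]
    exact h1
  · rintro e0 ⟨k, d', h1, h2⟩ e he
    refine ⟨k + 1, d', ?_, h2⟩
    rw [Function.iterate_succ_apply, Function.iterate_succ_apply]
    have hl := (A.legal_edge e).iter hT 1
    exact hl.sub hT (show e0 ∈ S.seg _ _ from he) k h1

theorem expgrow (hT : ∀ a b, A.Taken a b → ∀ H, A.D^[H] a ≠ A.D^[H] b) (hI : S.Irr)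
    (hexp : ∃ e, 2 ≤ S.N 1 e) (d : S.E) : ∃ i K, ∀ j, 2 ^ j ≤ S.N (i + K * j) d := by
  obtain ⟨e, he⟩ := hexp
  have h2 : ∃ d1 d2, d1 ∈ S.seg (S.f^[1] (S.src e)) (S.f^[1] (S.tgt e)) ∧
      d2 ∈ S.seg (S.f^[1] (S.src e)) (S.f^[1] (S.tgt e)) ∧ d2 ≠ d1 := by
    obtain ⟨a, ha, b, hb, hab⟩ := (Set.one_lt_ncard (S.seg_finite _ _)).1 (show 1 < _ from he)
    exact ⟨a, b, ha, hb, hab.symm⟩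
  obtain ⟨d1, d2, hd1, hd2, hne⟩ := h2
  have hl := (A.legal_edge e).iter hT 1
  have t1 : ∀ m, S.N m d1 + S.N m d2 ≤ S.N (1 + m) e := by
    intro m
    have := hl.two hT hd1 hd2 hne m
    rw [← Function.iterate_add_apply, ← Function.iterate_add_apply, add_comm m] at this
    exact this
  obtain ⟨k1, hk1⟩ := reach hT hI d1 e
  obtain ⟨k2, hk2⟩ := reach hT hI d2 e
  have hdouble : ∀ m, 2 * S.N m e ≤ S.N (k1 + k2 + 2 + m) e := by
    intro m
    have a1 := t1 (k1 + (k2 + 1 + m))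
    have a2 := hk1 (k2 + 1 + m)
    have a3 := hk2 (k1 + 1 + m)
    have a4 := t1 (k2 + m)
    have a5 := hk2 m
    have a6 := t1 (k1 + m)
    have a7 := hk1 m
    have e1 : 1 + (k1 + (k2 + 1 + m)) = k1 + k2 + 2 + m := by ring
    have e2 : k2 + (k1 + 1 + m) = k1 + (k2 + 1 + m) := by ring
    have e3 : 1 + (k2 + m) = k2 + 1 + m := by ring
    have e4 : 1 + (k1 + m) = k1 + 1 + m := by ring
    rw [e1] at a1
    rw [e2] at a3
    rw [e3] at a4
    rw [e4] at a6
    omega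
  obtain ⟨i, hi⟩ := reach hT hI d e
  refine ⟨i, k1 + k2 + 2, fun j => ?_⟩
  refine le_trans ?_ (hi _)
  induction j with
  | zero =>
    have := S.L_edge e
    change 2 ^ 0 ≤ S.L (S.src e) (S.tgt e)
    rw [this]; norm_num
  | succ j ih =>
    have := hdouble ((k1 + k2 + 2) * j)
    rw [show k1 + k2 + 2 + (k1 + k2 + 2) * j = (k1 + k2 + 2) * (j + 1) by ring] at this
    rw [pow_succ]
    omega

theorem caseB (hT : ∀ a b, A.Taken a b → ∀ H, A.D^[H] a ≠ A.D^[H] b) (hI : S.Irr)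
    (hexp : ∃ e, 2 ≤ S.N 1 e) : ∃ (h : F) (d : S.E),
      ∀ R j, R * S.N j d ≤ S.L (S.f^[j] (S.src d)) (((φ ^ j) h) ^ R • S.f^[j] (S.tgt d)) := by
  obtain ⟨e0, he0⟩ := id hexp
  obtain ⟨i, K, hiK⟩ := expgrow hT hI hexp e0
  obtain ⟨j, hj⟩ : ∃ j, Nat.card S.O < S.N j e0 :=
    ⟨_, lt_of_lt_of_le (Nat.lt_two_pow_self (n := Nat.card S.O)) (hiK _)⟩
  set x := S.f^[j] (S.src e0)
  set y := S.f^[j] (S.tgt e0)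
  have hl : A.Legal x y := (A.legal_edge e0).iter hT j
  have hpig : ∃ a ∈ S.seg x y, ∃ b ∈ S.seg x y, a ≠ b ∧ S.mkO a = S.mkO b := by
    by_contra hcon
    push Not at hcon
    have hinj : Function.Injective (fun a : S.seg x y => S.mkO a.1) := by
      intro a b hab
      by_contra hne
      exact hcon a.1 a.2 b.1 b.2 (fun h => hne (Subtype.ext h)) hab
    have := Nat.card_le_card_of_injective _ hinj
    have h2 : S.N j e0 = Nat.card (S.seg x y) := rfl
    omega
  have hord : ∃ d d', d ∈ S.seg x y ∧ d' ∈ S.seg (S.tgt d) y ∧ S.mkO d' = S.mkO d := by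
    obtain ⟨a, ha, b, hb, hab, hO⟩ := hpig
    rcases S.seg_tri (e := a) hb hab.symm with h | h
    · refine ⟨b, a, hb, ?_, hO⟩
      rcases S.seg_tri (e := b) ha hab with h' | h'
      · exfalso
        have e1 := (S.btw_seg h).1.L
        have e2 := (S.btw_seg h').1.L
        have e3 := S.L_pos_of_mem (e := b) (x := S.src b) (y := S.src a) ⟨S.src_notin _, h.2⟩
        omega
      · exact h'
    · exact ⟨a, b, ha, h, hO.symm⟩
  obtain ⟨d, d', hd, hd', hO⟩ := hord
  obtain ⟨h, rfl⟩ := S.mkO_eq.1 hO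
  have hsrc : S.src d ∉ S.U (h • d) := by
    intro hs
    have := S.crossing (d := S.rev d) (e := h • d) hd'.1 (by rw [S.tgt_rev]; exact hs)
    exact S.noinv h d this.symm
  have hnest : S.U (h • d) ⊆ S.U d := S.dir_sub hsrc hd'.2 hd.2
  have hnest' : ∀ R : ℕ, S.U (h ^ (R + 1) • d) ⊆ S.U (h ^ R • d) := by
    intro R z hz
    rw [pow_succ, mul_smul, S.U_smul'] at hz
    rw [S.U_smul']
    exact hnest hz
  have hnestR : ∀ R : ℕ, S.U (h ^ R • d) ⊆ S.U d := by
    intro R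
    induction R with
    | zero => simp
    | succ R ih => exact (hnest' R).trans ih
  have hl1 : A.Legal (S.src d) (S.tgt (h • d)) := by
    have h1 := hl.right (S.btw_seg hd).1
    have h2 : h • d ∈ S.seg (S.src d) y := ⟨hsrc, hd'.2⟩
    exact h1.left (S.btw_seg h2).2.1
  have hlR : ∀ R : ℕ, A.Legal (S.src d) (S.tgt (h ^ R • d)) := by
    intro R
    induction R with
    | zero => rw [pow_zero, one_smul]; exact A.legal_edge d
    | succ R ih =>
      refine ih.glue (fun hc => S.src_notin _ (hnestR R hc)) ?_ (hnest' R (S.tgt_mem _))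
      have := A.legal_smul (h ^ R) hl1
      rwa [← S.src_smul, ← S.tgt_smul, ← mul_smul, ← pow_succ] at this
  refine ⟨h, d, fun R j => ?_⟩
  have hR : R * S.N j d ≤ S.L (S.f^[j] (S.src d)) (S.f^[j] (S.tgt (h ^ R • d))) := by
    induction R with
    | zero => simp
    | succ R ih =>
      have m2 : h ^ (R + 1) • d ∈ S.seg (S.src d) (S.tgt (h ^ (R + 1) • d)) :=
        ⟨fun hc => S.src_notin _ (hnestR _ hc), S.tgt_mem _⟩
      have m1 : h ^ R • d ∈ S.seg (S.src d) (S.tgt (h ^ (R + 1) • d)) :=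
        ⟨fun hc => S.src_notin _ (hnestR _ hc), hnest' R (S.tgt_mem _)⟩
      have b1 := (S.btw_seg m1).2.1
      rw [((hlR (R + 1)).iter_btw hT b1 j).L]
      have m3 : h ^ (R + 1) • d ∈ S.seg (S.tgt (h ^ R • d)) (S.tgt (h ^ (R + 1) • d)) := by
        refine ⟨?_, S.tgt_mem _⟩
        rw [S.tgt_smul, pow_succ, mul_smul, S.U_smul]
        exact hd'.1
      have := ((hlR (R + 1)).right b1).one hT m3 j
      rw [S.N_smul] at this
      rw [add_mul, one_mul]
      omega
  rw [S.tgt_smul, S.iter_f_smul, map_pow] at hR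
  exact hR

end Dir
end Sys


namespace Sys
variable {F : Type} [Group F] {φ : MulAut F} {S : Sys φ}

namespace Dir

@[ext] structure Gam (A : Dir S) (H : ℕ) where
  h : ℕ
  v : S.V
  y : S.E
  le : h ≤ H
  ex : ∃ x, S.src x = v ∧ A.D^[h] x = y

variable (A : Dir S) (H : ℕ)

theorem iter_smul' (h : ℕ) (g : F) (x : S.E) : A.D^[h] (g • x) = (φ ^ h) g • A.D^[h] x := A.iter_smul h g x

instance : MulAction F (A.Gam H) where
  smul g γ := ⟨γ.h, g • γ.v, (φ ^ γ.h) g • γ.y, γ.le, by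
    obtain ⟨x, h1, h2⟩ := γ.ex
    exact ⟨g • x, by rw [S.src_smul, h1], by rw [A.iter_smul, h2]⟩⟩
  one_smul γ := by
    apply Gam.ext
    · rfl
    · exact one_smul _ _
    · change (φ ^ γ.h) 1 • γ.y = _
      rw [map_one, one_smul]
  mul_smul a b γ := by
    apply Gam.ext
    · rfl
    · exact mul_smul _ _ _
    · change (φ ^ γ.h) (a * b) • γ.y = (φ ^ γ.h) a • (φ ^ γ.h) b • γ.y
      rw [map_mul, mul_smul]

variable {A H}
@[simp] theorem Gam.smul_h (g : F) (γ : A.Gam H) : (g • γ).h = γ.h := rfl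
@[simp] theorem Gam.smul_v (g : F) (γ : A.Gam H) : (g • γ).v = g • γ.v := rfl
@[simp] theorem Gam.smul_y (g : F) (γ : A.Gam H) : (g • γ).y = (φ ^ γ.h) g • γ.y := rfl
variable (A H)

def z (h : ℕ) (hh : h ≤ H) (x : S.E) : A.Gam H := ⟨h, S.src x, A.D^[h] x, hh, x, rfl, rfl⟩

theorem z_smul (h : ℕ) (hh : h ≤ H) (g : F) (x : S.E) : A.z H h hh (g • x) = g • A.z H h hh x := by
  apply Gam.ext
  · rfl
  · exact S.src_smul g x
  · exact A.iter_smul h g x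

variable {A H}
theorem Gam.exz (γ : A.Gam H) : ∃ x, γ = A.z H γ.h γ.le x := by
  obtain ⟨x, h1, h2⟩ := γ.ex
  exact ⟨x, Gam.ext rfl h1.symm h2.symm⟩

def Gam.mem (γ : A.Gam H) (x : S.E) : Prop := S.src x = γ.v ∧ A.D^[γ.h] x = γ.y

theorem Gam.mem_smul (g : F) (γ : A.Gam H) (x : S.E) : (g • γ).mem (g • x) ↔ γ.mem x := by
  unfold Gam.mem
  rw [S.src_smul, A.iter_smul]
  simp

def Gam.W (γ : A.Gam H) (v : S.V) : Prop := ∃ x, γ.mem x ∧ v ∈ S.U x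

theorem Gam.W_smul (g : F) (γ : A.Gam H) (v : S.V) : (g • γ).W (g • v) ↔ γ.W v := by
  constructor
  · rintro ⟨x, h1, h2⟩
    refine ⟨g⁻¹ • x, ?_, ?_⟩
    · rw [← Gam.mem_smul g, smul_inv_smul]; exact h1
    · rw [S.U_smul', inv_inv]; exact h2
  · rintro ⟨x, h1, h2⟩
    exact ⟨g • x, (Gam.mem_smul g γ x).2 h1, (S.U_smul _ _ _).2 h2⟩

def base : S.V ⊕ A.Gam H → S.V := Sum.elim id Gam.v

def Gam.below (γ : A.Gam H) : S.V ⊕ A.Gam H → Prop :=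
  Sum.elim (fun _ => False) (fun δ => δ.h ≤ γ.h ∧ δ.v = γ.v ∧ A.D^[γ.h - δ.h] δ.y = γ.y)

theorem base_smul (g : F) (p : S.V ⊕ A.Gam H) : base (g • p) = g • base p := by
  rcases p with v | γ <;> rfl

theorem Gam.below_smul (g : F) (γ : A.Gam H) (p : S.V ⊕ A.Gam H) : (g • γ).below (g • p) ↔ γ.below p := by
  rcases p with v | δ
  · exact Iff.rfl
  · change (δ.h ≤ γ.h ∧ g • δ.v = g • γ.v ∧ A.D^[γ.h - δ.h] ((φ ^ δ.h) g • δ.y) = (φ ^ γ.h) g • γ.y) ↔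
      (δ.h ≤ γ.h ∧ δ.v = γ.v ∧ A.D^[γ.h - δ.h] δ.y = γ.y)
    refine and_congr_right fun hle => ?_
    rw [A.iter_smul, ← MulAut.mul_apply, ← pow_add, Nat.sub_add_cancel hle]
    simp

/-- the positive side of a gate -/
def Gam.pos (γ : A.Gam H) (p : S.V ⊕ A.Gam H) : Prop := γ.W (base p) ∨ γ.below p

theorem Gam.pos_smul (g : F) (γ : A.Gam H) (p : S.V ⊕ A.Gam H) : (g • γ).pos (g • p) ↔ γ.pos p := by
  unfold Gam.pos
  rw [base_smul, Gam.W_smul, Gam.below_smul]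

def Gam.up (γ : A.Gam H) : S.V ⊕ A.Gam H :=
  if h : γ.h < H then Sum.inr ⟨γ.h + 1, γ.v, A.D γ.y, h, by
    obtain ⟨x, h1, h2⟩ := γ.ex
    exact ⟨x, h1, by rw [Function.iterate_succ_apply', h2]⟩⟩
  else Sum.inl γ.v

theorem Gam.up_smul (g : F) (γ : A.Gam H) : (g • γ).up = g • γ.up := by
  unfold Gam.up
  by_cases h : γ.h < H
  · rw [dif_pos h, dif_pos (show (g • γ).h < H from h)]
    change _ = Sum.inr (g • _)
    congr 1
    apply Gam.ext
    · rfl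
    · rfl
    · change A.D ((φ ^ γ.h) g • γ.y) = (φ ^ (γ.h + 1)) g • A.D γ.y
      rw [A.smul, pow_succ', MulAut.mul_apply]
  · rw [dif_neg h, dif_neg (show ¬ (g • γ).h < H from h)]
    rfl

theorem Gam.base_up (γ : A.Gam H) : base γ.up = γ.v := by
  unfold Gam.up
  split <;> rfl

theorem Gam.not_W (γ : A.Gam H) : ¬ γ.W γ.v := by
  rintro ⟨x, h1, h2⟩
  rw [← h1.1] at h2
  exact S.src_notin _ h2

theorem Gam.below_inr (γ δ : A.Gam H) : γ.below (Sum.inr δ) ↔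
    δ.h ≤ γ.h ∧ δ.v = γ.v ∧ A.D^[γ.h - δ.h] δ.y = γ.y := Iff.rfl

theorem Gam.below_self (γ : A.Gam H) : γ.below (Sum.inr γ) := by
  rw [Gam.below_inr]; simp

/-- gates cross only themselves -/
theorem Gam.pos_up (γ δ : A.Gam H) (hne : δ ≠ γ) : γ.pos δ.up ↔ γ.pos (Sum.inr δ) := by
  unfold Gam.pos
  have : base (Sum.inr δ : S.V ⊕ A.Gam H) = δ.v := rfl
  rw [Gam.base_up, this]
  refine or_congr_right ?_
  rw [Gam.below_inr]
  unfold Gam.up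
  by_cases h : δ.h < H
  · rw [dif_pos h, Gam.below_inr]
    simp only
    rw [← Function.iterate_succ_apply]
    constructor
    · rintro ⟨h1, h2, h3⟩
      exact ⟨by omega, h2, by rwa [show γ.h - δ.h = (γ.h - (δ.h + 1)).succ by omega]⟩
    · rintro ⟨h1, h2, h3⟩
      have h4 : δ.h ≠ γ.h := by
        intro h4
        rw [h4, Nat.sub_self] at h3
        exact hne (Gam.ext h4 h2 h3)
      exact ⟨by omega, h2, by rwa [show (γ.h - (δ.h + 1)).succ = γ.h - δ.h by omega]⟩
  · rw [dif_neg h]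
    refine iff_of_false (fun h => h) ?_
    rintro ⟨h1, h2, h3⟩
    have h4 : δ.h = γ.h := by have := γ.le; omega
    rw [h4, Nat.sub_self] at h3
    exact hne (Gam.ext h4 h2 h3)

theorem Gam.not_pos_up (γ : A.Gam H) : ¬ γ.pos γ.up := by
  unfold Gam.pos
  rw [Gam.base_up]
  rintro (h | h)
  · exact γ.not_W h
  · unfold Gam.up at h
    split at h
    · rw [Gam.below_inr] at h
      have := h.1
      simp at this
    · exact h

theorem Gam.pos_z0 (γ : A.Gam H) (x : S.E) : γ.pos (Sum.inr (A.z H 0 (Nat.zero_le _) x)) ↔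
    γ.W (S.src x) ∨ γ.mem x := by
  unfold Gam.pos
  rw [Gam.below_inr]
  simp [z, base, Gam.mem]

theorem Gam.pos_mid1 (γ : A.Gam H) (x : S.E) (h : γ.W (S.src x) ∨ γ.mem x) :
    γ.W (S.src (S.rev x)) ∨ γ.mem (S.rev x) := by
  rcases h with ⟨q, h1, h2⟩ | h
  · by_cases h3 : q = S.rev x
    · subst h3; exact Or.inr h1
    · left
      refine ⟨q, h1, ?_⟩
      have : q ≠ x := by rintro rfl; exact S.src_notin _ h2
      exact (S.cross q x this h3).1 h2
  · exact Or.inl ⟨x, h, S.tgt_mem x⟩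

theorem Gam.pos_mid (γ : A.Gam H) (x : S.E) : γ.pos (Sum.inr (A.z H 0 (Nat.zero_le _) x)) ↔
    γ.pos (Sum.inr (A.z H 0 (Nat.zero_le _) (S.rev x))) := by
  rw [Gam.pos_z0, Gam.pos_z0]
  refine ⟨γ.pos_mid1 x, fun h => ?_⟩
  have := γ.pos_mid1 (S.rev x) h
  rwa [S.rev_rev] at this

variable (A H)

def src' : S.E ⊕ (A.Gam H × Bool) → S.V ⊕ A.Gam H :=
  Sum.elim (fun x => Sum.inr (A.z H 0 (Nat.zero_le _) x))
    (fun q => if q.2 then q.1.up else Sum.inr q.1)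

def rev' : S.E ⊕ (A.Gam H × Bool) → S.E ⊕ (A.Gam H × Bool) :=
  Sum.elim (fun x => Sum.inl (S.rev x)) (fun q => Sum.inr (q.1, !q.2))

def U' : S.E ⊕ (A.Gam H × Bool) → Set (S.V ⊕ A.Gam H) :=
  Sum.elim (fun x => {p | base p ∈ S.U x}) (fun q => {p | q.1.pos p ↔ q.2 = true})

/-- action on edges of the blown-up tree -/
instance actE' : MulAction F (S.E ⊕ (A.Gam H × Bool)) where
  smul g := Sum.map (fun x => g • x) (fun q => (g • q.1, q.2))
  one_smul e := by
    rcases e with x | ⟨γ, b⟩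
    · exact congrArg Sum.inl (one_smul F x)
    · exact congrArg (fun t => Sum.inr (t, b)) (one_smul F γ)
  mul_smul g k e := by
    rcases e with x | ⟨γ, b⟩
    · exact congrArg Sum.inl (mul_smul g k x)
    · exact congrArg (fun t => Sum.inr (t, b)) (mul_smul g k γ)

theorem down_mem {B : Set (S.V ⊕ A.Gam H)}
    (hB : ∀ e, src' A H e ∈ B → src' A H (rev' A H e) ∈ B) (k : ℕ) (γ : A.Gam H) (hk : H - γ.h = k)
    (h : Sum.inr γ ∈ B) : Sum.inl γ.v ∈ B := by
  induction k generalizing γ with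
  | zero =>
    have h1 := hB (Sum.inr (γ, false)) h
    have h2 : γ.up ∈ B := h1
    unfold Gam.up at h2
    rwa [dif_neg (by omega)] at h2
  | succ k ih =>
    have h1 := hB (Sum.inr (γ, false)) h
    have h2 : γ.up ∈ B := h1
    unfold Gam.up at h2
    rw [dif_pos (by omega)] at h2
    refine ih ⟨γ.h + 1, γ.v, A.D γ.y, _, _⟩ ?_ h2
    simp only
    omega

theorem up_mem {B : Set (S.V ⊕ A.Gam H)}
    (hB : ∀ e, src' A H e ∈ B → src' A H (rev' A H e) ∈ B) (k : ℕ) (γ : A.Gam H) (hk : H - γ.h = k)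
    (h : Sum.inl γ.v ∈ B) : Sum.inr γ ∈ B := by
  induction k generalizing γ with
  | zero =>
    refine hB (Sum.inr (γ, true)) ?_
    change γ.up ∈ B
    unfold Gam.up
    rwa [dif_neg (by omega)]
  | succ k ih =>
    refine hB (Sum.inr (γ, true)) ?_
    change γ.up ∈ B
    unfold Gam.up
    rw [dif_pos (by omega)]
    exact ih _ (by simp only; omega) h

/-- the blown-up tree -/
def blow : Tr F where
  V := S.V ⊕ A.Gam H
  E := S.E ⊕ (A.Gam H × Bool)
  actV := inferInstance
  actE := actE' A H
  src := src' A H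
  rev := rev' A H
  U := U' A H
  rev_rev := by
    rintro (x | ⟨γ, b⟩)
    · simp [rev', S.rev_rev]
    · simp [rev']
  src_smul := by
    rintro g (x | ⟨γ, b⟩)
    · exact congrArg Sum.inr (A.z_smul H 0 _ g x)
    · cases b
      · rfl
      · exact γ.up_smul g
  rev_smul := by
    rintro g (x | ⟨γ, b⟩)
    · exact congrArg Sum.inl (S.rev_smul g x)
    · rfl
  U_smul := by
    rintro g (x | ⟨γ, b⟩) p
    · change base (g • p) ∈ S.U (g • x) ↔ base p ∈ S.U x
      rw [base_smul, S.U_smul]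
    · change ((g • γ).pos (g • p) ↔ _) ↔ (γ.pos p ↔ _)
      rw [Gam.pos_smul]
  U_rev := by
    rintro (x | ⟨γ, b⟩) p
    · exact S.U_rev x (base p)
    · change (γ.pos p ↔ (!b) = true) ↔ ¬ (γ.pos p ↔ b = true)
      cases b <;> simp
  src_notin := by
    rintro (x | ⟨γ, b⟩)
    · exact S.src_notin x
    · cases b
      · change ¬ (γ.pos (Sum.inr γ) ↔ false = true)
        have : γ.pos (Sum.inr γ) := Or.inr γ.below_self
        simp [this]
      · change ¬ (γ.pos γ.up ↔ true = true)
        simp [γ.not_pos_up]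
  cross := by
    rintro (x | ⟨γ, b⟩) (y | ⟨δ, c⟩) h1 h2
    · exact S.cross x y (fun h => h1 (congrArg Sum.inl h)) (fun h => h2 (congrArg Sum.inl h))
    · cases c
      · change base (Sum.inr δ) ∈ S.U x ↔ base δ.up ∈ S.U x
        rw [δ.base_up]; rfl
      · change base δ.up ∈ S.U x ↔ base (Sum.inr δ) ∈ S.U x
        rw [δ.base_up]; rfl
    · exact iff_congr (γ.pos_mid y) Iff.rfl
    · have hne : δ ≠ γ := by
        rintro rfl
        cases b <;> cases c <;> simp [rev'] at h1 h2
      cases c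
      · change (γ.pos (Sum.inr δ) ↔ _) ↔ (γ.pos δ.up ↔ _)
        rw [γ.pos_up δ hne]
      · change (γ.pos δ.up ↔ _) ↔ (γ.pos (Sum.inr δ) ↔ _)
        rw [γ.pos_up δ hne]
  conn := by
    intro B hne hB
    have hV : ∀ v, Sum.inl v ∈ B := by
      refine S.conn {v | Sum.inl v ∈ B} ?_ ?_
      · obtain ⟨v | γ, hp⟩ := hne
        · exact ⟨v, hp⟩
        · exact ⟨γ.v, A.down_mem H hB _ γ rfl hp⟩
      · intro e he
        have h1 := A.up_mem H hB _ (A.z H 0 (Nat.zero_le _) e) rfl he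
        have h2 : Sum.inr (A.z H 0 (Nat.zero_le _) (S.rev e)) ∈ B := hB (Sum.inl e) h1
        exact A.down_mem H hB _ _ rfl h2
    rintro (v | γ)
    · exact hV v
    · exact A.up_mem H hB _ γ rfl (hV _)
  free := by
    rintro g (x | ⟨γ, b⟩) h
    · exact S.free g x (Sum.inl_injective h)
    · have h1 : g • γ = γ := congrArg Prod.fst (Sum.inr_injective h)
      have h2 := congrArg Gam.y h1
      have h3 : (φ ^ γ.h) g = 1 := S.free _ _ h2
      simpa using h3
  noinv := by
    rintro g (x | ⟨γ, b⟩) h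
    · exact S.noinv g x (Sum.inl_injective h)
    · have h1 : b = !b := congrArg Prod.snd (Sum.inr_injective h)
      cases b <;> simp at h1
  fin := by
    obtain ⟨S0, hS0, h⟩ := S.fin
    refine ⟨Sum.inl '' S0 ∪ (fun t : Fin (H + 1) × S.E × Bool =>
      Sum.inr (A.z H t.1.1 (Nat.lt_succ_iff.1 t.1.2) t.2.1, t.2.2)) '' (Set.univ ×ˢ S0 ×ˢ Set.univ), ?_, ?_⟩
    · exact (hS0.image _).union ((Set.finite_univ.prod (hS0.prod Set.finite_univ)).image _)
    · rintro (x | ⟨γ, b⟩)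
      · obtain ⟨g, s, hs, rfl⟩ := h x
        exact ⟨g, Sum.inl s, Or.inl ⟨s, hs, rfl⟩, rfl⟩
      · obtain ⟨x, hx⟩ := γ.exz
        obtain ⟨g, s, hs, rfl⟩ := h x
        refine ⟨g, Sum.inr (A.z H γ.h γ.le s, b), Or.inr ⟨(⟨γ.h, Nat.lt_succ_iff.2 γ.le⟩, s, b),
          ⟨trivial, hs, trivial⟩, rfl⟩, ?_⟩
        rw [A.z_smul] at hx
        exact congrArg (fun t => Sum.inr (t, b)) hx.symm
  ne := ⟨Sum.inl S.ne.some⟩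

end Dir
end Sys


namespace Sys
variable {F : Type} [Group F] {φ : MulAut F} {S : Sys φ}

theorem sum_bound {α β : Type} (s : Finset β) (supp : β → Finset α) (t : Finset α) (w : α → ℝ)
    (hw : ∀ a, 0 < w a) (hd : ∀ a ∈ s, ∀ b ∈ s, ∀ y, y ∈ supp a → y ∈ supp b → a = b)
    (hs : ∀ a ∈ s, supp a ⊆ t) :
    ∑ a ∈ s, ∑ y ∈ supp a, w y ≤ ∑ y ∈ t, w y ∧
    ((∃ y ∈ t, ∀ a ∈ s, y ∉ supp a) → ∑ a ∈ s, ∑ y ∈ supp a, w y < ∑ y ∈ t, w y) := by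
  have hdis : (s : Set β).PairwiseDisjoint supp := by
    intro a ha b hb hab
    change Disjoint (supp a) (supp b)
    rw [Finset.disjoint_left]
    intro y h1 h2
    exact hab (hd a ha b hb y h1 h2)
  rw [← Finset.sum_biUnion hdis]
  have hsub : s.biUnion supp ⊆ t := Finset.biUnion_subset.2 hs
  refine ⟨Finset.sum_le_sum_of_subset_of_nonneg hsub (fun i _ _ => (hw i).le), ?_⟩
  rintro ⟨y, hy, h⟩
  refine Finset.sum_lt_sum_of_subset hsub hy ?_ (hw y) (fun i _ _ => (hw i).le)
  rw [Finset.mem_biUnion]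
  rintro ⟨a, h1, h2⟩
  exact h a h1 h2

namespace Dir
variable (A : Dir S) (H : ℕ) (x1 : S.E)

noncomputable def tau (y : S.E) : S.E := if ∃ g : F, y = g • x1 then S.rev y else y


theorem tau_smul (g : F) (y : S.E) : tau x1 (g • y) = g • tau x1 y := by
  unfold tau
  have : (∃ k : F, g • y = k • x1) ↔ ∃ k : F, y = k • x1 := by
    constructor
    · rintro ⟨k, hk⟩
      exact ⟨g⁻¹ * k, by rw [mul_smul, ← hk, inv_smul_smul]⟩
    · rintro ⟨k, hk⟩
      exact ⟨g * k, by rw [mul_smul, ← hk]⟩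
  rw [apply_ite (fun t => g • t)]
  simp only [this, S.rev_smul]

noncomputable def f' : S.V ⊕ A.Gam H → S.V ⊕ A.Gam H :=
  Sum.elim (fun v => Sum.inl (S.f v)) (fun γ =>
    if h : γ.h = 0 then Sum.inr (A.z H 0 (Nat.zero_le _) (tau x1 (A.D γ.y)))
    else Sum.inr ⟨γ.h - 1, S.f γ.v, γ.y, (Nat.sub_le _ _).trans γ.le, by
      obtain ⟨x, h1, h2⟩ := γ.ex
      refine ⟨A.D x, by rw [A.src_D, h1], ?_⟩
      rw [← Function.iterate_succ_apply, show (γ.h - 1).succ = γ.h by omega, h2]⟩)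

noncomputable def blowS : Sys φ where
  toTr := A.blow H
  f := A.f' H x1
  f_smul := by
    rintro g (v | γ)
    · exact congrArg Sum.inl (S.f_smul g v)
    · change A.f' H x1 (Sum.inr (g • γ)) = φ g • A.f' H x1 (Sum.inr γ)
      unfold f'
      simp only [Sum.elim_inr]
      by_cases h : γ.h = 0
      · rw [dif_pos h, dif_pos (show (g • γ).h = 0 from h)]
        refine congrArg Sum.inr ?_
        change A.z H 0 _ _ = φ g • A.z H 0 _ _
        rw [← A.z_smul, ← tau_smul, ← A.smul]
        have : (g • γ).y = g • γ.y := by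
          rw [Gam.smul_y, h]; rfl
        rw [this]
      · rw [dif_neg h, dif_neg (show ¬ (g • γ).h = 0 from h)]
        refine congrArg Sum.inr ?_
        apply Gam.ext
        · rfl
        · exact S.f_smul g γ.v
        · change (φ ^ γ.h) g • γ.y = (φ ^ (γ.h - 1)) (φ g) • γ.y
          rw [← MulAut.mul_apply, ← pow_succ, Nat.sub_add_cancel (by omega)]

variable {A H}
theorem f'_z0 (x : S.E) : A.f' H x1 (Sum.inr (A.z H 0 (Nat.zero_le _) x)) =
    Sum.inr (A.z H 0 (Nat.zero_le _) (tau x1 (A.D x))) := by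
  unfold f'
  simp only [Sum.elim_inr]
  rw [dif_pos (show (A.z H 0 (Nat.zero_le _) x).h = 0 from rfl)]
  rfl

theorem f'_z (k : ℕ) (hk : k + 1 ≤ H) (x : S.E) : A.f' H x1 (Sum.inr (A.z H (k + 1) hk x)) =
    Sum.inr (A.z H k (by omega) (A.D x)) := by
  unfold f'
  simp only [Sum.elim_inr]
  rw [dif_neg (by simp [z])]
  refine congrArg Sum.inr ?_
  apply Gam.ext
  · rfl
  · exact (A.src_D x).symm
  · exact Function.iterate_succ_apply _ _ _

theorem up_z (k : ℕ) (hk : k < H) (x : S.E) : (A.z H k hk.le x).up = Sum.inr (A.z H (k + 1) hk x) := by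
  unfold Gam.up
  rw [dif_pos (show (A.z H k hk.le x).h < H from hk)]
  refine congrArg Sum.inr ?_
  apply Gam.ext
  · rfl
  · rfl
  · exact (Function.iterate_succ_apply' _ _ _).symm

theorem up_zH (x : S.E) : (A.z H H le_rfl x).up = Sum.inl (S.src x) := by
  unfold Gam.up
  rw [dif_neg (show ¬ (A.z H H le_rfl x).h < H from lt_irrefl _)]
  rfl

theorem f'_up (k : ℕ) (hk : k ≤ H) (x : S.E) : A.f' H x1 (A.z H k hk x).up =
    if h : k < H then Sum.inr (A.z H k hk (A.D x)) else Sum.inl (S.src (A.D x)) := by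
  split
  · next h => rw [up_z k h, f'_z]
  · next h =>
    have : k = H := by omega
    subst this
    rw [up_zH, A.src_D]
    rfl

theorem z_mem {k : ℕ} {hk : k ≤ H} {x y : S.E} : (A.z H k hk x).mem y ↔
    S.src y = S.src x ∧ A.D^[k] y = A.D^[k] x := Iff.rfl

theorem mem_z {γ : A.Gam H} {x : S.E} : γ.mem x ↔ A.z H γ.h γ.le x = γ := by
  constructor
  · intro h
    exact Gam.ext rfl h.1 h.2
  · intro h
    exact ⟨congrArg Gam.v h, congrArg Gam.y h⟩

theorem Gam.pos_up_imp (γ δ : A.Gam H) (h : γ.pos δ.up) : γ.pos (Sum.inr δ) := by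
  by_cases hne : δ = γ
  · subst hne; exact absurd h δ.not_pos_up
  · exact (γ.pos_up δ hne).1 h

theorem pos_tau (γ : A.Gam H) (y : S.E) : γ.pos (Sum.inr (A.z H 0 (Nat.zero_le _) (tau x1 y))) ↔
    γ.pos (Sum.inr (A.z H 0 (Nat.zero_le _) y)) := by
  unfold tau
  split
  · exact (γ.pos_mid y).symm
  · rfl

/-- images of gates -/
theorem gate_step (hH : 1 ≤ H) (γ δ : A.Gam H) :
    (γ.pos (A.f' H x1 δ.up) → γ.pos (A.f' H x1 (Sum.inr δ))) ∧
    (¬ γ.pos (A.f' H x1 δ.up) → γ.pos (A.f' H x1 (Sum.inr δ)) →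
      δ.h = min (γ.h + 1) H ∧ ∀ x, δ.mem x → γ.mem (A.D x)) ∧
    (∀ x, δ.h = γ.h + 1 → δ.mem x → γ.mem (A.D x) →
      ¬ γ.pos (A.f' H x1 δ.up) ∧ γ.pos (A.f' H x1 (Sum.inr δ))) := by
  obtain ⟨x, hx⟩ := δ.exz
  obtain ⟨k, hk⟩ : ∃ k, k = δ.h := ⟨_, rfl⟩
  have hkH : k ≤ H := hk ▸ δ.le
  have hx' : δ = A.z H k hkH x := by subst hk; exact hx
  subst hx'
  clear hx hk
  rcases k with _ | k
  · rw [f'_up, dif_pos (by omega), f'_z0, pos_tau]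
    refine ⟨id, fun h1 h2 => absurd h2 h1, fun y h => ?_⟩
    simp [z] at h
  · rw [f'_z, f'_up]
    have hup : (A.z H k (by omega) (A.D x)).up = Sum.inr (A.z H (k + 1) hkH (A.D x)) := up_z k hkH _
    have hmem : ∀ {j : ℕ} {hj : j ≤ H} (y : S.E), k ≤ j → (A.z H (k + 1) hkH x).mem y →
        (A.z H j hj (A.D x)).mem (A.D y) := by
      intro j hj y hkj h
      refine ⟨?_, ?_⟩
      · change S.src (A.D y) = S.src (A.D x)
        rw [A.src_D, A.src_D]; exact congrArg S.f h.1
      have h2 : A.D^[k + 1] y = A.D^[k + 1] x := h.2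
      rw [Function.iterate_succ_apply, Function.iterate_succ_apply] at h2
      change A.D^[j] (A.D y) = A.D^[j] (A.D x)
      rw [show j = (j - k) + k by omega, Function.iterate_add_apply, h2, Function.iterate_add_apply]
    split
    · next h =>
      rw [← hup]
      refine ⟨γ.pos_up_imp _, fun h1 h2 => ?_, fun y h1 h2 h3 => ?_⟩
      · have : A.z H k (by omega) (A.D x) = γ := by
          by_contra hne
          exact h1 ((γ.pos_up _ hne).2 h2)
        subst this
        refine ⟨?_, fun y hy => hmem y le_rfl hy⟩
        change k + 1 = min (k + 1) H
        omega
      · have e1 : k = γ.h := by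
          have : k + 1 = γ.h + 1 := h1
          omega
        have : A.z H k (by omega) (A.D x) = γ := by
          have h4 := hmem (j := k) (hj := by omega) y le_rfl h2
          refine Gam.ext e1 (h4.1.symm.trans h3.1) ?_
          have h7 := h3.2
          rw [← e1] at h7
          exact h4.2.symm.trans h7
        rw [this]
        exact ⟨γ.not_pos_up, Or.inr γ.below_self⟩
    · next h =>
      have hkk : k + 1 = H := by omega
      have hup2 : (A.z H (k + 1) hkH (A.D x)).up = Sum.inl (S.src (A.D x)) := by
        subst hkk
        exact up_zH _
      rw [← hup2]
      have hstep1 := γ.pos_up_imp (A.z H (k + 1) hkH (A.D x))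
      have hstep2 := γ.pos_up_imp (A.z H k (by omega) (A.D x))
      rw [hup] at hstep2
      refine ⟨fun h => hstep2 (hstep1 h), fun h1 h2 => ?_, fun y h1 h2 h3 => ?_⟩
      · by_cases h3 : A.z H (k + 1) hkH (A.D x) = γ
        · subst h3
          refine ⟨?_, fun y hy => hmem y (by omega) hy⟩
          change k + 1 = min (k + 1 + 1) H
          omega
        · have : A.z H k (by omega) (A.D x) = γ := by
            by_contra hne
            have h5 := (γ.pos_up _ hne).2 h2
            rw [hup] at h5
            exact h1 ((γ.pos_up _ h3).2 h5)
          subst this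
          refine ⟨?_, fun y hy => hmem y le_rfl hy⟩
          change k + 1 = min (k + 1) H
          omega
      · have e1 : k = γ.h := by
          have : k + 1 = γ.h + 1 := h1
          omega
        have : A.z H k (by omega) (A.D x) = γ := by
          have h4 := hmem (j := k) (hj := by omega) y le_rfl h2
          refine Gam.ext e1 (h4.1.symm.trans h3.1) ?_
          have h7 := h3.2
          rw [← e1] at h7
          exact h4.2.symm.trans h7
        have e2 : ¬ γ.pos (Sum.inr (A.z H (k + 1) hkH (A.D x))) := by
          rw [← hup, this]
          exact γ.not_pos_up
        refine ⟨fun h => e2 (hstep1 h), ?_⟩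
        rw [this]
        exact Or.inr γ.below_self

/-- row of a gate: mids -/
theorem gate_mid (γ : A.Gam H) (y : S.E)
    (h1 : ¬ γ.pos (A.f' H x1 (Sum.inr (A.z H 0 (Nat.zero_le _) y))))
    (h2 : γ.pos (A.f' H x1 (Sum.inr (A.z H 0 (Nat.zero_le _) (S.rev y))))) :
    ¬ γ.W (S.f (S.src y)) ∧ ¬ γ.mem (A.D y) ∧ ∃ x, γ.mem x ∧ y ∈ S.C x := by
  rw [f'_z0, pos_tau, Gam.pos_z0, A.src_D] at h1 h2
  push Not at h1
  refine ⟨h1.1, h1.2, ?_⟩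
  rcases h2 with ⟨x, hx1, hx2⟩ | h2
  · exact ⟨x, hx1, fun h => h1.1 ⟨x, hx1, h⟩, hx2⟩
  · exfalso
    refine h1.1 ⟨_, h2, ?_⟩
    have := A.tgt_D (S.rev y)
    rwa [S.tgt_rev] at this

end Dir
end Sys


namespace Sys
variable {F : Type} [Group F] {φ : MulAut F} {S : Sys φ}

namespace Dir
variable {A : Dir S} {H : ℕ} {x1 : S.E}

theorem tau_self {x : S.E} (h : ∃ g : F, x = g • x1) : S.src (tau x1 x) = S.tgt x := by
  unfold tau; rw [if_pos h]; rfl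

theorem tau_in {x y : S.E} (h1 : S.src (tau x1 y) ∈ S.U x) (h2 : S.src y ∉ S.U x) :
    y = x ∧ ∃ g : F, x = g • x1 := by
  unfold tau at h1
  split at h1
  · next h =>
    have := S.crossing h2 h1
    exact ⟨this, this ▸ h⟩
  · exact absurd h1 h2

theorem tau_out {x y : S.E} (h1 : S.src (tau x1 y) ∉ S.U x) (h2 : S.src y ∈ S.U x) :
    y = S.rev x ∧ ∃ g : F, S.rev x = g • x1 := by
  refine tau_in (x1 := x1) (x := S.rev x) ?_ ?_
  · rw [S.U_rev]; exact h1
  · rw [S.U_rev]; exact not_not.2 h2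

theorem not_both {x : S.E} (h : ∃ g : F, x = g • x1) (h' : ∃ g : F, S.rev x = g • x1) : False := by
  obtain ⟨g, rfl⟩ := h
  obtain ⟨k, hk⟩ := h'
  refine S.noinv (k * g⁻¹) (g • x1) ?_
  rw [hk, mul_smul, inv_smul_smul]

theorem base_f'_up (δ : A.Gam H) : base (A.f' H x1 δ.up) = S.f δ.v := by
  obtain ⟨x, hx⟩ := δ.exz
  rw [hx, f'_up]
  split
  · exact A.src_D x
  · exact A.src_D x

theorem mid_src (y : S.E) : base (A.f' H x1 (Sum.inr (A.z H 0 (Nat.zero_le _) y))) =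
    S.src (tau x1 (A.D y)) := by rw [f'_z0]; rfl

theorem gate_base (δ : A.Gam H) (h : base (A.f' H x1 (Sum.inr δ)) ≠ S.f δ.v) :
    ∃ y, δ = A.z H 0 (Nat.zero_le _) y := by
  obtain ⟨y, hy⟩ := δ.exz
  obtain ⟨k, hk⟩ : ∃ k, k = δ.h := ⟨_, rfl⟩
  have hkH : k ≤ H := hk ▸ δ.le
  have hx' : δ = A.z H k hkH y := by subst hk; exact hy
  rcases k with _ | k
  · exact ⟨y, hx'⟩
  · subst hx'
    rw [f'_z] at h
    exact absurd (A.src_D y) h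

theorem mC_ll {x y : S.E} : (Sum.inl y : (A.blowS H x1).E) ∈ (A.blowS H x1).C (Sum.inl x) ↔
    S.src (tau x1 (A.D y)) ∉ S.U x ∧ S.src (tau x1 (A.D (S.rev y))) ∈ S.U x := by
  rw [← mid_src (H := H), ← mid_src (H := H)]; exact Iff.rfl

theorem mC_lt {x : S.E} {δ : A.Gam H} : (Sum.inr (δ, true) : (A.blowS H x1).E) ∈ (A.blowS H x1).C (Sum.inl x) ↔
    S.f δ.v ∉ S.U x ∧ base (A.f' H x1 (Sum.inr δ)) ∈ S.U x := by
  rw [← base_f'_up (x1 := x1)]; exact Iff.rfl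

theorem mC_lf {x : S.E} {δ : A.Gam H} : (Sum.inr (δ, false) : (A.blowS H x1).E) ∈ (A.blowS H x1).C (Sum.inl x) ↔
    base (A.f' H x1 (Sum.inr δ)) ∉ S.U x ∧ S.f δ.v ∈ S.U x := by
  rw [← base_f'_up (x1 := x1)]; exact Iff.rfl

theorem mC_gt {γ δ : A.Gam H} : (Sum.inr (δ, true) : (A.blowS H x1).E) ∈ (A.blowS H x1).C (Sum.inr (γ, true)) ↔
    ¬ γ.pos (A.f' H x1 δ.up) ∧ γ.pos (A.f' H x1 (Sum.inr δ)) := by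
  change ¬ (γ.pos (A.f' H x1 δ.up) ↔ true = true) ∧ (γ.pos (A.f' H x1 (Sum.inr δ)) ↔ true = true) ↔ _
  simp

theorem mC_gf {γ δ : A.Gam H} : (Sum.inr (δ, false) : (A.blowS H x1).E) ∈ (A.blowS H x1).C (Sum.inr (γ, true)) ↔
    ¬ γ.pos (A.f' H x1 (Sum.inr δ)) ∧ γ.pos (A.f' H x1 δ.up) := by
  change ¬ (γ.pos (A.f' H x1 (Sum.inr δ)) ↔ true = true) ∧ (γ.pos (A.f' H x1 δ.up) ↔ true = true) ↔ _
  simp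

theorem mC_gl {γ : A.Gam H} {y : S.E} : (Sum.inl y : (A.blowS H x1).E) ∈ (A.blowS H x1).C (Sum.inr (γ, true)) ↔
    ¬ γ.pos (A.f' H x1 (Sum.inr (A.z H 0 (Nat.zero_le _) y))) ∧
    γ.pos (A.f' H x1 (Sum.inr (A.z H 0 (Nat.zero_le _) (S.rev y)))) := by
  change ¬ (γ.pos (A.f' H x1 (Sum.inr (A.z H 0 (Nat.zero_le _) y))) ↔ true = true) ∧
    (γ.pos (A.f' H x1 (Sum.inr (A.z H 0 (Nat.zero_le _) (S.rev y)))) ↔ true = true) ↔ _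
  simp

theorem mids {x y : S.E} (h : (Sum.inl y : (A.blowS H x1).E) ∈ (A.blowS H x1).C (Sum.inl x)) :
    y ∈ S.C x ∧ ¬ (A.D y = x ∧ ∃ g : F, x = g • x1) ∧
      ¬ (A.D (S.rev y) = S.rev x ∧ ∃ g : F, S.rev x = g • x1) := by
  rw [mC_ll] at h
  obtain ⟨h1, h2⟩ := h
  have k1 : S.f (S.src y) ∉ S.U x := by
    intro h3
    rw [← A.src_D] at h3
    obtain ⟨h4, h5⟩ := tau_out h1 h3
    have h6 : S.f (S.tgt y) ∉ S.U x := by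
      have := A.tgt_D y
      rwa [h4, S.U_rev] at this
    have h7 : S.src (A.D (S.rev y)) ∉ S.U x := by rw [A.src_D]; exact h6
    exact not_both (tau_in h2 h7).2 h5
  refine ⟨⟨k1, ?_⟩, ?_, ?_⟩
  · by_contra h3
    have h3' : S.f (S.tgt y) ∉ S.U x := h3
    have h7 : S.src (A.D (S.rev y)) ∉ S.U x := by rw [A.src_D]; exact h3'
    have h8 := (tau_in h2 h7).1
    have := A.tgt_D (S.rev y)
    rw [h8, S.tgt_rev] at this
    exact k1 this
  · rintro ⟨h3, h4⟩
    rw [h3, tau_self h4] at h1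
    exact h1 (S.tgt_mem x)
  · rintro ⟨h3, h4⟩
    rw [h3, tau_self h4, S.tgt_rev] at h2
    exact S.src_notin x h2

theorem mid_mem {x y : S.E} (h : y ∈ S.C x) (h1 : ¬ ∃ g : F, x = g • x1) (h2 : ¬ ∃ g : F, S.rev x = g • x1) :
    (Sum.inl y : (A.blowS H x1).E) ∈ (A.blowS H x1).C (Sum.inl x) := by
  rw [mC_ll]
  obtain ⟨h3, h4⟩ := h
  constructor
  · intro h5
    refine h1 (tau_in h5 ?_).2
    rw [A.src_D]; exact h3
  · by_contra h5
    refine h2 (tau_out h5 ?_).2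
    rw [A.src_D]; exact h4

theorem mid_t {x : S.E} {δ : A.Gam H}
    (h : (Sum.inr (δ, true) : (A.blowS H x1).E) ∈ (A.blowS H x1).C (Sum.inl x)) :
    ∃ y, δ = A.z H 0 (Nat.zero_le _) y ∧ A.D y = x ∧ ∃ g : F, x = g • x1 := by
  rw [mC_lt] at h
  obtain ⟨y, rfl⟩ := gate_base (x1 := x1) δ (fun he => h.1 (he ▸ h.2))
  refine ⟨y, rfl, ?_⟩
  rw [mid_src] at h
  refine tau_in h.2 ?_
  rw [A.src_D]; exact h.1

theorem mid_f {x : S.E} {δ : A.Gam H}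
    (h : (Sum.inr (δ, false) : (A.blowS H x1).E) ∈ (A.blowS H x1).C (Sum.inl x)) :
    ∃ y, δ = A.z H 0 (Nat.zero_le _) y ∧ A.D y = S.rev x ∧ ∃ g : F, S.rev x = g • x1 := by
  rw [mC_lf] at h
  obtain ⟨y, rfl⟩ := gate_base (x1 := x1) δ (fun he => h.1 (he ▸ h.2))
  refine ⟨y, rfl, ?_⟩
  rw [mid_src] at h
  refine tau_out h.1 ?_
  rw [A.src_D]; exact h.2

theorem mid_t_mem {c : S.E} : (Sum.inr (A.z H 0 (Nat.zero_le _) c, true) : (A.blowS H (A.D c)).E) ∈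
    (A.blowS H (A.D c)).C (Sum.inl (A.D c)) := by
  rw [mC_lt, mid_src, tau_self ⟨1, (one_smul _ _).symm⟩]
  refine ⟨?_, S.tgt_mem _⟩
  change S.f (S.src c) ∉ _
  rw [← A.src_D]; exact S.src_notin _

/-! weights -/
theorem Gam.mem_finite (γ : A.Gam H) : {x | γ.mem x}.Finite := by
  have key : ∀ k : ℕ, ∀ y : S.E, {x | A.D^[k] x = y}.Finite := by
    intro k
    induction k with
    | zero => intro y; exact (Set.finite_singleton y).subset (fun x hx => hx)
    | succ k ih =>
      intro y
      refine ((ih y).biUnion (t := fun u => S.C u) (fun u _ => S.C_finite u)).subset ?_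
      intro x hx
      rw [Set.mem_ofPred_eq, Function.iterate_succ_apply] at hx
      simp only [Set.mem_iUnion]
      exact ⟨A.D x, hx, A.mem x⟩
  exact (key γ.h γ.y).subset fun x hx => hx.2

noncomputable def Gam.fin (γ : A.Gam H) : Finset S.E := γ.mem_finite.toFinset
theorem Gam.mem_fin {γ : A.Gam H} {x : S.E} : x ∈ γ.fin ↔ γ.mem x := by simp [Gam.fin]

theorem Gam.fin_smul (g : F) (γ : A.Gam H) : (g • γ).fin = γ.fin.image (fun x => g • x) := by
  ext x
  simp only [Finset.mem_image, Gam.mem_fin]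
  constructor
  · intro h
    refine ⟨g⁻¹ • x, ?_, smul_inv_smul _ _⟩
    rw [← Gam.mem_smul g, smul_inv_smul]; exact h
  · rintro ⟨y, h, rfl⟩
    exact (Gam.mem_smul g γ y).2 h

variable (A H x1) in
noncomputable def supp : (A.blowS H x1).E → Finset S.E :=
  Sum.elim (fun x => {x}) (fun q => if q.2 then q.1.fin else q.1.fin.image S.rev)

variable (A H x1) in
noncomputable def mu (w : S.E → ℝ) (e : (A.blowS H x1).E) : ℝ := ∑ y ∈ supp A H x1 e, w y

theorem mu_inl (w : S.E → ℝ) (x : S.E) : mu A H x1 w (Sum.inl x) = w x := Finset.sum_singleton _ _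
theorem mu_t (w : S.E → ℝ) (γ : A.Gam H) : mu A H x1 w (Sum.inr (γ, true)) = ∑ y ∈ γ.fin, w y := rfl
theorem mu_f {w : S.E → ℝ} (hw : S.WInv w) (γ : A.Gam H) :
    mu A H x1 w (Sum.inr (γ, false)) = ∑ y ∈ γ.fin, w y := by
  change ∑ y ∈ γ.fin.image S.rev, w y = _
  rw [Finset.sum_image (fun a _ b _ hab => S.rev_inj hab)]
  exact Finset.sum_congr rfl fun e _ => hw.rev _

theorem fin_sum_smul {w : S.E → ℝ} (hw : S.WInv w) (g : F) (γ : A.Gam H) :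
    ∑ y ∈ (g • γ).fin, w y = ∑ y ∈ γ.fin, w y := by
  rw [Gam.fin_smul, Finset.sum_image (fun a _ b _ hab => MulAction.injective g hab)]
  exact Finset.sum_congr rfl fun e _ => hw.smul _ _

theorem mu_inv {w : S.E → ℝ} (hw : S.WInv w) : (A.blowS H x1).WInv (mu A H x1 w) := by
  refine ⟨?_, ?_⟩
  · rintro g (x | ⟨γ, b⟩)
    · change mu A H x1 w (Sum.inl (g • x)) = _
      rw [mu_inl, mu_inl, hw.smul]
    · change mu A H x1 w (Sum.inr (g • γ, b)) = _
      cases b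
      · rw [mu_f hw, mu_f hw, fin_sum_smul hw]
      · rw [mu_t, mu_t, fin_sum_smul hw]
  · rintro (x | ⟨γ, b⟩)
    · change mu A H x1 w (Sum.inl (S.rev x)) = _
      rw [mu_inl, mu_inl, hw.rev]
    · change mu A H x1 w (Sum.inr (γ, !b)) = _
      cases b
      · change mu A H x1 w (Sum.inr (γ, true)) = _
        rw [mu_f hw, mu_t]
      · change mu A H x1 w (Sum.inr (γ, false)) = _
        rw [mu_f hw, mu_t]

theorem mu_pos {w : S.E → ℝ} (hw : S.WInv w) (hp : ∀ e, 0 < w e) (e : (A.blowS H x1).E) :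
    0 < mu A H x1 w e := by
  rcases e with x | ⟨γ, b⟩
  · rw [mu_inl]; exact hp x
  · have : 0 < ∑ y ∈ γ.fin, w y := by
      refine Finset.sum_pos (fun y _ => hp y) ?_
      obtain ⟨x, h1, h2⟩ := γ.ex
      exact ⟨x, Gam.mem_fin.2 ⟨h1, h2⟩⟩
    cases b
    · rw [mu_f hw]; exact this
    · exact this

theorem z0_fin (y : S.E) : (A.z H 0 (Nat.zero_le _) y).fin = {y} := by
  ext x
  rw [Gam.mem_fin, z_mem, Finset.mem_singleton]
  constructor
  · exact fun h => h.2
  · rintro rfl; exact ⟨rfl, rfl⟩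

theorem row_mid {l : ℝ} {w : S.E → ℝ} (h : S.FeE l w) (x : S.E) :
    (A.blowS H x1).cost (mu A H x1 w) (Sum.inl x) ≤ l * mu A H x1 w (Sum.inl x) := by
  rw [mu_inl]
  refine le_trans ?_ (h.le x)
  have key : ∀ a ∈ (A.blowS H x1).Cf (Sum.inl x), ∀ y, y ∈ supp A H x1 a → y ∈ S.C x ∧
      (a = Sum.inl y ∧ ¬ (A.D y = x ∧ ∃ g : F, x = g • x1) ∧
        ¬ (A.D (S.rev y) = S.rev x ∧ ∃ g : F, S.rev x = g • x1) ∨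
       a = Sum.inr (A.z H 0 (Nat.zero_le _) y, true) ∧ A.D y = x ∧ (∃ g : F, x = g • x1) ∨
       a = Sum.inr (A.z H 0 (Nat.zero_le _) (S.rev y), false) ∧ A.D (S.rev y) = S.rev x ∧
        (∃ g : F, S.rev x = g • x1)) := by
    rintro (u | ⟨δ, b⟩) ha y hy
    · have ha' : (Sum.inl u : (A.blowS H x1).E) ∈ (A.blowS H x1).C (Sum.inl x) := (A.blowS H x1).mem_Cf.1 ha
      have hy' : y = u := by simpa [supp] using hy
      subst hy'
      have := mids ha'
      exact ⟨this.1, Or.inl ⟨rfl, this.2⟩⟩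
    · cases b
      · have ha' : (Sum.inr (δ, false) : (A.blowS H x1).E) ∈ (A.blowS H x1).C (Sum.inl x) := (A.blowS H x1).mem_Cf.1 ha
        obtain ⟨u, rfl, h1, h2⟩ := mid_f ha'
        have hy' : y = S.rev u := by
          have : y ∈ (A.z H 0 (Nat.zero_le _) u).fin.image S.rev := hy
          rw [z0_fin] at this
          simpa using this
        subst hy'
        rw [S.rev_rev]
        refine ⟨?_, Or.inr (Or.inr ⟨rfl, h1, h2⟩)⟩
        have := A.mem u
        rw [h1] at this
        rw [← S.mem_C_rev, S.rev_rev]; exact this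
      · have ha' : (Sum.inr (δ, true) : (A.blowS H x1).E) ∈ (A.blowS H x1).C (Sum.inl x) := (A.blowS H x1).mem_Cf.1 ha
        obtain ⟨u, rfl, h1, h2⟩ := mid_t ha'
        have hy' : y = u := by
          have : y ∈ (A.z H 0 (Nat.zero_le _) u).fin := hy
          rw [z0_fin] at this
          simpa using this
        subst hy'
        refine ⟨?_, Or.inr (Or.inl ⟨rfl, h1, h2⟩)⟩
        have := A.mem y
        rwa [h1] at this
  refine (sum_bound ((A.blowS H x1).Cf (Sum.inl x)) (supp A H x1) (S.Cf x) w h.pos ?_ ?_).1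
  · intro a ha b hb y ya yb
    rcases (key a ha y ya).2 with ⟨a1, a2, a3⟩ | ⟨a1, a2, a3⟩ | ⟨a1, a2, a3⟩ <;>
    rcases (key b hb y yb).2 with ⟨b1, b2, b3⟩ | ⟨b1, b2, b3⟩ | ⟨b1, b2, b3⟩
    · rw [a1, b1]
    · exact absurd ⟨b2, b3⟩ a2
    · exact absurd ⟨b2, b3⟩ a3
    · exact absurd ⟨a2, a3⟩ b2
    · rw [a1, b1]
    · exact (not_both a3 b3).elim
    · exact absurd ⟨a2, a3⟩ b3
    · exact (not_both b3 a3).elim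
    · rw [a1, b1]
  · intro a ha y hy
    rw [mem_Cf]; exact (key a ha y hy).1

theorem row_key (hH : 1 ≤ H) (γ : A.Gam H) (a : (A.blowS H x1).E)
    (ha : a ∈ (A.blowS H x1).C (Sum.inr (γ, true))) (y : S.E) (hy : y ∈ supp A H x1 a) :
    (∃ x, γ.mem x ∧ y ∈ S.C x) ∧ (a = Sum.inl y ∧ ¬ γ.W (S.f (S.src y)) ∧ ¬ γ.mem (A.D y) ∨
      a = Sum.inr (A.z H (min (γ.h + 1) H) (min_le_right _ _) y, true) ∧ γ.mem (A.D y)) := by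
  rcases a with u | ⟨δ, b⟩
  · have hy' : y = u := by simpa [supp] using hy
    subst hy'
    replace ha := mC_gl.1 ha
    have := gate_mid x1 γ y ha.1 ha.2
    exact ⟨this.2.2, Or.inl ⟨rfl, this.1, this.2.1⟩⟩
  · cases b
    · replace ha := mC_gf.1 ha
      exact absurd ((gate_step x1 hH γ δ).1 ha.2) ha.1
    · replace ha := mC_gt.1 ha
      obtain ⟨h1, h2⟩ := (gate_step x1 hH γ δ).2.1 ha.1 ha.2
      have hy' : δ.mem y := Gam.mem_fin.1 hy
      refine ⟨⟨A.D y, h2 y hy', A.mem y⟩, Or.inr ⟨?_, h2 y hy'⟩⟩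
      have : A.z H (min (γ.h + 1) H) (min_le_right _ _) y = δ := by
        refine Gam.ext h1.symm hy'.1 ?_
        have := hy'.2
        rw [h1] at this
        exact this
      rw [this]

theorem row_gate (hH : 1 ≤ H) {l : ℝ} {w : S.E → ℝ} (h : S.FeE l w) (γ : A.Gam H) :
    (A.blowS H x1).cost (mu A H x1 w) (Sum.inr (γ, true)) ≤ l * mu A H x1 w (Sum.inr (γ, true)) ∧
    (¬ (A.blowS H x1).cost (mu A H x1 w) (Sum.inr (γ, true)) < l * mu A H x1 w (Sum.inr (γ, true)) →
      ∀ x, γ.mem x → ∀ y ∈ S.C x, ∃ a ∈ (A.blowS H x1).C (Sum.inr (γ, true)), y ∈ supp A H x1 a) := by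
  have hdisj : ∀ x x', γ.mem x → γ.mem x' → ∀ y ∈ S.C x, y ∈ S.C x' → x = x' := by
    intro x x' h1 h2 y h3 h4
    exact S.dir_unique (h1.1.trans h2.1.symm) h3.2 h4.2
  have hsum : ∑ y ∈ γ.fin.biUnion S.Cf, w y ≤ l * mu A H x1 w (Sum.inr (γ, true)) := by
    rw [Finset.sum_biUnion, mu_t, Finset.mul_sum]
    · exact Finset.sum_le_sum fun x _ => h.le x
    · intro x hx x' hx' hne
      change Disjoint (S.Cf x) (S.Cf x')
      rw [Finset.disjoint_left]
      intro y h1 h2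
      rw [mem_Cf] at h1 h2
      exact hne (hdisj x x' (Gam.mem_fin.1 hx) (Gam.mem_fin.1 hx') y h1 h2)
  have hb := sum_bound ((A.blowS H x1).Cf (Sum.inr (γ, true))) (supp A H x1) (γ.fin.biUnion S.Cf) w h.pos ?_ ?_
  · refine ⟨hb.1.trans hsum, fun hn x hx y hy => ?_⟩
    by_contra hcon
    push Not at hcon
    refine hn (lt_of_lt_of_le (hb.2 ⟨y, ?_, ?_⟩) hsum)
    · rw [Finset.mem_biUnion]
      exact ⟨x, Gam.mem_fin.2 hx, by simpa using hy⟩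
    · intro a ha
      exact hcon a ((A.blowS H x1).mem_Cf.1 ha)
  · intro a ha b hb y ya yb
    replace ha := (A.blowS H x1).mem_Cf.1 ha
    replace hb := (A.blowS H x1).mem_Cf.1 hb
    rcases (row_key hH γ a ha y ya).2 with ⟨a1, a2, a3⟩ | ⟨a1, a2⟩ <;>
    rcases (row_key hH γ b hb y yb).2 with ⟨b1, b2, b3⟩ | ⟨b1, b2⟩
    · rw [a1, b1]
    · exact absurd b2 a3
    · exact absurd a2 b3
    · rw [a1, b1]
  · intro a ha y hy
    replace ha := (A.blowS H x1).mem_Cf.1 ha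
    obtain ⟨x, h1, h2⟩ := (row_key hH γ a ha y hy).1
    rw [Finset.mem_biUnion]
    exact ⟨x, Gam.mem_fin.2 h1, by simpa using h2⟩

theorem mu_fe (hH : 1 ≤ H) {l : ℝ} {w : S.E → ℝ} (h : S.FeE l w) :
    (A.blowS H x1).FeE l (mu A H x1 w) := by
  refine ⟨mu_inv h.inv, mu_pos h.inv h.pos, ?_⟩
  rintro (x | ⟨γ, b⟩)
  · exact row_mid h x
  · cases b
    · have h1 := (row_gate (x1 := x1) hH h γ).1
      have h2 := (A.blowS H x1).cost_rev (mu_inv h.inv) (Sum.inr (γ, true))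
      have h3 := (mu_inv (x1 := x1) (H := H) (A := A) h.inv).rev (Sum.inr (γ, true))
      rw [← h2, ← h3] at h1
      exact h1
    · exact (row_gate hH h γ).1

theorem blow_NF (hNF : S.NF) (hF : ∃ g : F, g ≠ 1) : (A.blowS H x1).NF := by
  rintro (v | γ)
  · obtain ⟨g, hg⟩ := hNF v
    exact ⟨g, fun h => hg (Sum.inl_injective h)⟩
  · obtain ⟨g, hg⟩ := hF
    refine ⟨g, fun h => hg ?_⟩
    have h1 : g • γ = γ := Sum.inr_injective h
    have h2 := congrArg Gam.y h1
    have h3 : (φ ^ γ.h) g = 1 := S.free _ _ h2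
    simpa using h3

end Dir
end Sys


namespace Sys
variable {F : Type} [Group F] {φ : MulAut F} {S : Sys φ}

namespace Dir

theorem caseA (A : Dir S) (hI : S.Irr) {l : ℝ} {w : S.E → ℝ} (hf : S.FeE l w) {a b : S.E}
    (hT : A.Taken a b) {H : ℕ} (hH : A.D^[H] a = A.D^[H] b) (hF : ∃ g : F, g ≠ 1) (hNF : S.NF) :
    ∃ S' : Sys φ, S'.NF ∧ ∃ l' < l, ∃ w', S'.FeE l' w' := by
  obtain ⟨hs, hab, e, he1, he2⟩ := hT
  have hH1 : 1 ≤ H := by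
    rcases H with _ | H
    · exact absurd hH hab
    · omega
  have hl : 0 < l := by
    have h1 := hf.le (A.D e)
    have h2 : w e ≤ S.cost w (A.D e) :=
      Finset.single_le_sum (f := w) (fun i _ => (hf.pos i).le) (S.mem_Cf.2 (A.mem e))
    have h3 := hf.pos e
    have h4 := hf.pos (A.D e)
    by_contra hcon
    nlinarith
  obtain ⟨c, hc⟩ : ∃ c, c = A.D^[H] a := ⟨_, rfl⟩
  -- basic facts on the turn
  have n1 : S.f (S.tgt e) ∉ S.U a := fun h => S.disj hs hab _ h he2
  have n2 : S.f (S.src e) ∉ S.U b := fun h => S.disj hs hab _ he1 h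
  have n3 : A.D e ≠ b := by
    intro h
    have h5 := A.src_D e
    rw [h, ← hs] at h5
    rw [← h5] at he1
    exact S.src_notin _ he1
  have n4 : A.D (S.rev e) ≠ a := by
    intro h
    have h5 : S.src (A.D (S.rev e)) = S.f (S.tgt e) := A.src_D (S.rev e)
    rw [h, hs] at h5
    rw [← h5] at he2
    exact S.src_notin _ he2
  have eb : e ∈ S.C b := ⟨n2, he2⟩
  have ea : S.rev e ∈ S.C a := ⟨n1, by
    change S.f (S.tgt (S.rev e)) ∈ S.U a
    rw [S.tgt_rev]; exact he1⟩
  have hfe := mu_fe (A := A) (x1 := A.D c) hH1 hf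
  refine ⟨A.blowS H (A.D c), blow_NF hNF hF, ?_⟩
  suffices h : ∃ l' w', l' < l ∧ (A.blowS H (A.D c)).FeE l' w' by
    obtain ⟨l', w', h1, h2⟩ := h
    exact ⟨l', h1, w', h2⟩
  refine (A.blowS H (A.D c)).decrease hfe ?_
  intro B hB hBne
  by_contra hcon
  push Not at hcon
  have hinv : ∀ (g : F) (x : S.E), (Sum.inl x : (A.blowS H (A.D c)).E) ∈ B →
      (Sum.inl (g • x) : (A.blowS H (A.D c)).E) ∈ B := fun g x h => hB.smul g _ h
  have hrev : ∀ (x : S.E), (Sum.inl x : (A.blowS H (A.D c)).E) ∈ B →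
      (Sum.inl (S.rev x) : (A.blowS H (A.D c)).E) ∈ B := fun x h => hB.rev _ h
  have hgate : ∀ γ : A.Gam H, (Sum.inr (γ, true) : (A.blowS H (A.D c)).E) ∈ B → ∀ x, γ.mem x →
      ∀ y ∈ S.C x, (Sum.inl y : (A.blowS H (A.D c)).E) ∈ B ∧ ¬ γ.W (S.f (S.src y)) ∨
        (Sum.inr (A.z H (min (γ.h + 1) H) (min_le_right _ _) y, true) : (A.blowS H (A.D c)).E) ∈ B ∧
          A.D y = x := by
    intro γ hγ x hx y hy
    obtain ⟨q, hq1, hq2⟩ := (row_gate (x1 := A.D c) hH1 hf γ).2 (not_lt.2 (hcon _ hγ)) x hx y hy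
    have hqB := hB.cl _ hγ q hq1
    rcases (row_key hH1 γ q hq1 y hq2).2 with ⟨rfl, h1, h2⟩ | ⟨rfl, h1⟩
    · exact Or.inl ⟨hqB, h1⟩
    · refine Or.inr ⟨hqB, ?_⟩
      exact S.dir_unique (h1.1.trans hx.1.symm) (A.tgt_D y) hy.2
  by_cases hmid : ∃ x, (Sum.inl x : (A.blowS H (A.D c)).E) ∈ B
  · -- a mid edge
    have hx1 : (Sum.inl (A.D c) : (A.blowS H (A.D c)).E) ∈ B := by
      have := hI {x | (Sum.inl x : (A.blowS H (A.D c)).E) ∈ B ∨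
        (Sum.inl (A.D c) : (A.blowS H (A.D c)).E) ∈ B} ?_ ?_ (A.D c)
      · exact this.elim id id
      · refine ⟨⟨fun g x h => h.imp_left (hinv g x), fun x h => h.imp_left (hrev x)⟩, ?_⟩
        rintro x (hx | hx) y hy
        · by_cases h1 : ∃ g : F, x = g • A.D c
          · obtain ⟨g, rfl⟩ := h1
            right
            have := hinv g⁻¹ _ hx
            rwa [inv_smul_smul] at this
          by_cases h2 : ∃ g : F, S.rev x = g • A.D c
          · obtain ⟨g, h2⟩ := h2
            right
            have := hrev _ hx
            rw [h2] at this
            have := hinv g⁻¹ _ this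
            rwa [inv_smul_smul] at this
          · left
            exact hB.cl _ hx _ (mid_mem hy h1 h2)
        · exact Or.inr hx
      · obtain ⟨x, hx⟩ := hmid
        exact ⟨x, Or.inl hx⟩
    have hz0 : (Sum.inr (A.z H 0 (Nat.zero_le _) c, true) : (A.blowS H (A.D c)).E) ∈ B :=
      hB.cl _ hx1 _ mid_t_mem
    have hzk : ∀ k, ∀ hk : k ≤ H,
        (Sum.inr (A.z H k hk (A.D^[H - k] a), true) : (A.blowS H (A.D c)).E) ∈ B := by
      intro k
      induction k with
      | zero =>
        intro hk
        rw [Nat.sub_zero, ← hc]; exact hz0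
      | succ k ih =>
        intro hk
        refine hB.cl _ (ih (by omega)) _ (mC_gt.2 ?_)
        refine (gate_step (A.D c) hH1 _ _).2.2 (A.D^[H - (k + 1)] a) rfl ⟨rfl, rfl⟩ ?_
        have : A.D^[H - k] a = A.D (A.D^[H - (k + 1)] a) := by
          rw [← Function.iterate_succ_apply' A.D, show (H - (k + 1)).succ = H - k by omega]
        rw [this]
        exact ⟨rfl, rfl⟩
    have hzH := hzk H le_rfl
    rw [Nat.sub_self] at hzH
    rcases hgate _ hzH b ⟨hs.symm, hH.symm⟩ e eb with ⟨_, h1⟩ | ⟨_, h1⟩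
    · exact h1 ⟨a, ⟨rfl, rfl⟩, he1⟩
    · exact n3 h1
  · -- only gates
    have hg : ∀ γ : A.Gam H, (Sum.inr (γ, true) : (A.blowS H (A.D c)).E) ∈ B → ∀ x, γ.mem x →
      ∀ y ∈ S.C x, (Sum.inr (A.z H (min (γ.h + 1) H) (min_le_right _ _) y, true) : (A.blowS H (A.D c)).E) ∈ B ∧
          A.D y = x := by
      intro γ hγ x hx y hy
      rcases hgate γ hγ x hx y hy with h | h
      · exact absurd ⟨y, h.1⟩ hmid
      · exact h
    have hclimb : ∀ n, ∃ γ : A.Gam H, (Sum.inr (γ, true) : (A.blowS H (A.D c)).E) ∈ B ∧ min n H ≤ γ.h := by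
      intro n
      induction n with
      | zero =>
        obtain ⟨x | ⟨γ, b⟩, hx⟩ := hBne
        · exact absurd ⟨x, hx⟩ hmid
        · refine ⟨γ, ?_, by simp⟩
          cases b
          · exact hB.rev _ hx
          · exact hx
      | succ n ih =>
        obtain ⟨γ, h1, h2⟩ := ih
        have h3 := hcon _ h1
        have h4 := mu_pos (A := A) (H := H) (x1 := A.D c) hf.inv hf.pos (Sum.inr (γ, true))
        have h5 : 0 < (A.blowS H (A.D c)).cost (mu A H (A.D c) w) (Sum.inr (γ, true)) :=
          lt_of_lt_of_le (mul_pos hl h4) h3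
        obtain ⟨q, hq⟩ := Finset.nonempty_of_sum_ne_zero h5.ne'
        have hq' := (A.blowS H (A.D c)).mem_Cf.1 hq
        have hqB := hB.cl _ h1 q hq'
        rcases q with y | ⟨δ, b⟩
        · exact absurd ⟨y, hqB⟩ hmid
        · cases b
          · have h6 := mC_gf.1 hq'
            exact absurd ((gate_step (A.D c) hH1 γ δ).1 h6.2) h6.1
          · have h6 := mC_gt.1 hq'
            have h7 := ((gate_step (A.D c) hH1 γ δ).2.1 h6.1 h6.2).1
            refine ⟨δ, hqB, ?_⟩
            rw [h7]; omega
    obtain ⟨γ0, hγ0, hγ0'⟩ := hclimb H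
    have hγH : γ0.h = H := by have := γ0.le; omega
    obtain ⟨K0, hK0⟩ : ∃ K0 : Set S.E, ∀ x, x ∈ K0 ↔
      (Sum.inr (A.z H H le_rfl x, true) : (A.blowS H (A.D c)).E) ∈ B := ⟨{x | _}, fun x => Iff.rfl⟩
    have k1 : ∀ x ∈ K0, ∀ y ∈ S.C x, A.D y = x ∧ y ∈ K0 := by
      intro x hx y hy
      have := hg _ ((hK0 x).1 hx) x ⟨rfl, rfl⟩ y hy
      refine ⟨this.2, (hK0 y).2 ?_⟩
      have h8 : A.z H (min ((A.z H H le_rfl x).h + 1) H) (min_le_right _ _) y = A.z H H le_rfl y := by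
        have e1 : min ((A.z H H le_rfl x).h + 1) H = H := by
          change min (H + 1) H = H
          omega
        refine Gam.ext e1 rfl ?_
        change A.D^[min ((A.z H H le_rfl x).h + 1) H] y = A.D^[H] y
        rw [e1]
      rw [← h8]; exact this.1
    have k2 : ∀ (g : F) x, x ∈ K0 → g • x ∈ K0 := by
      intro g x hx
      rw [hK0] at hx ⊢
      rw [A.z_smul]
      exact hB.smul g _ hx
    have k3 : ∃ x, x ∈ K0 := by
      obtain ⟨x, hx⟩ := γ0.exz
      refine ⟨x, (hK0 x).2 ?_⟩
      have : A.z H H le_rfl x = γ0 := by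
        rw [hx]
        refine Gam.ext hγH.symm rfl ?_
        change A.D^[H] x = A.D^[γ0.h] x
        rw [hγH]
      rw [this]; exact hγ0
    have k4 : ∀ x, x ∈ K0 ∨ S.rev x ∈ K0 := by
      refine hI {x | x ∈ K0 ∨ S.rev x ∈ K0} ⟨⟨?_, ?_⟩, ?_⟩ ?_
      · rintro g x (h | h)
        · exact Or.inl (k2 g x h)
        · right; rw [S.rev_smul]; exact k2 g _ h
      · rintro x (h | h)
        · right; rw [S.rev_rev]; exact h
        · exact Or.inl h
      · rintro x (h | h) y hy
        · exact Or.inl (k1 x h y hy).2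
        · exact Or.inr (k1 _ h _ ((S.mem_C_rev _ _).2 hy)).2
      · obtain ⟨x, hx⟩ := k3
        exact ⟨x, Or.inl hx⟩
    have ka : a ∉ K0 := fun h => n4 (k1 a h _ ea).1
    have kb : b ∉ K0 := fun h => n3 (k1 b h _ eb).1
    have kra := (k4 a).resolve_left ka
    have krb := (k4 b).resolve_left kb
    have ke : e ∈ K0 := by
      refine (k1 _ kra e ⟨?_, ?_⟩).2
      · change ¬ (S.f (S.src e) ∈ S.U (S.rev a))
        rw [S.U_rev]; exact not_not.2 he1
      · change S.f (S.tgt e) ∈ S.U (S.rev a)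
        rw [S.U_rev]; exact n1
    have kre : S.rev e ∈ K0 := by
      refine (k1 _ krb (S.rev e) ⟨?_, ?_⟩).2
      · change ¬ (S.f (S.tgt e) ∈ S.U (S.rev b))
        rw [S.U_rev]; exact not_not.2 he2
      · change S.f (S.tgt (S.rev e)) ∈ S.U (S.rev b)
        rw [S.tgt_rev, S.U_rev]; exact n2
    have := hI {x | x ∈ K0 ∧ S.rev x ∈ K0} ⟨⟨?_, ?_⟩, ?_⟩ ⟨e, ke, kre⟩ a
    · exact ka this.1
    · rintro g x ⟨h1, h2⟩
      refine ⟨k2 g x h1, ?_⟩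
      rw [S.rev_smul]; exact k2 g _ h2
    · rintro x ⟨h1, h2⟩
      exact ⟨h2, by rw [S.rev_rev]; exact h1⟩
    · rintro x ⟨h1, h2⟩ y hy
      exact ⟨(k1 x h1 y hy).2, (k1 _ h2 _ ((S.mem_C_rev _ _).2 hy)).2⟩

end Dir
end Sys


theorem Tr.ECond.nf {F : Type} [Group F] {T : Tr F} (h : T.ECond) : T.NF := by
  intro x
  by_contra hc
  push Not at hc
  obtain ⟨⟨d⟩, h⟩ := h
  obtain ⟨g, hg⟩ := h d x
  obtain ⟨k, hk⟩ := h (T.rev d) x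
  rw [hc] at hg hk
  exact (T.U_rev _ _).1 hk hg

namespace Sys
variable {F : Type} [Group F] {φ : MulAut F}

theorem C_nonempty (S : Sys φ) (hE : S.ECond) (d : S.E) : (S.C d).Nonempty := by
  by_contra hc
  rw [Set.not_nonempty_iff_eq_empty] at hc
  obtain ⟨x⟩ := S.ne
  have key : ∀ d, ∃ h : F, S.f (h • x) ∈ S.U d := by
    intro d
    obtain ⟨g, hg⟩ := hE.2 d (S.f x)
    obtain ⟨h, rfl⟩ := φ.surjective g
    exact ⟨h, by rw [S.f_smul]; exact hg⟩
  obtain ⟨h1, hh1⟩ := key d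
  obtain ⟨h2, hh2⟩ := key (S.rev d)
  rw [S.U_rev] at hh2
  have := S.conn {y | S.f y ∉ S.U d} ⟨_, hh2⟩ (by
    intro e he hcon
    have : e ∈ S.C d := ⟨he, hcon⟩
    rw [hc] at this
    exact this) (h1 • x)
  exact this hh1

theorem exists_minimal (N : ℕ) (hN : ∀ S : Sys φ, S.Red → Nat.card S.Q ≤ N)
    (hF : ∃ a b : F, a * b ≠ b * a) (S0 : Sys φ) (h0 : S0.NF) (l0 : ℝ) (w0 : S0.E → ℝ)
    (hw0 : S0.FeE l0 w0) :
    ∃ (S : Sys φ) (l : ℝ) (w : S.E → ℝ), S.Red ∧ S.FeE l w ∧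
      ∀ S' : Sys φ, S'.NF → ∀ l' w', S'.FeE l' w' → l ≤ l' := by
  have toFin : ∀ (S : Sys φ) (m : ℕ) (eq : S.Q ≃ Fin m) (l : ℝ) (w : S.E → ℝ), S.FeE l w →
      LA.Fe (fun i j => S.M (eq.symm i) (eq.symm j)) l (fun i => w (S.rep (eq.symm i))) := by
    intro S m eq l w h
    have := h.toQ
    refine ⟨fun i => this.1 _, fun i => ?_⟩
    have h2 := this.2 (eq.symm i)
    rwa [← Equiv.sum_comp eq.symm] at h2
  obtain ⟨m, A, l, w, ⟨S, hS, eq, hA⟩, hFe, hmin⟩ := LA.min_exists N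
    (fun m A => ∃ S : Sys φ, S.Red ∧ ∃ eq : S.Q ≃ Fin m, ∀ i j, A i j = S.M (eq.symm i) (eq.symm j)) (by
      rintro m A ⟨S, hS, eq, hA⟩
      have hc : Nat.card S.Q = m := by rw [Nat.card_congr eq]; simp
      refine ⟨hc ▸ hN S hS, ?_, ?_⟩
      · obtain ⟨e⟩ := hS.1.1
        have : Nonempty (Fin m) := ⟨eq (S.cl e)⟩
        exact Fin.pos_iff_nonempty.2 this
      · intro B hB hcl i
        have := hS.2.1.toQ (eq ⁻¹' B) ?_ ?_ (eq.symm i)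
        · simpa using this
        · obtain ⟨j, hj⟩ := hB
          exact ⟨eq.symm j, by simpa using hj⟩
        · intro q hq r hr
          refine hcl _ hq _ ?_
          rw [hA]; simpa using hr) (by
      obtain ⟨S, ⟨w, hw⟩, hS⟩ := reduce hF S0 ⟨w0, hw0⟩ h0
      have eq : S.Q ≃ Fin (Nat.card S.Q) := Finite.equivFin S.Q
      exact ⟨_, _, l0, _, ⟨S, hS, eq, fun i j => rfl⟩, toFin S _ eq l0 w hw⟩)
  refine ⟨S, l, fun e => w (eq (S.cl e)), hS, ?_, ?_⟩
  · refine FeE.ofQ S (w := fun q => w (eq q)) ⟨fun q => hFe.1 _, fun q => ?_⟩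
    have h2 := hFe.2 (eq q)
    rw [← Equiv.sum_comp eq] at h2
    simpa [hA] using h2
  · intro S' hS' l' w' hw'
    obtain ⟨S1, ⟨w1, hw1⟩, hS1⟩ := reduce hF S' ⟨w', hw'⟩ hS'
    have eq1 : S1.Q ≃ Fin (Nat.card S1.Q) := Finite.equivFin S1.Q
    exact hmin _ _ l' _ ⟨S1, hS1, eq1, fun i j => rfl⟩ (toFin S1 _ eq1 l' w1 hw1)

theorem exists_Dir (S : Sys φ) (h : S.Red) : Nonempty (Dir S) := by
  have : ∀ e, e ∈ {e : S.E | S.f (S.src e) ≠ S.f (S.tgt e)} := by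
    refine h.2.1 _ ⟨⟨?_, ?_⟩, ?_⟩ ?_
    · intro g e he h
      rw [S.src_smul, S.tgt_smul, S.f_smul, S.f_smul] at h
      exact he (MulAction.injective _ h)
    · intro e he h
      rw [S.tgt_rev] at h
      exact he h.symm
    · intro d _ e he h
      exact he.1 (by have := he.2; change S.f (S.tgt e) ∈ S.U d at this; rw [← h] at this; exact this)
    · obtain ⟨d⟩ := h.1.1
      obtain ⟨e, he⟩ := S.C_nonempty h.1 d
      refine ⟨e, fun h => he.1 ?_⟩
      have := he.2; change S.f (S.tgt e) ∈ S.U d at this; rw [← h] at this; exact this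
  choose D hD using fun e => S.exists_dir (this e)
  exact ⟨⟨D, fun e => (hD e).1, fun e => (hD e).2⟩⟩

theorem dich (N : ℕ) (hN : ∀ S : Sys φ, S.Red → Nat.card S.Q ≤ N)
    (hF : ∃ a b : F, a * b ≠ b * a) (S0 : Sys φ) (h0 : S0.NF) (l0 : ℝ) (w0 : S0.E → ℝ)
    (hw0 : S0.FeE l0 w0) :
    ∃ S : Sys φ, S.Red ∧ ((∃ l w, l ≤ 1 ∧ S.FeE l w) ∨
      ∃ A : Dir S, (∀ a b, A.Taken a b → ∀ H, A.D^[H] a ≠ A.D^[H] b) ∧ ∃ e, 2 ≤ S.N 1 e) := by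
  obtain ⟨S, l, w, hS, hw, hmin⟩ := exists_minimal N hN hF S0 h0 l0 w0 hw0
  refine ⟨S, hS, ?_⟩
  by_cases hl : l ≤ 1
  · exact Or.inl ⟨l, w, hl, hw⟩
  · right
    obtain ⟨A⟩ := S.exists_Dir hS
    refine ⟨A, ?_, ?_⟩
    · intro a b hT H hH
      have hF1 : ∃ g : F, g ≠ 1 := by
        obtain ⟨a, b, hab⟩ := hF
        refine ⟨a, ?_⟩
        rintro rfl
        simp at hab
      obtain ⟨S', h1, l', h2, w', h3⟩ := A.caseA hS.2.1 hw hT hH hF1 hS.1.nf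
      exact absurd (hmin S' h1 l' w' h3) (not_le.2 h2)
    · refine A.expand (not_le.1 hl) hw.inv hw.pos ?_ hS.1.1
      intro d
      by_contra hne
      have hlt := lt_of_le_of_ne (hw.le d) hne
      obtain ⟨l', w', h2, h3⟩ := S.decrease hw (fun B hB hBn => ⟨d, hS.2.1 B hB hBn d, hlt⟩)
      exact absurd (hmin S hS.1.nf l' w' h3) (not_le.2 h2)

end Sys


namespace Tr
variable {F : Type} [Group F]

def Retr (A : Subgroup F) (r : F →* F) : Prop := (∀ g, r g ∈ A) ∧ ∀ g ∈ A, r g = g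

def Split1 (Ψ : MulAut F) : Prop := ∃ (A B : Subgroup F) (rA rB : F →* F),
  (∀ g, Ψ g ∈ A ↔ g ∈ A) ∧ (∀ g, Ψ g ∈ B ↔ g ∈ B) ∧ A ≠ ⊥ ∧ B ≠ ⊥ ∧
  Subgroup.closure ((A : Set F) ∪ B) = ⊤ ∧ Retr A rA ∧ Retr B rB ∧ (∀ g ∈ B, rA g = 1) ∧ ∀ g ∈ A, rB g = 1

def Split2 (Ψ : MulAut F) : Prop := ∃ (A : Subgroup F) (s : F) (rA : F →* F) (χ : F →* Z2),
  (∀ g, Ψ g ∈ A ↔ g ∈ A) ∧ s⁻¹ * Ψ s ∈ A ∧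
  Subgroup.closure ((A : Set F) ∪ {s}) = ⊤ ∧ Retr A rA ∧ χ s ≠ 1 ∧ ∀ g ∈ A, χ g = 1

theorem split (T : Tr F) (d : T.E) (hd : ∀ e, ∃ g : F, e = g • d ∨ e = g • T.rev d) (Ψ : MulAut F)
    (f : T.V → T.V) (hf : ∀ (g : F) x, f (g • x) = Ψ g • f x) (hU : ∀ x, f x ∈ T.U d ↔ x ∈ T.U d)
    (hE : T.ECond) : Split1 Ψ ∨ Split2 Ψ := by
  have hU1 : ∀ (g : F) x, f x ∈ T.U (Ψ g • d) ↔ x ∈ T.U (g • d) := by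
    intro g x
    rw [T.U_smul', T.U_smul', ← map_inv, ← hf, hU]
  have hU2 : ∀ (g : F) x, f x ∈ T.U (Ψ g • T.rev d) ↔ x ∈ T.U (g • T.rev d) := by
    intro g x
    rw [← T.rev_smul, ← T.rev_smul, T.U_rev, T.U_rev, hU1]
  have hinj : ∀ x y, f x = f y → x = y := by
    intro x y h
    by_contra hne
    obtain ⟨e, h1, h2⟩ := T.exists_dir hne
    have h3 : x ∉ T.U e := h1 ▸ T.src_notin e
    obtain ⟨g, rfl | rfl⟩ := hd e
    · rw [← hU1] at h2 h3
      rw [h] at h3; exact h3 h2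
    · rw [← hU2] at h2 h3
      rw [h] at h3; exact h3 h2
  have hseg : T.seg (f (T.src d)) (f (T.tgt d)) = {d} := by
    ext e
    rw [Set.mem_singleton_iff]
    constructor
    · rintro ⟨h1, h2⟩
      obtain ⟨g, h⟩ := hd e
      obtain ⟨g, rfl⟩ := Ψ.surjective g
      rcases h with rfl | rfl
      · rw [hU1] at h1 h2
        have h3 := T.crossing h1 h2
        have := T.free g d h3.symm
        rw [this, map_one, one_smul]
      · rw [hU2] at h1 h2
        have h3 := T.crossing h1 h2
        refine absurd ?_ (T.noinv g⁻¹ d)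
        rw [inv_smul_eq_iff]; exact h3
    · rintro rfl
      exact ⟨fun h => T.src_notin _ ((hU _).1 h), (hU _).2 (T.tgt_mem _)⟩
  obtain ⟨hv, ht⟩ := T.seg_single hseg
  have hstab : ∀ x, f x = x → ∀ g : F, Ψ g ∈ MulAction.stabilizer F x ↔ g ∈ MulAction.stabilizer F x := by
    intro x hx g
    rw [MulAction.mem_stabilizer_iff, MulAction.mem_stabilizer_iff]
    constructor
    · intro h
      apply hinj
      rw [hf, hx, h]
    · intro h
      have := hf g x
      rw [h, hx] at this
      exact this.symm
  have hr : ∀ x : T.V, ∃ r : F →* F, Retr (MulAction.stabilizer F x) r ∧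
      ∀ g v, (∀ h : F, v ≠ h • x) → g ∈ MulAction.stabilizer F v → r g = 1 := by
    intro x
    obtain ⟨r, h1, h2, h3⟩ := T.retraction x
    exact ⟨r, ⟨h1, h2⟩, h3⟩
  by_cases hc : ∃ s : F, T.tgt d = s • T.src d
  · right
    obtain ⟨s, hs⟩ := hc
    obtain ⟨r, hr1, _⟩ := hr (T.src d)
    obtain ⟨u, χ, hu1, hu2⟩ := T.edge_hom (G := Z2) (fun _ => Multiplicative.ofAdd 1)
      (fun _ => (z2inv _).symm) (fun _ _ => rfl)
    refine ⟨MulAction.stabilizer F (T.src d), s, r, χ, hstab _ hv.symm.symm, ?_, ?_, hr1, ?_, ?_⟩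
    · rw [MulAction.mem_stabilizer_iff, mul_smul, inv_smul_eq_iff, ← hs]
      have := hf s (T.src d)
      rw [← hs, hv, ht] at this
      exact this.symm
    · obtain ⟨H, hH⟩ : ∃ H, H = Subgroup.closure ((MulAction.stabilizer F (T.src d) : Set F) ∪ {s}) := ⟨_, rfl⟩
      rw [← hH]
      have hs' : s ∈ H := by rw [hH]; exact Subgroup.subset_closure (Or.inr rfl)
      have hA : ∀ g k : F, k ∈ H → g • T.src d = k • T.src d → g ∈ H := by
        intro g k hk h
        have : k⁻¹ * g ∈ H := by
          rw [hH]
          refine Subgroup.subset_closure (Or.inl ?_)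
          change _ • _ = _
          rw [mul_smul, h, inv_smul_smul]
        simpa using H.mul_mem hk this
      rw [eq_top_iff]
      intro g _
      have := T.conn {x | ∃ k ∈ H, x = k • T.src d} ⟨_, 1, H.one_mem, rfl⟩ ?_ (g • T.src d)
      · obtain ⟨k, hk, h⟩ := this
        exact hA g k hk h
      · rintro e ⟨k, hk, h⟩
        obtain ⟨g, rfl | rfl⟩ := hd e
        · rw [T.src_smul] at h
          refine ⟨g * s, H.mul_mem (hA g k hk h) hs', ?_⟩
          rw [mul_smul, ← hs, ← T.tgt_smul]; rfl
        · rw [T.src_smul] at h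
          change g • T.tgt d = _ at h
          rw [hs, ← mul_smul] at h
          have h1 := hA _ k hk h
          refine ⟨g, by simpa using H.mul_mem h1 (H.inv_mem hs'), ?_⟩
          rw [T.rev_smul, T.rev_rev, T.src_smul]
    · intro h
      have h1 := hu1 d
      rw [hs, hu2, h, one_mul] at h1
      have h2 : (Multiplicative.ofAdd 1 : Z2) = 1 := by simpa using h1.symm
      exact absurd h2 (by decide)
    · intro g hg
      have := hu2 g (T.src d)
      rw [MulAction.mem_stabilizer_iff.1 hg] at this
      simpa using this.symm
  · left
    push Not at hc
    have hc' : ∀ s : F, T.src d ≠ s • T.tgt d := by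
      intro s h
      refine hc s⁻¹ ?_
      rw [h, inv_smul_smul]
    obtain ⟨rA, hA1, hA2⟩ := hr (T.src d)
    obtain ⟨rB, hB1, hB2⟩ := hr (T.tgt d)
    refine ⟨MulAction.stabilizer F (T.src d), MulAction.stabilizer F (T.tgt d), rA, rB,
      hstab _ hv, hstab _ ht, ?_, ?_, ?_, hA1, hB1, fun g hg => hA2 g _ hc hg, fun g hg => hB2 g _ hc' hg⟩
    · intro hbot
      obtain ⟨g, hg⟩ := hE.2 (T.rev d) (T.tgt d)
      rw [T.U_rev] at hg
      have hne : T.src d ≠ g • T.tgt d := hc' g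
      obtain ⟨e, h1, h2⟩ := T.exists_dir hne
      obtain ⟨k, rfl | rfl⟩ := hd e
      · rw [T.src_smul] at h1
        have : k ∈ MulAction.stabilizer F (T.src d) := h1
        rw [hbot, Subgroup.mem_bot] at this
        rw [this, one_smul] at h2
        exact hg h2
      · rw [T.src_smul] at h1
        exact hc' k h1.symm
    · intro hbot
      obtain ⟨g, hg⟩ := hE.2 d (T.src d)
      have hne : T.tgt d ≠ g • T.src d := hc g
      obtain ⟨e, h1, h2⟩ := T.exists_dir hne
      obtain ⟨k, rfl | rfl⟩ := hd e
      · rw [T.src_smul] at h1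
        exact hc k h1.symm
      · rw [T.src_smul] at h1
        have : k ∈ MulAction.stabilizer F (T.tgt d) := h1
        rw [hbot, Subgroup.mem_bot] at this
        rw [this, one_smul, T.U_rev] at h2
        exact h2 hg
    · obtain ⟨H, hH⟩ : ∃ H, H = Subgroup.closure ((MulAction.stabilizer F (T.src d) : Set F) ∪
          (MulAction.stabilizer F (T.tgt d) : Set F)) := ⟨_, rfl⟩
      rw [← hH]
      have key : ∀ x : T.V, (∀ g : F, g ∈ MulAction.stabilizer F x → g ∈ H) →
          ∀ g k : F, k ∈ H → g • x = k • x → g ∈ H := by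
        intro x hx g k hk h
        have : k⁻¹ * g ∈ H := by
          refine hx _ ?_
          rw [MulAction.mem_stabilizer_iff, mul_smul, h, inv_smul_smul]
        simpa using H.mul_mem hk this
      have kA := key (T.src d) (fun g hg => by rw [hH]; exact Subgroup.subset_closure (Or.inl hg))
      have kB := key (T.tgt d) (fun g hg => by rw [hH]; exact Subgroup.subset_closure (Or.inr hg))
      rw [eq_top_iff]
      intro g _
      have := T.conn {x | ∃ k ∈ H, x = k • T.src d ∨ x = k • T.tgt d} ⟨_, 1, H.one_mem, Or.inl rfl⟩ ?_ (g • T.src d)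
      · obtain ⟨k, hk, h | h⟩ := this
        · exact kA g k hk h
        · refine absurd ?_ (hc' (g⁻¹ * k))
          rw [mul_smul, ← h, inv_smul_smul]
      · rintro e ⟨k, hk, h⟩
        obtain ⟨g, rfl | rfl⟩ := hd e
        · rw [T.src_smul] at h
          rcases h with h | h
          · refine ⟨g, kA g k hk h, Or.inr ?_⟩
            rw [← T.tgt_smul]; rfl
          · refine absurd ?_ (hc' (g⁻¹ * k))
            rw [mul_smul, ← h, inv_smul_smul]
        · rw [T.src_smul] at h
          change g • T.tgt d = _ ∨ g • T.tgt d = _ at h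
          rcases h with h | h
          · refine absurd ?_ (hc (g⁻¹ * k))
            rw [mul_smul, ← h, inv_smul_smul]
          · refine ⟨g, kB g k hk h, Or.inl ?_⟩
            rw [T.rev_smul, T.rev_rev, T.src_smul]

end Tr

namespace Sys
variable {F : Type} [Group F] {φ : MulAut F}

theorem caseL (S : Sys φ) (hS : S.Red) {l : ℝ} {w : S.E → ℝ} (hl : l ≤ 1) (hw : S.FeE l w) :
    ∃ p ≥ 1, ∃ u : F, Tr.Split1 (MulAut.conj u * φ ^ p) ∨ Tr.Split2 (MulAut.conj u * φ ^ p) := by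
  obtain ⟨e0, he0⟩ := hw.inv.exists_min hS.1.1
  have hcost : ∀ d, S.cost w d ≤ w d := fun d =>
    (hw.le d).trans (by have := hw.pos d; nlinarith)
  have hall : ∀ d, d ∈ {d | w d = w e0} := by
    refine hS.2.1 _ ⟨⟨?_, ?_⟩, ?_⟩ ⟨e0, rfl⟩
    · intro g e he
      rw [Set.mem_ofPred_eq, hw.inv.smul]; exact he
    · intro e he
      rw [Set.mem_ofPred_eq, hw.inv.rev]; exact he
    · intro d hd e he
      have h1 := hcost d
      have h2 : w e ≤ S.cost w d :=
        Finset.single_le_sum (f := w) (fun i _ => (hw.pos i).le) (S.mem_Cf.2 he)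
      rw [Set.mem_ofPred_eq] at hd ⊢
      exact le_antisymm (by linarith) (he0 e)
  have huniq : ∀ d, ∃ e, ∀ e', e' ∈ S.C d ↔ e' = e := by
    intro d
    obtain ⟨e, he⟩ := S.C_nonempty hS.1 d
    refine ⟨e, fun e' => ⟨fun he' => ?_, fun h => h ▸ he⟩⟩
    by_contra hne
    have h2 : ∑ i ∈ {e', e}, w i ≤ S.cost w d := by
      refine Finset.sum_le_sum_of_subset_of_nonneg ?_ (fun i _ _ => (hw.pos i).le)
      intro i hi
      rw [Finset.mem_insert, Finset.mem_singleton] at hi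
      rw [mem_Cf]
      rcases hi with rfl | rfl
      · exact he'
      · exact he
    rw [Finset.sum_pair hne] at h2
    have h1 := hcost d
    have h3 : w e' = w e0 := hall e'
    have h4 : w e = w e0 := hall e
    have h5 : w d = w e0 := hall d
    have := hw.pos e0
    linarith
  choose σ hσ using huniq
  have hfU : ∀ d x, S.f x ∈ S.U d ↔ x ∈ S.U (σ d) := by
    intro d
    have hm : σ d ∈ S.C d := (hσ d _).2 rfl
    have hm1 : S.f (S.src (σ d)) ∉ S.U d := hm.1
    have hm2 : S.f (S.tgt (σ d)) ∈ S.U d := hm.2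
    have h1 := S.src_notin (σ d)
    have h2 := S.tgt_mem (σ d)
    refine S.conn {x | S.f x ∈ S.U d ↔ x ∈ S.U (σ d)} ⟨S.src (σ d), iff_of_false hm1 h1⟩ ?_
    intro e he
    change S.f (S.tgt e) ∈ S.U d ↔ S.tgt e ∈ S.U (σ d)
    by_cases c1 : σ d = e
    · rw [← c1]; exact iff_of_true hm2 h2
    by_cases c2 : σ d = S.rev e
    · have : S.tgt e = S.src (σ d) := by rw [c2]; rfl
      rw [this]; exact iff_of_false hm1 h1
    have h3 : S.src e ∈ S.U (σ d) ↔ S.tgt e ∈ S.U (σ d) := S.cross _ _ c1 c2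
    rw [← h3, ← show _ ↔ _ from he]
    have n1 : e ∉ S.C d := fun h => c1 ((hσ d _).1 h).symm
    have n2 : S.rev e ∉ S.C d := fun h => c2 ((hσ d _).1 h).symm
    rw [mem_C] at n1 n2
    rw [S.tgt_rev] at n2
    change ¬ (S.f (S.tgt e) ∉ _ ∧ _) at n2
    tauto
  have hfU' : ∀ k d x, S.f^[k] x ∈ S.U d ↔ x ∈ S.U (σ^[k] d) := by
    intro k
    induction k with
    | zero => intro d x; rfl
    | succ k ih =>
      intro d x
      rw [Function.iterate_succ_apply', hfU, ih, ← Function.iterate_succ_apply]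
  obtain ⟨i, j, hij, heq⟩ : ∃ i j : ℕ, i < j ∧ S.mkO (σ^[i] e0) = S.mkO (σ^[j] e0) := by
    obtain ⟨i, j, hne, h⟩ := Finite.exists_ne_map_eq_of_infinite (fun i : ℕ => S.mkO (σ^[i] e0))
    rcases lt_or_gt_of_ne hne with h1 | h1
    · exact ⟨i, j, h1, h⟩
    · exact ⟨j, i, h1, h.symm⟩
  obtain ⟨d0, hd0⟩ : ∃ d0, d0 = σ^[i] e0 := ⟨_, rfl⟩
  obtain ⟨p, hp⟩ : ∃ p, p = j - i := ⟨_, rfl⟩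
  have hσp : σ^[j] e0 = σ^[p] d0 := by
    rw [hd0, ← Function.iterate_add_apply, hp, Nat.sub_add_cancel hij.le]
  rw [hσp, ← hd0] at heq
  obtain ⟨g, hg⟩ := S.mkO_eq.1 heq.symm
  refine ⟨p, by omega, (φ ^ p) g, ?_⟩
  have hK : S.Inv (S.orb d0) := by
    refine ⟨?_, ?_⟩
    · rintro k e ⟨h, rfl | rfl⟩
      · exact ⟨k * h, Or.inl (mul_smul _ _ _).symm⟩
      · exact ⟨k * h, Or.inr (mul_smul _ _ _).symm⟩
    · rintro e ⟨h, rfl | rfl⟩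
      · exact ⟨h, Or.inr (S.rev_smul _ _)⟩
      · exact ⟨h, Or.inl (by rw [S.rev_smul, S.rev_rev])⟩
  have hd0K : d0 ∈ S.orb d0 := ⟨1, Or.inl (one_smul _ _).symm⟩
  obtain ⟨Ψ, hΨ⟩ : ∃ Ψ, Ψ = MulAut.conj ((φ ^ p) g) * φ ^ p := ⟨_, rfl⟩
  rw [← hΨ]
  have hΨ' : ∀ h, Ψ h = (φ ^ p) (g * h * g⁻¹) := by
    intro h
    rw [hΨ, MulAut.mul_apply, MulAut.conj_apply, map_mul, map_mul, map_inv]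
  have hFs : ∀ (h : F) x, S.f^[p] (g • h • x) = Ψ h • S.f^[p] (g • x) := by
    intro h x
    rw [hΨ', ← S.iter_f_smul, ← mul_smul, ← mul_smul]
    simp
  have hFU : ∀ x, S.f^[p] (g • x) ∈ S.U d0 ↔ x ∈ S.U d0 := by
    intro x
    rw [hfU', ← hg, S.U_smul]
  have hFU1 : ∀ (h : F) x, S.f^[p] (g • x) ∈ S.U (Ψ h • d0) ↔ x ∈ S.U (h • d0) := by
    intro h x
    rw [S.U_smul', S.U_smul', ← map_inv, ← hFs, hFU]
  have hdesc : ∀ x y, S.ks (S.orb d0) x y → S.ks (S.orb d0) (S.f^[p] (g • x)) (S.f^[p] (g • y)) := by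
    intro x y hxy
    rw [S.ks_iff] at hxy ⊢
    rintro d ⟨h, hd⟩
    obtain ⟨h, rfl⟩ := Ψ.surjective h
    have h1 := hxy (h • d0) ⟨h, Or.inl rfl⟩
    rcases hd with rfl | rfl
    · rw [hFU1, hFU1]; exact h1
    · rw [← S.rev_smul, S.U_rev, S.U_rev, hFU1, hFU1, h1]
  refine (S.toTr.quot (S.orb d0) hK).split ⟨d0, hd0K⟩ ?_ Ψ
    (Quotient.map (fun x => S.f^[p] (g • x)) (fun x y h => hdesc x y h)) ?_ ?_
    (hS.1.quot hK ⟨d0, hd0K⟩)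
  · rintro ⟨e, k, h⟩
    refine ⟨k, h.imp (fun h => Subtype.ext h) (fun h => Subtype.ext h)⟩
  · rintro h ⟨x⟩
    exact congrArg (Quotient.mk (S.ks (S.orb d0))) (hFs h x)
  · rintro ⟨x⟩
    exact hFU x

end Sys


namespace Cay
variable {n : ℕ}
abbrev Fn (n : ℕ) := FreeGroup (Fin n)

def nb (a : Fin n × Bool) : Fin n × Bool := (a.1, !a.2)

theorem nb_nb (a : Fin n × Bool) : nb (nb a) = a := by simp [nb]

theorem mk_nb (a : Fin n × Bool) : FreeGroup.mk [a] * FreeGroup.mk [nb a] = 1 := by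
  rw [FreeGroup.mul_mk, FreeGroup.one_eq_mk]
  exact Quot.sound (by simpa [nb] using FreeGroup.Red.Step.not (L₁ := []) (L₂ := []) (x := a.1) (b := a.2))

theorem mk_nb' (a : Fin n × Bool) : FreeGroup.mk [nb a] * FreeGroup.mk [a] = 1 := by
  have := mk_nb (nb a); rwa [nb_nb] at this

/-- starts with -/
def sw (a : Fin n × Bool) (y : Fn n) : Prop := y.toWord.head? = some a

theorem sw_nb (a : Fin n × Bool) (y : Fn n) :
    sw (nb a) (FreeGroup.mk [nb a] * y) ↔ ¬ sw a y := by
  unfold sw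
  rw [FreeGroup.toWord_mul, FreeGroup.toWord_mk]
  have hr : (y.toWord) = FreeGroup.reduce y.toWord := by simp
  have : FreeGroup.reduce (FreeGroup.reduce [nb a] ++ y.toWord) = FreeGroup.reduce (nb a :: y.toWord) := by
    simp
  rw [this, FreeGroup.reduce.cons, ← hr]
  have hred := FreeGroup.isReduced_toWord (x := y)
  rcases hy : y.toWord with _ | ⟨c, _ | ⟨c', L⟩⟩
  · simp
  · simp only [nb]; grind
  · rw [hy] at hred
    have h1 := FreeGroup.isReduced_cons_cons.mp hred
    simp only [nb]; grind

theorem head_app (b : Fin n × Bool) (L : List (Fin n × Bool)) (hL : FreeGroup.IsReduced L)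
    (h1 : L ≠ []) (h2 : L ≠ [nb b]) : (FreeGroup.reduce (L ++ [b])).head? = L.head? := by
  induction L with
  | nil => exact absurd rfl h1
  | cons c L ih =>
    rcases L with _ | ⟨c', L⟩
    · have : c ≠ nb b := fun h => h2 (by rw [h])
      simp only [List.cons_append, List.nil_append, FreeGroup.reduce.cons, FreeGroup.reduce_nil]
      simp only [nb] at this
      grind
    · have h := FreeGroup.isReduced_cons_cons.mp hL
      by_cases hc : c' :: L = [nb b]
      · rw [hc, List.cons_append, FreeGroup.reduce.cons]
        have : FreeGroup.reduce ([nb b] ++ [b]) = [] := by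
          simp [nb]
        rw [this]; rfl
      · have := ih h.2 (by simp) hc
        rw [List.cons_append, FreeGroup.reduce.cons]
        rcases hx : FreeGroup.reduce (c' :: L ++ [b]) with _ | ⟨e, M⟩
        · rfl
        · rw [hx] at this
          simp only [List.head?_cons, Option.some.injEq] at this
          subst this
          have h1 := h.1
          grind

theorem sw_mul (a b : Fin n × Bool) (y : Fn n) (h1 : ¬ (y = 1 ∧ a = b))
    (h2 : ¬ (y * FreeGroup.mk [b] = 1 ∧ a = nb b)) :
    sw a y ↔ sw a (y * FreeGroup.mk [b]) := by
  by_cases hy : y = 1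
  · subst hy
    have : a ≠ b := fun h => h1 ⟨rfl, h⟩
    simp [sw, this.symm]
  · by_cases hy2 : y.toWord = [nb b]
    · have : y = FreeGroup.mk [nb b] := by rw [← hy2, FreeGroup.mk_toWord]
      subst this
      rw [mk_nb'] at h2 ⊢
      have : a ≠ nb b := fun h => h2 ⟨rfl, h⟩
      simp [sw, this.symm]
    · unfold sw
      rw [FreeGroup.toWord_mul, FreeGroup.toWord_mk]
      have : FreeGroup.reduce [b] = [b] := by simp
      rw [this, head_app b _ FreeGroup.isReduced_toWord (by simpa using hy) hy2]

theorem gen_ind (A : Set (Fn n)) (a0 : Fn n) (h0 : a0 ∈ A)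
    (h : ∀ x ∈ A, ∀ a, x * FreeGroup.mk [a] ∈ A) (x : Fn n) : x ∈ A := by
  have key : ∀ L : List (Fin n × Bool), ∀ y ∈ A, y * FreeGroup.mk L ∈ A := by
    intro L
    induction L with
    | nil => intro y hy; rw [← FreeGroup.one_eq_mk, mul_one]; exact hy
    | cons c L ih =>
      intro y hy
      have : FreeGroup.mk (c :: L) = FreeGroup.mk [c] * FreeGroup.mk L := by
        rw [FreeGroup.mul_mk]; rfl
      rw [this, ← mul_assoc]
      exact ih _ (h y hy c)
  have := key (a0⁻¹ * x).toWord a0 h0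
  rwa [FreeGroup.mk_toWord, mul_inv_cancel_left] at this

instance actE : MulAction (Fn n) (Fn n × (Fin n × Bool)) where
  smul g e := (g * e.1, e.2)
  one_smul e := by
    change (1 * e.1, e.2) = e
    simp
  mul_smul g h e := by
    change ((g * h) * e.1, e.2) = (g * (h * e.1), e.2)
    rw [mul_assoc]

theorem smul_eq (g : Fn n) (e : Fn n × (Fin n × Bool)) : g • e = (g * e.1, e.2) := rfl

def tr (n : ℕ) : Tr (Fn n) where
  V := Fn n
  E := Fn n × (Fin n × Bool)
  actV := inferInstance
  actE := actE
  src e := e.1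
  rev e := (e.1 * FreeGroup.mk [e.2], nb e.2)
  U e := {x | sw e.2 (e.1⁻¹ * x)}
  rev_rev e := by
    ext1
    · simp only [mul_assoc, mk_nb, mul_one]
    · simp only [nb_nb]
  src_smul g e := rfl
  rev_smul g e := by simp [smul_eq, mul_assoc]
  U_smul g e x := by
    simp only [smul_eq, Set.mem_ofPred_eq, smul_eq_mul, mul_inv_rev, mul_assoc, inv_mul_cancel_left]
  U_rev e x := by
    simp only [Set.mem_ofPred_eq]
    rw [← sw_nb, mul_inv_rev, ← eq_inv_of_mul_eq_one_right (mk_nb _), mul_assoc]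
  src_notin e := by simp [sw]
  cross d e h1 h2 := by
    simp only [Set.mem_ofPred_eq, ← mul_assoc]
    apply sw_mul
    · rintro ⟨h3, h4⟩
      rw [inv_mul_eq_one] at h3
      exact h1 (Prod.ext h3 h4)
    · rintro ⟨h3, h4⟩
      rw [mul_assoc, inv_mul_eq_one] at h3
      exact h2 (Prod.ext h3 h4)
  conn A hA h x := by
    obtain ⟨a, ha⟩ := hA
    exact gen_ind A a ha (fun x hx a => h (x, a) hx) x
  free g e h := by
    have := congrArg Prod.fst h
    simpa [smul_eq] using this
  noinv g e h := by
    have := congrArg (fun x => x.2.2) h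
    simp [smul_eq, nb] at this
  fin := by
    refine ⟨Set.range fun a => (1, a), Set.finite_range _, fun e => ⟨e.1, (1, e.2), ⟨_, rfl⟩, ?_⟩⟩
    simp [smul_eq]
  ne := ⟨(1 : Fn n)⟩

def sys (φ : MulAut (Fn n)) : Sys φ where
  toTr := tr n
  f x := φ x
  f_smul g x := map_mul φ g (show Fn n from x)

theorem sys_nf (hn : 1 ≤ n) (φ : MulAut (Fn n)) : (sys φ).NF := by
  intro x
  refine ⟨FreeGroup.of ⟨0, hn⟩, fun h => ?_⟩
  have key : ∀ y : Fn n, FreeGroup.of ⟨0, hn⟩ * y = y → False := fun y h =>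
    FreeGroup.of_ne_one _ (mul_eq_right.1 h)
  exact key x h

def ed (φ : MulAut (Fn n)) (e : Fn n × (Fin n × Bool)) : (sys φ).E := e

theorem sys_fe (φ : MulAut (Fn n)) : ∃ l w, (sys φ).FeE l w := by
  have hi : (sys φ).WInv (fun _ => 1) := ⟨fun _ _ => rfl, fun _ => rfl⟩
  refine ⟨∑ a : Fin n × Bool, (sys φ).cost (fun _ => 1) (ed φ (1, a)), fun _ => 1, hi, fun _ => one_pos, ?_⟩
  intro d
  obtain ⟨g, a, rfl⟩ : ∃ g a, d = g • ed φ (1, a) := by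
    refine ⟨(show Fn n × (Fin n × Bool) from d).1, (show Fn n × (Fin n × Bool) from d).2, ?_⟩
    have key : ∀ e : Fn n × (Fin n × Bool), e = (e.1 * 1, e.2) := fun e => by rw [mul_one]
    exact key d
  rw [(sys φ).cost_smul hi g, mul_one]
  refine Finset.single_le_sum (f := fun a : Fin n × Bool => (sys φ).cost (fun _ => 1) (ed φ (1, a))) (fun a _ => ?_) (Finset.mem_univ a)
  exact Finset.sum_nonneg fun _ _ => zero_le_one

theorem homZ2_finite : Finite (Fn n →* Tr.Z2) := Finite.of_equiv _ (FreeGroup.lift (α := Fin n) (β := Tr.Z2))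

theorem homZ2_card : Nat.card (Fn n →* Tr.Z2) = 2 ^ n := by
  rw [← Nat.card_congr (FreeGroup.lift (α := Fin n) (β := Tr.Z2))]
  simp [Tr.Z2]

theorem free_Z2 (G : Type) [Group G] [IsFreeGroup G] (h : ∃ g : G, g ≠ 1) : ∃ χ : G →* Tr.Z2, ∃ g, χ g ≠ 1 := by
  by_contra hc
  push Not at hc
  have : IsEmpty (IsFreeGroup.Generators G) := by
    constructor
    intro x
    have := hc (IsFreeGroup.lift (fun _ => Multiplicative.ofAdd (1 : ZMod 2))) (IsFreeGroup.of x)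
    rw [IsFreeGroup.lift_of] at this
    revert this; decide
  obtain ⟨g, hg⟩ := h
  apply hg
  apply (IsFreeGroup.toFreeGroup G).injective
  exact Subsingleton.elim _ _

theorem sub_Z2 (H : Subgroup (Fn n)) (h : H ≠ ⊥) : ∃ χ : H →* Tr.Z2, ∃ g, χ g ≠ 1 := by
  apply free_Z2
  exact H.ne_bot_iff_exists_ne_one.1 h

theorem noncomm (hn : 2 ≤ n) : ∃ a b : Fn n, a * b ≠ b * a := by
  refine ⟨FreeGroup.of ⟨0, by omega⟩, FreeGroup.of ⟨1, by omega⟩, fun h => ?_⟩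
  have := congrArg FreeGroup.toWord h
  simp [FreeGroup.of, FreeGroup.mul_mk, FreeGroup.toWord_mk, FreeGroup.reduce.cons] at this

theorem red_card (φ : MulAut (Fn n)) (S : Sys φ) (hS : S.Red) : Nat.card S.Q ≤ 6 * n := by
  have := homZ2_finite (n := n)
  exact S.bound n homZ2_card.le sub_Z2 hS.1.1 hS.2.2

end Cay


namespace Cay
variable {n : ℕ}

theorem lip (ℓ : Fn n → ℕ) (h1 : ℓ 1 = 0) (hm : ∀ x y, ℓ (x * y) ≤ ℓ x + ℓ y) :
    ∃ B, ∀ g, ℓ g ≤ B * g.norm := by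
  refine ⟨∑ a : Fin n × Bool, ℓ (FreeGroup.mk [a]), fun g => ?_⟩
  obtain ⟨B, hB⟩ : ∃ B, B = ∑ a : Fin n × Bool, ℓ (FreeGroup.mk [a]) := ⟨_, rfl⟩
  rw [← hB]
  have key : ∀ L : List (Fin n × Bool), ℓ (FreeGroup.mk L) ≤ B * L.length := by
    intro L
    induction L with
    | nil => rw [← FreeGroup.one_eq_mk, h1]; simp
    | cons c L ih =>
      have h2 : FreeGroup.mk (c :: L) = FreeGroup.mk [c] * FreeGroup.mk L := by
        rw [FreeGroup.mul_mk]; rfl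
      have h3 : ℓ (FreeGroup.mk [c]) ≤ B := by
        rw [hB]
        exact Finset.single_le_sum (f := fun a : Fin n × Bool => ℓ (FreeGroup.mk [a]))
          (fun _ _ => Nat.zero_le _) (Finset.mem_univ c)
      have := hm (FreeGroup.mk [c]) (FreeGroup.mk L)
      rw [h2, List.length_cons, mul_add]
      omega
  have := key g.toWord
  rwa [FreeGroup.mk_toWord] at this

/-- all conjugacy classes polynomially bounded -/
def PB (φ : MulAut (Fn n)) : Prop := ∀ g, ∃ C D : ℕ, ∀ k ≥ 1, ∃ u : Fn n,
  (u * (φ ^ k) g * u⁻¹).norm ≤ C * k ^ D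

theorem exp_beats (C D : ℕ) : ∃ m : ℕ, 1 ≤ m ∧ C * m ^ D < 2 ^ m := by
  have h := tendsto_pow_const_div_const_pow_of_one_lt D (r := (2 : ℝ)) (by norm_num)
  have h2 := (h.eventually (gt_mem_nhds (show (0:ℝ) < 1 / (C + 1) by positivity))).and
    (Filter.eventually_ge_atTop 1)
  obtain ⟨m, hm, h1⟩ := h2.exists
  refine ⟨m, h1, ?_⟩
  rw [div_lt_div_iff₀ (by positivity) (by positivity)] at hm
  have : (m : ℝ) ^ D * (C + 1) < 1 * 2 ^ m := hm
  have h3 : m ^ D * (C + 1) < 1 * 2 ^ m := by exact_mod_cast this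
  have : 0 ≤ m ^ D := Nat.zero_le _
  nlinarith

theorem exp_contra {φ : MulAut (Fn n)} (hφ : PB φ) (S : Sys φ) (h : Fn n) (d : S.E)
    (hB : ∀ R j, R * S.N j d ≤ S.L (S.f^[j] (S.src d)) (((φ ^ j) h) ^ R • S.f^[j] (S.tgt d)))
    (hE : ∃ i K, ∀ j, 2 ^ j ≤ S.N (i + K * j) d) : False := by
  obtain ⟨x0⟩ := S.ne
  obtain ⟨B, hBB⟩ := lip (n := n) (fun g => S.L x0 (g • x0))
    (by
      change (S.seg x0 ((1 : Fn n) • x0)).ncard = 0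
      rw [one_smul, S.seg_self, Set.ncard_empty])
    (fun x y => by
      have h1 := S.seg_ncard_le x0 (x • x0) ((x * y) • x0)
      rw [mul_smul, S.seg_ncard_smul] at h1
      rw [mul_smul]; exact h1)
  have hpow : ∀ (δ : Fn n) (R : ℕ), S.L x0 (δ ^ R • x0) ≤ R * (B * δ.norm) := by
    intro δ R
    induction R with
    | zero =>
      change (S.seg x0 ((δ ^ 0) • x0)).ncard ≤ _
      rw [pow_zero, one_smul, S.seg_self, Set.ncard_empty]; exact Nat.zero_le _
    | succ R ih =>
      have h1 := S.seg_ncard_le x0 (δ ^ R • x0) (δ ^ (R + 1) • x0)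
      rw [pow_succ, mul_smul, S.seg_ncard_smul] at h1
      rw [pow_succ, mul_smul, add_mul, one_mul]
      exact h1.trans (add_le_add ih (hBB δ))
  have key : ∀ j (u : Fn n), S.N j d ≤ B * (u * (φ ^ j) h * u⁻¹).norm := by
    intro j u
    by_contra hc
    push Not at hc
    obtain ⟨δ, hδ⟩ : ∃ δ, δ = u * (φ ^ j) h * u⁻¹ := ⟨_, rfl⟩
    rw [← hδ] at hc
    obtain ⟨P, hP⟩ : ∃ P, P = S.f^[j] (S.src d) := ⟨_, rfl⟩
    obtain ⟨Q, hQ⟩ : ∃ Q, Q = S.f^[j] (S.tgt d) := ⟨_, rfl⟩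
    have h1 := hB (S.L (u • P) x0 + S.L x0 (u • Q) + 1) j
    obtain ⟨R, hR⟩ : ∃ R, R = S.L (u • P) x0 + S.L x0 (u • Q) + 1 := ⟨_, rfl⟩
    rw [← hR, ← hP, ← hQ] at h1
    have h2 : S.L P (((φ ^ j) h) ^ R • Q) = S.L (u • P) (δ ^ R • u • Q) := by
      have e : δ ^ R = u * ((φ ^ j) h) ^ R * u⁻¹ := by rw [hδ, conj_pow]
      rw [e, mul_smul, mul_smul, inv_smul_smul]
      exact (S.seg_ncard_smul u _ _).symm
    have h3 : S.L (u • P) (δ ^ R • u • Q) ≤ S.L (u • P) x0 + S.L x0 (δ ^ R • u • Q) := S.seg_ncard_le _ _ _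
    have h4 : S.L x0 (δ ^ R • u • Q) ≤ S.L x0 (δ ^ R • x0) + S.L (δ ^ R • x0) (δ ^ R • u • Q) := S.seg_ncard_le _ _ _
    have h5 : S.L (δ ^ R • x0) (δ ^ R • u • Q) = S.L x0 (u • Q) := S.seg_ncard_smul _ _ _
    have h6 := hpow δ R
    have h7 : R * (B * δ.norm + 1) ≤ R * S.N j d := Nat.mul_le_mul_left R hc
    rw [mul_add, mul_one] at h7
    omega
  obtain ⟨i, K, hiK⟩ := hE
  obtain ⟨C, D, hCD⟩ := hφ h
  obtain ⟨m, hm1, hm⟩ := exp_beats (S.N 0 d + B * C * (i + K) ^ D) D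
  have h1 := hiK m
  rcases Nat.eq_zero_or_pos (i + K * m) with h0 | h0
  · rw [h0] at h1
    have h2 : 1 ≤ m ^ D := Nat.one_le_pow _ _ hm1
    have h3 : (S.N 0 d + B * C * (i + K) ^ D) * 1 ≤ (S.N 0 d + B * C * (i + K) ^ D) * m ^ D :=
      Nat.mul_le_mul_left _ h2
    have h4 := Nat.zero_le (B * C * (i + K) ^ D)
    omega
  · obtain ⟨u, hu⟩ := hCD _ h0
    have h2 := key (i + K * m) u
    have h3 : (i + K * m) ^ D ≤ (i + K) ^ D * m ^ D := by
      rw [← mul_pow]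
      apply Nat.pow_le_pow_left
      nlinarith
    have h4 : B * (u * (φ ^ (i + K * m)) h * u⁻¹).norm ≤ B * (C * ((i + K) ^ D * m ^ D)) :=
      Nat.mul_le_mul_left _ (hu.trans (Nat.mul_le_mul_left _ h3))
    have h5 : B * (C * ((i + K) ^ D * m ^ D)) = B * C * (i + K) ^ D * m ^ D := by ring
    have h6 : (S.N 0 d + B * C * (i + K) ^ D) * m ^ D = S.N 0 d * m ^ D + B * C * (i + K) ^ D * m ^ D := by ring
    omega

theorem kt (hn : 2 ≤ n) {φ : MulAut (Fn n)} (hφ : PB φ) :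
    ∃ p ≥ 1, ∃ u : Fn n, Tr.Split1 (MulAut.conj u * φ ^ p) ∨ Tr.Split2 (MulAut.conj u * φ ^ p) := by
  obtain ⟨l0, w0, hw0⟩ := sys_fe φ
  obtain ⟨S, hS, ⟨l, w, hl, hw⟩ | ⟨A, hT, hexp⟩⟩ := Sys.dich (6 * n) (red_card φ) (noncomm hn) (sys φ)
    (sys_nf (by omega) φ) l0 w0 hw0
  · exact S.caseL hS hl hw
  · exfalso
    obtain ⟨h, d, hB⟩ := Sys.Dir.caseB hT hS.2.1 hexp
    exact exp_contra hφ S h d hB (Sys.Dir.expgrow hT hS.2.1 hexp d)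

end Cay


namespace Cay

def Bd (m : ℕ) (f : ℕ → ℕ) : Prop := ∃ C, ∀ k, f k ≤ C * (k + 1) ^ m

theorem Bd.mono {m : ℕ} {f g : ℕ → ℕ} (h : Bd m f) (hg : ∀ k, g k ≤ f k) : Bd m g := by
  obtain ⟨C, hC⟩ := h
  exact ⟨C, fun k => (hg k).trans (hC k)⟩

theorem Bd.add {m : ℕ} {f g : ℕ → ℕ} (hf : Bd m f) (hg : Bd m g) : Bd m (fun k => f k + g k) := by
  obtain ⟨C, hC⟩ := hf
  obtain ⟨D, hD⟩ := hg
  exact ⟨C + D, fun k => by rw [add_mul]; exact add_le_add (hC k) (hD k)⟩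

theorem Bd.cmul {m : ℕ} {f : ℕ → ℕ} (B : ℕ) (hf : Bd m f) : Bd m (fun k => B * f k) := by
  obtain ⟨C, hC⟩ := hf
  exact ⟨B * C, fun k => by rw [mul_assoc]; exact Nat.mul_le_mul_left _ (hC k)⟩

theorem Bd.exp {m m' : ℕ} {f : ℕ → ℕ} (hf : Bd m f) (h : m ≤ m') : Bd m' f := by
  obtain ⟨C, hC⟩ := hf
  exact ⟨C, fun k => (hC k).trans (Nat.mul_le_mul_left _ (Nat.pow_le_pow_right (by omega) h))⟩

theorem Bd.sum {m : ℕ} {f g : ℕ → ℕ} (hf : Bd m f) (h0 : g 0 = 0)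
    (hs : ∀ k, g (k + 1) ≤ g k + f k) : Bd (m + 1) g := by
  obtain ⟨C, hC⟩ := hf
  refine ⟨C, fun k => ?_⟩
  induction k with
  | zero => rw [h0]; exact Nat.zero_le _
  | succ k ih =>
    refine (hs k).trans ?_
    have h1 := hC k
    have h2 : (k + 1) ^ m ≤ (k + 1 + 1) ^ m := Nat.pow_le_pow_left (by omega) _
    have h3 : C * (k + 1) ^ (m + 1) + C * (k + 1) ^ m = C * (k + 1) ^ m * (k + 1 + 1) := by ring
    have h4 : C * (k + 1) ^ m * (k + 1 + 1) ≤ C * (k + 1 + 1) ^ m * (k + 1 + 1) :=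
      Nat.mul_le_mul_right _ (Nat.mul_le_mul_left _ h2)
    have h5 : C * (k + 1 + 1) ^ m * (k + 1 + 1) = C * (k + 1 + 1) ^ (m + 1) := by ring
    omega

theorem Bd.sub {m : ℕ} {f : ℕ → ℕ} (p : ℕ) (hp : 1 ≤ p)
    (h : ∀ q, Bd m (fun k => f (p * k + q))) : Bd m f := by
  choose C hC using h
  refine ⟨∑ q ∈ Finset.range p, C q, fun k => ?_⟩
  have h1 := hC (k % p) (k / p)
  simp only [Nat.div_add_mod] at h1
  refine h1.trans (Nat.mul_le_mul ?_ (Nat.pow_le_pow_left ?_ _))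
  · exact Finset.single_le_sum (f := C) (fun _ _ => Nat.zero_le _)
      (Finset.mem_range.2 (Nat.mod_lt _ hp))
  · have := Nat.div_le_self k p
    omega

section Pi
variable {F : Type} [Group F]

def Pi (v : F) (θ : MulAut F) : ℕ → F
  | 0 => 1
  | k + 1 => v * θ (Pi v θ k)

theorem Pi_zero (v : F) (θ : MulAut F) : Pi v θ 0 = 1 := rfl
theorem Pi_succ (v : F) (θ : MulAut F) (k : ℕ) : Pi v θ (k + 1) = v * θ (Pi v θ k) := rfl

theorem Pi_add (v : F) (θ : MulAut F) (j k : ℕ) :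
    Pi v θ (j + k) = Pi v θ j * (θ ^ j) (Pi v θ k) := by
  induction j with
  | zero => simp [Pi_zero]
  | succ j ih =>
    rw [Nat.add_right_comm, Pi_succ, ih, Pi_succ, map_mul, pow_succ', MulAut.mul_apply, mul_assoc]

theorem Pi_one (v : F) (θ : MulAut F) : Pi v θ 1 = v := by simp [Pi]

theorem Pi_succ' (v : F) (θ : MulAut F) (k : ℕ) : Pi v θ (k + 1) = Pi v θ k * (θ ^ k) v := by
  rw [Pi_add, Pi_one]

theorem Pi_mul (v : F) (θ : MulAut F) (p k : ℕ) : Pi v θ (p * k) = Pi (Pi v θ p) (θ ^ p) k := by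
  induction k with
  | zero => rfl
  | succ k ih => rw [Nat.mul_succ, Nat.add_comm, Pi_add, ih, Pi_succ]

theorem Pi_conj (v u : F) (θ : MulAut F) (k : ℕ) :
    Pi v (MulAut.conj u * θ) k = Pi (v * u) θ k * (Pi u θ k)⁻¹ := by
  induction k with
  | zero => simp [Pi_zero]
  | succ k ih =>
    rw [Pi_succ, ih, Pi_succ, Pi_succ, MulAut.mul_apply, MulAut.conj_apply, map_mul, map_inv]
    group

theorem conj_pow_apply (u : F) (θ : MulAut F) (k : ℕ) (x : F) :
    ((MulAut.conj u * θ) ^ k) x = Pi u θ k * (θ ^ k) x * (Pi u θ k)⁻¹ := by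
  induction k with
  | zero => simp [Pi_zero]
  | succ k ih =>
    rw [pow_succ', MulAut.mul_apply, ih, Pi_succ, MulAut.mul_apply, MulAut.conj_apply, pow_succ',
      MulAut.mul_apply, map_mul, map_mul, map_inv]
    group

end Pi

section A
variable {a : ℕ}

def Star (n : ℕ) : Prop := ∀ φ : MulAut (Fn n), PB φ → ∃ p ≥ 1, ∃ w : Fn n, ∀ g,
  Bd (n - 1) (fun k => (((MulAut.conj w * φ ^ p) ^ k) g).norm)

theorem lemA (hS : Star a) (θ : MulAut (Fn a)) (hθ : PB θ) :
    (∀ x, Bd a (fun k => ((θ ^ k) x).norm)) ∧ ∀ v, Bd a (fun k => (Pi v θ k).norm) := by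
  rcases Nat.eq_zero_or_pos a with rfl | ha
  · have h0 : ∀ x : Fn 0, x.norm = 0 := fun x => by
      rw [FreeGroup.norm_eq_zero]; exact Subsingleton.elim _ _
    exact ⟨fun x => ⟨0, fun k => by simp [h0]⟩, fun x => ⟨0, fun k => by simp [h0]⟩⟩
  obtain ⟨p, hp, w, hw⟩ := hS θ hθ
  obtain ⟨Ψ, hΨ⟩ : ∃ Ψ, Ψ = MulAut.conj w * θ ^ p := ⟨_, rfl⟩
  rw [← hΨ] at hw
  have hθp : θ ^ p = MulAut.conj w⁻¹ * Ψ := by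
    rw [hΨ, map_inv, inv_mul_cancel_left]
  have h2 : ∀ v, Bd a (fun k => (Pi v Ψ k).norm) := by
    intro v
    have := (hw v).sum (g := fun k => (Pi v Ψ k).norm) (by simp [Pi_zero]) (fun k => by
      rw [Pi_succ']; exact FreeGroup.norm_mul_le _ _)
    rwa [Nat.sub_add_cancel ha] at this
  have h3 : ∀ x, Bd a (fun k => ((θ ^ (p * k)) x).norm) := by
    intro x
    refine (((h2 w⁻¹).add ((hw x).exp (Nat.sub_le _ _))).add (h2 w⁻¹)).mono fun k => ?_
    rw [pow_mul, hθp, conj_pow_apply]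
    refine (FreeGroup.norm_mul_le _ _).trans (add_le_add (FreeGroup.norm_mul_le _ _) ?_)
    rw [FreeGroup.norm_inv_eq]
  have h4 : ∀ v, Bd a (fun k => (Pi v (θ ^ p) k).norm) := by
    intro v
    refine ((h2 (v * w⁻¹)).add (h2 w⁻¹)).mono fun k => ?_
    rw [hθp, Pi_conj]
    refine (FreeGroup.norm_mul_le _ _).trans (le_of_eq ?_)
    rw [FreeGroup.norm_inv_eq]
  constructor
  · intro x
    refine Bd.sub p hp fun q => (h3 ((θ ^ q) x)).mono fun k => ?_
    rw [pow_add, MulAut.mul_apply]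
  · intro v
    refine Bd.sub p hp fun q => ((h4 (Pi v θ p)).add (h3 (Pi v θ q))).mono fun k => ?_
    rw [Pi_add, Pi_mul]
    exact FreeGroup.norm_mul_le _ _

theorem hom_lip {n m : ℕ} (f : Fn n →* Fn m) : ∃ B, ∀ g, (f g).norm ≤ B * g.norm :=
  lip (fun g => (f g).norm) (by simp) (fun x y => by
    rw [map_mul]; exact FreeGroup.norm_mul_le _ _)

end A

variable {n : ℕ}

theorem PB.conj_pow {φ : MulAut (Fn n)} (h : PB φ) {p : ℕ} (hp : 1 ≤ p) (u : Fn n) :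
    PB (MulAut.conj u * φ ^ p) := by
  intro g
  obtain ⟨C, D, hC⟩ := h g
  refine ⟨C * p ^ D, D, fun k hk => ?_⟩
  obtain ⟨v, hv⟩ := hC (p * k) (Nat.mul_pos hp hk)
  refine ⟨v * (Pi u (φ ^ p) k)⁻¹, ?_⟩
  rw [conj_pow_apply, ← pow_mul]
  rw [mul_pow, ← mul_assoc] at hv
  convert hv using 2
  group

theorem iter_comm {F G : Type} [Group F] [Group G] {ι : G →* F} {θ : MulAut G} {Ψ : MulAut F}
    (h : ∀ x, ι (θ x) = Ψ (ι x)) (k : ℕ) (x : G) : ι ((θ ^ k) x) = (Ψ ^ k) (ι x) := by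
  induction k with
  | zero => rfl
  | succ k ih => rw [pow_succ', pow_succ', MulAut.mul_apply, MulAut.mul_apply, h, ih]

theorem Pi_comm {F G : Type} [Group F] [Group G] {ι : G →* F} {θ : MulAut G} {Ψ : MulAut F}
    (h : ∀ x, ι (θ x) = Ψ (ι x)) (k : ℕ) (x : G) : ι (Pi x θ k) = Pi (ι x) Ψ k := by
  induction k with
  | zero => simp [Pi_zero]
  | succ k ih => rw [Pi_succ, Pi_succ, map_mul, h, ih]

theorem PB.restrict {a : ℕ} {Ψ : MulAut (Fn n)} {θ : MulAut (Fn a)} (hΨ : PB Ψ) {ι : Fn a →* Fn n}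
    {ρ : Fn n →* Fn a} (hρ : ∀ x, ρ (ι x) = x) (h : ∀ x, ι (θ x) = Ψ (ι x)) : PB θ := by
  intro x
  obtain ⟨C, D, hC⟩ := hΨ (ι x)
  obtain ⟨B, hB⟩ := hom_lip ρ
  refine ⟨B * C, D, fun k hk => ?_⟩
  obtain ⟨u, hu⟩ := hC k hk
  refine ⟨ρ u, ?_⟩
  have h1 := hB (u * (Ψ ^ k) (ι x) * u⁻¹)
  rw [map_mul, map_mul, map_inv, ← iter_comm h, hρ] at h1
  refine h1.trans ?_
  rw [iter_comm h, mul_assoc B]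
  exact Nat.mul_le_mul_left _ hu

theorem exists_restrict {a : ℕ} {Ψ : MulAut (Fn n)} {ι : Fn a →* Fn n}
    {ρ : Fn n →* Fn a} (hρ : ∀ x, ρ (ι x) = x) {A : Subgroup (Fn n)} (hA : ι.range = A)
    (hΨ : ∀ g, Ψ g ∈ A ↔ g ∈ A) : ∃ θ : MulAut (Fn a), ∀ x, ι (θ x) = Ψ (ι x) := by
  have hι : ∀ y ∈ A, ι (ρ y) = y := by
    intro y hy
    rw [← hA] at hy
    obtain ⟨x, rfl⟩ := hy
    rw [hρ]
  have hm : ∀ x, ι x ∈ A := fun x => by rw [← hA]; exact ⟨x, rfl⟩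
  have h1 : ∀ x, ι (ρ (Ψ (ι x))) = Ψ (ι x) := fun x => hι _ ((hΨ _).2 (hm x))
  have h2 : ∀ x, ι (ρ (Ψ⁻¹ (ι x))) = Ψ⁻¹ (ι x) := fun x => hι _ ((hΨ _).1 (by
    rw [MulAut.apply_inv_self]; exact hm x))
  refine ⟨{ toFun := fun x => ρ (Ψ (ι x)), invFun := fun x => ρ (Ψ⁻¹ (ι x)), left_inv := ?_, right_inv := ?_, map_mul' := ?_ }, h1⟩
  · intro x
    simp only [h1, MulAut.inv_apply_self, hρ]
  · intro x
    simp only [h2, MulAut.apply_inv_self, hρ]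
  · intro x y
    simp only [map_mul]

theorem retract_free (A : Subgroup (Fn n)) (r : Fn n →* Fn n) (hr : Tr.Retr A r) :
    ∃ (a : ℕ) (ι : Fn a →* Fn n) (ρ : Fn n →* Fn a), (∀ x, ρ (ι x) = x) ∧ ι.range = A ∧
      ∀ g, ι (ρ g) = r g := by
  let X := IsFreeGroup.Generators A
  let e : A ≃* FreeGroup X := IsFreeGroup.toFreeGroup A
  let R : Fn n →* A := r.codRestrict A hr.1
  have hR : ∀ x : A, R x = x := fun x => Subtype.ext (hr.2 x x.2)
  have hfin : Finite X := by
    have := homZ2_finite (n := n)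
    let c : X → (FreeGroup X →* Tr.Z2) := fun x => FreeGroup.lift (fun y => if y = x then Multiplicative.ofAdd 1 else 1)
    refine Finite.of_injective (fun x => ((c x).comp e.toMonoidHom).comp R) ?_
    intro x y hxy
    have h1 := DFunLike.congr_fun hxy ((e.symm (FreeGroup.of x) : A) : Fn n)
    simp only [MonoidHom.comp_apply, hR] at h1
    simp [c] at h1
    exact h1
  let b : X ≃ Fin (Nat.card X) := Finite.equivFin X
  let E : A ≃* Fn (Nat.card X) := e.trans (FreeGroup.freeGroupCongr b)
  refine ⟨Nat.card X, A.subtype.comp E.symm.toMonoidHom, E.toMonoidHom.comp R, ?_, ?_, ?_⟩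
  · intro x
    simp [hR]
  · ext g
    constructor
    · rintro ⟨x, rfl⟩
      exact (E.symm x).2
    · intro hg
      exact ⟨E ⟨g, hg⟩, by simp⟩
  · intro g
    simp [R]

end Cay

namespace Cay
variable {n : ℕ}

theorem homZ2_inj2 {a b n : ℕ} {Y : Type} [Finite Y] (hY : Nat.card Y = 2 ^ b)
    (f : (Fn a →* Tr.Z2) × Y → (Fn n →* Tr.Z2)) (hf : Function.Injective f) : a + b ≤ n := by
  have := homZ2_finite (n := n)
  have := homZ2_finite (n := a)
  have h := Nat.card_le_card_of_injective f hf
  rw [Nat.card_prod, homZ2_card, homZ2_card, hY, ← pow_add] at h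
  exact (Nat.pow_le_pow_iff_right (by norm_num)).1 h

theorem Bd.closure {m : ℕ} (Ψ : MulAut (Fn n)) (s : Set (Fn n)) (hs : Subgroup.closure s = ⊤)
    (h : ∀ g ∈ s, Bd m (fun k => ((Ψ ^ k) g).norm)) (g : Fn n) :
    Bd m (fun k => ((Ψ ^ k) g).norm) := by
  have hg : g ∈ Subgroup.closure s := by rw [hs]; trivial
  induction hg using Subgroup.closure_induction with
  | mem x hx => exact h x hx
  | one => exact ⟨0, fun k => by simp⟩
  | mul x y _ _ hx hy =>
    exact (hx.add hy).mono fun k => by rw [map_mul]; exact FreeGroup.norm_mul_le _ _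
  | inv x _ hx => exact hx.mono fun k => by rw [map_inv, FreeGroup.norm_inv_eq]

theorem sub_bd {a m : ℕ} (hS : Star a) (ham : a ≤ m) {Ψ : MulAut (Fn n)} (hΨ : PB Ψ) {ι : Fn a →* Fn n}
    {ρ : Fn n →* Fn a} (hρ : ∀ x, ρ (ι x) = x) {A : Subgroup (Fn n)} (hA : ι.range = A)
    (hA' : ∀ g, Ψ g ∈ A ↔ g ∈ A) : ∀ g ∈ A, Bd m (fun k => ((Ψ ^ k) g).norm) ∧
      Bd m (fun k => (Pi g Ψ k).norm) := by
  obtain ⟨θ, hθ⟩ := exists_restrict hρ hA hA'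
  obtain ⟨h1, h2⟩ := lemA hS θ (hΨ.restrict hρ hθ)
  obtain ⟨B, hB⟩ := hom_lip ι
  intro g hg
  rw [← hA] at hg
  obtain ⟨x, rfl⟩ := hg
  constructor
  · refine (((h1 x).cmul B).exp ham).mono fun k => ?_
    rw [← iter_comm hθ]
    exact hB _
  · refine (((h2 x).cmul B).exp ham).mono fun k => ?_
    rw [← Pi_comm hθ]
    exact hB _

theorem star_step (hn : 2 ≤ n) (ih : ∀ m < n, Star m) : Star n := by
  intro φ hφ
  obtain ⟨p, hp, u, h⟩ := kt hn hφ
  refine ⟨p, hp, u, ?_⟩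
  have hΨ := hφ.conj_pow hp u
  obtain ⟨Ψ, hΨe⟩ : ∃ Ψ, Ψ = MulAut.conj u * φ ^ p := ⟨_, rfl⟩
  rw [← hΨe] at h hΨ ⊢
  rcases h with ⟨A, B, rA, rB, hA, hB, hA1, hB1, hcl, hrA, hrB, hAB, hBA⟩ | ⟨A, s, rA, χ, hA, hs, hcl, hrA, hχ, hχA⟩
  · obtain ⟨a, ιA, ρA, hρA, hιA, hA3⟩ := retract_free A rA hrA
    obtain ⟨b, ιB, ρB, hρB, hιB, hB3⟩ := retract_free B rB hrB
    have zA : ∀ x, ρA (ιB x) = 1 := fun x => by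
      have h1 : ιA (ρA (ιB x)) = 1 := by
        rw [hA3]; exact hAB _ (by rw [← hιB]; exact ⟨x, rfl⟩)
      rw [← hρA (ρA (ιB x)), h1, map_one]
    have zB : ∀ x, ρB (ιA x) = 1 := fun x => by
      have h1 : ιB (ρB (ιA x)) = 1 := by
        rw [hB3]; exact hBA _ (by rw [← hιA]; exact ⟨x, rfl⟩)
      rw [← hρB (ρB (ιA x)), h1, map_one]
    have pos : ∀ (c : ℕ) (ι : Fn c →* Fn n) (C : Subgroup (Fn n)), ι.range = C → C ≠ ⊥ → 1 ≤ c := by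
      intro c ι C h1 h2
      by_contra hc
      obtain rfl : c = 0 := by omega
      apply h2
      rw [← h1, eq_bot_iff]
      rintro _ ⟨x, rfl⟩
      rw [Subsingleton.elim x 1, map_one]
      exact Subgroup.one_mem _
    have ha := pos a ιA A hιA hA1
    have hb := pos b ιB B hιB hB1
    have hab : a + b ≤ n := by
      have := homZ2_finite (n := b)
      refine homZ2_inj2 (Y := Fn b →* Tr.Z2) homZ2_card
        (fun c => c.1.comp ρA * c.2.comp ρB) ?_
      rintro ⟨α, β⟩ ⟨α', β'⟩ h
      have hα : α = α' := by
        ext1 x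
        have := DFunLike.congr_fun h (ιA (FreeGroup.of x))
        simpa [hρA, zB] using this
      have hβ : β = β' := by
        ext1 x
        have := DFunLike.congr_fun h (ιB (FreeGroup.of x))
        simpa [hρB, zA] using this
      rw [hα, hβ]
    refine Bd.closure Ψ _ hcl ?_
    rintro g (hg | hg)
    · exact (sub_bd (ih a (by omega)) (by omega) hΨ hρA hιA hA g hg).1
    · exact (sub_bd (ih b (by omega)) (by omega) hΨ hρB hιB hB g hg).1
  · obtain ⟨a, ι, ρ, hρ, hι, hA3⟩ := retract_free A rA hrA
    have hab : a + 1 ≤ n := by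
      refine homZ2_inj2 (Y := Bool) (by simp)
        (fun c => c.1.comp ρ * (if c.2 then χ else 1)) ?_
      rintro ⟨α, i⟩ ⟨α', i'⟩ h
      have hα : α = α' := by
        ext1 x
        have := DFunLike.congr_fun h (ι (FreeGroup.of x))
        have h1 : χ (ι (FreeGroup.of x)) = 1 := hχA _ (by rw [← hι]; exact ⟨_, rfl⟩)
        cases i <;> cases i' <;> simpa [hρ, h1] using this
      subst hα
      have := DFunLike.congr_fun h s
      cases i <;> cases i' <;> simp_all
    refine Bd.closure Ψ _ hcl ?_
    have hsub := sub_bd (ih a (by omega)) (m := n - 1) (by omega) hΨ hρ hι hA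
    rintro g (hg | hg)
    · exact (hsub g hg).1
    · rw [Set.mem_singleton_iff] at hg
      subst hg
      have hk : ∀ k, (Ψ ^ k) g = g * Pi (g⁻¹ * Ψ g) Ψ k := by
        intro k
        induction k with
        | zero => simp [Pi_zero]
        | succ k ih => rw [pow_succ', MulAut.mul_apply, ih, map_mul, Pi_succ]; group
      have hc : Bd (n - 1) (fun _ => g.norm) :=
        ⟨g.norm, fun k => Nat.le_mul_of_pos_right _ (by positivity)⟩
      refine (hc.add (hsub _ hs).2).mono fun k => ?_
      rw [hk]
      exact FreeGroup.norm_mul_le _ _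

theorem star_one : Star 1 := by
  intro φ _
  obtain ⟨x, hx⟩ : ∃ x : Fn 1, x = FreeGroup.of 0 := ⟨_, rfl⟩
  have hgen : Subgroup.zpowers x = ⊤ := by
    rw [Subgroup.zpowers_eq_closure, ← FreeGroup.closure_range_of (Fin 1)]
    congr 1
    ext y
    simp only [Set.mem_singleton_iff, Set.mem_range]
    constructor
    · rintro rfl; exact ⟨0, hx.symm⟩
    · rintro ⟨i, rfl⟩; rw [hx, Subsingleton.elim i 0]
  have hex : ∀ y : Fn 1, ∃ m : ℤ, x ^ m = y := fun y => by
    have : y ∈ Subgroup.zpowers x := by rw [hgen]; trivial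
    exact this
  obtain ⟨m, hm⟩ := hex (φ x)
  obtain ⟨l, hl⟩ := hex (φ⁻¹ x)
  have h1 : x ^ (m * l) = x ^ (1 : ℤ) := by
    rw [zpow_mul, hm, ← map_zpow, hl, MulAut.apply_inv_self, zpow_one]
  have h2 : m * l = 1 := by
    have := congrArg (FreeGroup.lift (fun _ : Fin 1 => Multiplicative.ofAdd (1 : ℤ))) h1
    rw [map_zpow, map_zpow, hx, FreeGroup.lift_apply_of] at this
    have := congrArg Multiplicative.toAdd this
    simpa using this
  have h3 : m * m = 1 := by
    rcases Int.isUnit_iff.1 (IsUnit.of_mul_eq_one l h2) with rfl | rfl <;> rfl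
  have h4 : (φ ^ 2) x = x := by
    rw [pow_two, MulAut.mul_apply, ← hm, map_zpow, ← hm, ← zpow_mul, h3, zpow_one]
  have h5 : φ ^ 2 = 1 := by
    ext1 y
    obtain ⟨j, rfl⟩ := hex y
    rw [map_zpow, h4]; rfl
  refine ⟨2, by norm_num, 1, fun g => ⟨g.norm, fun k => ?_⟩⟩
  simp [h5]

theorem star (n : ℕ) : Star n := by
  induction n using Nat.strong_induction_on with
  | _ n ih =>
    match n, ih with
    | 0, _ =>
      refine fun φ _ => ⟨1, le_rfl, 1, fun g => ⟨0, fun k => ?_⟩⟩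
      have h0 : ∀ x : Fn 0, x.norm = 0 := fun x => by
        rw [FreeGroup.norm_eq_zero]; exact Subsingleton.elim _ _
      simp [h0]
    | 1, _ => exact star_one
    | n + 2, ih => exact star_step (by omega) ih

theorem conjLength_spec (g : Fn n) : ∃ h : Fn n, (h * g * h⁻¹).norm = conjLength g :=
  Nat.sInf_mem (s := {m : ℕ | ∃ h : Fn n, ((h * g * h⁻¹).toWord).length = m}) ⟨_, 1, rfl⟩

theorem conjLength_le (g h : Fn n) : conjLength g ≤ (h * g * h⁻¹).norm :=
  Nat.sInf_le ⟨h, rfl⟩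

theorem final {n d : ℕ} {φ : MulAut (Fn n)} (h : AutGrowsPolyDeg φ d) : d ≤ n - 1 := by
  obtain ⟨hub, g, C1, _, hC1, _, hlow⟩ := h
  have hPB : PB φ := by
    intro g
    obtain ⟨C, hC, hk⟩ := hub g
    refine ⟨⌈C⌉₊, d, fun k hk1 => ?_⟩
    obtain ⟨u, hu⟩ := conjLength_spec ((φ ^ k) g)
    refine ⟨u, ?_⟩
    rw [hu]
    have h1 := hk k hk1
    have h2 : C * (k : ℝ) ^ d ≤ ⌈C⌉₊ * (k : ℝ) ^ d :=
      mul_le_mul_of_nonneg_right (Nat.le_ceil C) (by positivity)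
    exact_mod_cast h1.trans h2
  obtain ⟨p, hp, w, hw⟩ := star n φ hPB
  obtain ⟨C, hC⟩ := hw g
  by_contra hlt
  push Not at hlt
  have key : ∀ k : ℕ, 1 ≤ k → C1 * k ≤ C * 2 ^ (n - 1) := by
    intro k hk
    have h1 := (hlow (p * k) (Nat.mul_pos hp hk)).1
    have h2 := hC k
    simp only [conj_pow_apply, ← pow_mul] at h2
    have h3 := (conjLength_le ((φ ^ (p * k)) g) _).trans h2
    have h4 : C * (k + 1) ^ (n - 1) ≤ C * (2 ^ (n - 1) * k ^ (n - 1)) := by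
      rw [← mul_pow]
      exact Nat.mul_le_mul_left _ (Nat.pow_le_pow_left (by omega) _)
    have h5 : (conjLength ((φ ^ (p * k)) g) : ℝ) ≤ C * (2 ^ (n - 1) * (k : ℝ) ^ (n - 1)) := by
      exact_mod_cast h3.trans h4
    have hk0 : (0 : ℝ) < k := by exact_mod_cast hk
    have hk1 : (1 : ℝ) ≤ k := by exact_mod_cast hk
    have h6 : (k : ℝ) ^ (n - 1) * k ≤ ((p * k : ℕ) : ℝ) ^ d := by
      rw [← pow_succ]
      have : (k : ℝ) ^ d ≤ ((p * k : ℕ) : ℝ) ^ d := by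
        gcongr
        exact Nat.le_mul_of_pos_left _ hp
      exact (pow_le_pow_right₀ hk1 (by omega)).trans this
    have h7 : C1 * ((k : ℝ) ^ (n - 1) * k) ≤ C * (2 ^ (n - 1) * (k : ℝ) ^ (n - 1)) :=
      (mul_le_mul_of_nonneg_left h6 hC1.le).trans (h1.trans h5)
    have h8 : (0 : ℝ) < (k : ℝ) ^ (n - 1) := by positivity
    refine le_of_mul_le_mul_right ?_ h8
    calc C1 * k * (k : ℝ) ^ (n - 1) = C1 * ((k : ℝ) ^ (n - 1) * k) := by ring
      _ ≤ _ := h7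
      _ = _ := by ring
  obtain ⟨k, hk⟩ := exists_nat_gt ((C * 2 ^ (n - 1) : ℝ) / C1)
  have h1 := key (k + 1) (by omega)
  rw [div_lt_iff₀ hC1] at hk
  push_cast at h1
  nlinarith

end Cay

/-- If `φ` grows polynomially of degree `d`, then `d ≤ n - 1`. -/
theorem polyGrowth_degree_le (n : ℕ) (hn : 1 ≤ n) (φ : MulAut (FreeGroup (Fin n))) (d : ℕ)
    (h : AutGrowsPolyDeg φ d) : d ≤ n - 1 := by
  exact Cay.final h
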